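/- Direct coding part of the main theorem: Let ρ^{AB} be a bipartite quantum state on finite-dimensional systems with purification Ψ^{ABE}, and let Λ : H_A → H_Y be any POVM on Alice's system, with σ^{YBE} = (Λ ⊗ I^{BE})(Ψ^{ABE}). Then the rate pair (P, R) = (κ(ρ^A) + κ(ρ^B) + I(Y;B)_σ , I(Y;BE)_σ) is achievable by local purity distillation protocols; consequently every P ≤ κ*_→(ρ^{AB},R) corresponds to an achievable rate pair (P,R). -/

import Mathlib

noncomputable section
namespace LPD

open Matrix Kronecker BigOperators Filter Finset
open scoped ComplexOrder

/-- The positive semidefinite square root of a positive semidefinite matrix. -/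
def _root_.Matrix.PosSemidef.sqrt {n 𝕜 : Type*} [Fintype n] [RCLike 𝕜] [DecidableEq n]
    {A : Matrix n n 𝕜} (hA : A.PosSemidef) : Matrix n n 𝕜 :=
  hA.1.eigenvectorUnitary.1 * diagonal ((↑) ∘ Real.sqrt ∘ hA.1.eigenvalues) *
    (star hA.1.eigenvectorUnitary : Matrix n n 𝕜)

/-- The trace norm `‖ω‖₁ = Tr √(ωᴴ ω)` of a matrix. -/
def traceNorm {ι : Type*} [Fintype ι] [DecidableEq ι] (ω : Matrix ι ι ℂ) : ℝ :=
  ((Matrix.posSemidef_conjTranspose_mul_self ω).sqrt).trace.re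

/-- A density operator: positive semidefinite with trace one. -/
def IsDensity {ι : Type*} [Fintype ι] (ρ : Matrix ι ι ℂ) : Prop :=
  ρ.PosSemidef ∧ ρ.trace = 1

/-- The von Neumann entropy `H(ρ) = -Tr(ρ log ρ)`, expressed via eigenvalues
(with the convention `0 log 0 = 0`, and junk value `0` on non-Hermitian input). -/
def entropy {ι : Type*} [Fintype ι] [DecidableEq ι] (ρ : Matrix ι ι ℂ) : ℝ :=
  letI := Classical.dec ρ.IsHermitian
  if h : ρ.IsHermitian then -∑ i, h.eigenvalues i * Real.log (h.eigenvalues i) else 0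

/-- Partial trace over the first (left) tensor factor. -/
def ptraceLeft {α β : Type*} [Fintype α] (ρ : Matrix (α × β) (α × β) ℂ) : Matrix β β ℂ :=
  fun b b' => ∑ a, ρ (a, b) (a, b')

/-- Partial trace over the second (right) tensor factor. -/
def ptraceRight {α β : Type*} [Fintype β] (ρ : Matrix (α × β) (α × β) ℂ) : Matrix α α ℂ :=
  fun a a' => ∑ b, ρ (a, b) (a', b)

/-- Quantum mutual information `I(A;B) = H(A) + H(B) - H(AB)` of a bipartite state. -/
def mutualInfo {α β : Type*} [Fintype α] [DecidableEq α] [Fintype β] [DecidableEq β]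
    (ρ : Matrix (α × β) (α × β) ℂ) : ℝ :=
  entropy (ptraceRight ρ) + entropy (ptraceLeft ρ) - entropy ρ

/-- Conditional entropy `H(B|A) = H(AB) - H(A)` (second system conditioned on the first). -/
def condEntropySnd {α β : Type*} [Fintype α] [DecidableEq α] [Fintype β] [DecidableEq β]
    (ρ : Matrix (α × β) (α × β) ℂ) : ℝ :=
  entropy ρ - entropy (ptraceRight ρ)

/-- Conditional entropy `H(A|B) = H(AB) - H(B)` (first system conditioned on the second). -/
def condEntropyFst {α β : Type*} [Fintype α] [DecidableEq α] [Fintype β] [DecidableEq β]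
    (ρ : Matrix (α × β) (α × β) ℂ) : ℝ :=
  entropy ρ - entropy (ptraceLeft ρ)

/-- `n`-fold tensor power of a matrix. -/
def tpow {ι : Type*} (ρ : Matrix ι ι ℂ) (n : ℕ) : Matrix (Fin n → ι) (Fin n → ι) ℂ :=
  fun x y => ∏ k, ρ (x k) (y k)

/-- `n`-fold tensor power of a bipartite state, with the `A` and `B` factors collected. -/
def tpowAB {α β : Type*} (ρ : Matrix (α × β) (α × β) ℂ) (n : ℕ) :
    Matrix ((Fin n → α) × (Fin n → β)) ((Fin n → α) × (Fin n → β)) ℂ :=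
  Matrix.reindex (Equiv.arrowProdEquivProdArrow (Fin n) (fun _ => α) (fun _ => β))
    (Equiv.arrowProdEquivProdArrow (Fin n) (fun _ => α) (fun _ => β)) (tpow ρ n)

/-- A POVM on the system `ι` with outcome set `κ`. -/
structure POVM (ι κ : Type*) [Fintype ι] [DecidableEq ι] [Fintype κ] where
  elem : κ → Matrix ι ι ℂ
  pos : ∀ y, (elem y).PosSemidef
  sum_eq : ∑ y, elem y = 1

/-- Apply a POVM to the first factor of a bipartite state, recording the outcome in a
classical register: `ρ^{AΓ} ↦ Σ_y |y⟩⟨y| ⊗ Tr_A((Λ_y ⊗ 1)ρ)`. -/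
def measureLeft {ι κ γ : Type*} [Fintype ι] [DecidableEq ι] [Fintype κ] [DecidableEq κ]
    (Λ : POVM ι κ) (ρ : Matrix (ι × γ) (ι × γ) ℂ) : Matrix (κ × γ) (κ × γ) ℂ :=
  fun p q => if p.1 = q.1 then ∑ a, ∑ a', (Λ.elem p.1) a a' * ρ (a', p.2) (a, q.2) else 0

/-- The canonical purification of a density operator `ρ` on `ι`, a pure state on `ι × ι`
(junk value `0` for non-positive-semidefinite input). -/
def canonicalPurification {ι : Type*} [Fintype ι] [DecidableEq ι] (ρ : Matrix ι ι ℂ) :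
    Matrix (ι × ι) (ι × ι) ℂ :=
  letI := Classical.dec ρ.PosSemidef
  if h : ρ.PosSemidef then
    vecMulVec (fun p => h.sqrt p.1 p.2) (star fun p => h.sqrt p.1 p.2)
  else 0

/-- The purity `κ(ρ) = log d - H(ρ)`. -/
def kappa {ι : Type*} [Fintype ι] [DecidableEq ι] (ρ : Matrix ι ι ℂ) : ℝ :=
  Real.log (Fintype.card ι) - entropy ρ

/-- The pure state `|0⟩⟨0|` on a `d`-dimensional system. -/
def pureZero (d : ℕ) : Matrix (Fin d) (Fin d) ℂ :=
  fun i j => if i.val = 0 ∧ j.val = 0 then 1 else 0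

/-! ### Index bookkeeping equivalences -/

/-- `(a × b) × c ≃ (a × c) × b`. -/
def swapE (a b c : Type*) : (a × b) × c ≃ (a × c) × b where
  toFun x := ((x.1.1, x.2), x.1.2)
  invFun x := ((x.1.1, x.2), x.1.2)
  left_inv _ := rfl
  right_inv _ := rfl

/-- Pull the `Y` register to the front: `((a × y) × g) × b ≃ y × ((a × g) × b)`. -/
def pullY (a y g b : Type*) : ((a × y) × g) × b ≃ y × ((a × g) × b) where
  toFun x := (x.1.1.2, ((x.1.1.1, x.1.2), x.2))
  invFun x := (((x.2.1.1, x.1), x.2.1.2), x.2.2)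
  left_inv _ := rfl
  right_inv _ := rfl

/-- Rearrange for Bob's unitary: `((a × y) × g) × b ≃ (b × y) × (a × g)`. -/
def pullBY (a y g b : Type*) : ((a × y) × g) × b ≃ (b × y) × (a × g) where
  toFun x := ((x.2, x.1.1.2), (x.1.1.1, x.1.2))
  invFun x := (((x.2.1, x.1.2), x.2.2), x.1.1)
  left_inv _ := rfl
  right_inv _ := rfl

/-- Collect `Y` and `B` together: `((a × y) × g) × b ≃ (y × b) × (a × g)`. -/
def pullYB (a y g b : Type*) : ((a × y) × g) × b ≃ (y × b) × (a × g) where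
  toFun x := ((x.1.1.2, x.2), (x.1.1.1, x.1.2))
  invFun x := (((x.2.1, x.1.1), x.2.2), x.1.2)
  left_inv _ := rfl
  right_inv _ := rfl

/-- Sort output registers: `(bp × bg) × (ap × ag) ≃ (ap × bp) × (ag × bg)`. -/
def sortOut (bp bg ap ag : Type*) : (bp × bg) × (ap × ag) ≃ (ap × bp) × (ag × bg) where
  toFun x := ((x.2.1, x.1.1), (x.2.2, x.1.2))
  invFun x := ((x.1.2, x.2.2), (x.1.1, x.2.1))
  left_inv _ := rfl
  right_inv _ := rfl

/-- `y × (x × w) ≃ (y × w) × x`. -/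
def exYW (y x w : Type*) : y × (x × w) ≃ (y × w) × x where
  toFun a := ((a.1, a.2.2), a.2.1)
  invFun a := (a.1.1, (a.2, a.1.2))
  left_inv _ := rfl
  right_inv _ := rfl

/-- `y × (x × w) ≃ (y × x) × w`. -/
def exYX (y x w : Type*) : y × (x × w) ≃ (y × x) × w where
  toFun a := ((a.1, a.2.1), a.2.2)
  invFun a := (a.1.1, (a.1.2, a.2))
  left_inv _ := rfl
  right_inv _ := rfl

/-- `y × (x × (b × e)) ≃ (y × b) × (x × e)`. -/
def exYB (y x b e : Type*) : y × (x × (b × e)) ≃ (y × b) × (x × e) where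
  toFun a := ((a.1, a.2.2.1), (a.2.1, a.2.2.2))
  invFun a := (a.1.1, (a.2.1, (a.1.2, a.2.2)))
  left_inv _ := rfl
  right_inv _ := rfl

/-! ### The state `σ^{YBE}` obtained by measuring Alice's share of a purification -/

/-- The canonical purification of a bipartite state `ρ^{AB}`, with indices arranged as
`A × (B × E)` where `E = A × B`. -/
def purifyAssoc {α β : Type*} [Fintype α] [DecidableEq α] [Fintype β] [DecidableEq β]
    (ρ : Matrix (α × β) (α × β) ℂ) :
    Matrix (α × (β × (α × β))) (α × (β × (α × β))) ℂ :=
  Matrix.reindex (Equiv.prodAssoc α β (α × β)) (Equiv.prodAssoc α β (α × β))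
    (canonicalPurification ρ)

/-- `σ^{YBE} = (Λ ⊗ 1^{BE})(Ψ^{ABE})` for the canonical purification `Ψ` of `ρ^{AB}`. -/
def sigmaOf {α β κ : Type*} [Fintype α] [DecidableEq α] [Fintype β] [DecidableEq β]
    [Fintype κ] [DecidableEq κ] (ρ : Matrix (α × β) (α × β) ℂ) (Λ : POVM α κ) :
    Matrix (κ × (β × (α × β))) (κ × (β × (α × β))) ℂ :=
  measureLeft Λ (purifyAssoc ρ)

/-- `I(Y;B)` evaluated on a state of the form `σ^{Y(BE)}`: trace out `E`, then take the
mutual information. -/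
def IYB {κ β ε : Type*} [Fintype κ] [DecidableEq κ] [Fintype β] [DecidableEq β] [Fintype ε]
    (σ : Matrix (κ × (β × ε)) (κ × (β × ε)) ℂ) : ℝ :=
  mutualInfo (ptraceRight (Matrix.reindex (Equiv.prodAssoc κ β ε).symm
    (Equiv.prodAssoc κ β ε).symm σ))

/-- `I(Y;BE)` evaluated on a state of the form `σ^{Y(BE)}`. -/
def IYBE {κ β ε : Type*} [Fintype κ] [DecidableEq κ] [Fintype β] [DecidableEq β] [Fintype ε]
    [DecidableEq ε] (σ : Matrix (κ × (β × ε)) (κ × (β × ε)) ℂ) : ℝ :=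
  mutualInfo σ

/-- `P^{(1)}_→(ρ^{AB}, R) = max_Λ { I(Y;B)_σ : I(Y;BE)_σ ≤ R }`, the maximum over all
POVMs on Alice's system. -/
def P1 {α β : Type*} [Fintype α] [DecidableEq α] [Fintype β] [DecidableEq β]
    (ρ : Matrix (α × β) (α × β) ℂ) (R : ℝ) : ℝ :=
  sSup { v : ℝ | ∃ (m : ℕ) (Λ : POVM α (Fin m)),
    IYBE (sigmaOf ρ Λ) ≤ R ∧ v = IYB (sigmaOf ρ Λ) }

/-! ### Local purity distillation protocols -/

/-- An `(n, ·, ·, ·)` local purity distillation protocol: Alice's unitary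
`U_A : H_{A^n} ⊗ H_C → H_{A_p} ⊗ H_Y ⊗ H_{A_g}`, a dephasing channel on `Y`
(applied below), and Bob's unitary `U_B : H_{B^n} ⊗ H_Y → H_{B_p} ⊗ H_{B_g}`. -/
structure Protocol (α β : Type*) [Fintype α] [DecidableEq α] [Fintype β] [DecidableEq β]
    (n : ℕ) where
  dC : ℕ
  dAp : ℕ
  dY : ℕ
  dAg : ℕ
  dBp : ℕ
  dBg : ℕ
  dC_pos : 0 < dC
  dAp_pos : 0 < dAp
  dY_pos : 0 < dY
  dAg_pos : 0 < dAg
  dBp_pos : 0 < dBp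
  dBg_pos : 0 < dBg
  UA : Matrix ((Fin dAp × Fin dY) × Fin dAg) ((Fin n → α) × Fin dC) ℂ
  UA_unitary : UAᴴ * UA = 1 ∧ UA * UAᴴ = 1
  UB : Matrix (Fin dBp × Fin dBg) ((Fin n → β) × Fin dY) ℂ
  UB_unitary : UBᴴ * UB = 1 ∧ UB * UBᴴ = 1

variable {α β : Type*} [Fintype α] [DecidableEq α] [Fintype β] [DecidableEq β]

/-- The input state `(ρ^{AB})^{⊗n} ⊗ |0⟩⟨0|^C`, arranged as `(A^n × C) × B^n`. -/
def inputState (ρ : Matrix (α × β) (α × β) ℂ) {n : ℕ} (Pr : Protocol α β n) :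
    Matrix (((Fin n → α) × Fin Pr.dC) × (Fin n → β))
      (((Fin n → α) × Fin Pr.dC) × (Fin n → β)) ℂ :=
  Matrix.reindex (swapE (Fin n → α) (Fin n → β) (Fin Pr.dC))
    (swapE (Fin n → α) (Fin n → β) (Fin Pr.dC)) (tpowAB ρ n ⊗ₖ pureZero Pr.dC)

/-- The state `U_A((ρ^{AB})^{⊗n} ⊗ |0⟩⟨0|^C)` (before dephasing), on
`((A_p × Y) × A_g) × B^n`. -/
def stateAfterUA (ρ : Matrix (α × β) (α × β) ℂ) {n : ℕ} (Pr : Protocol α β n) :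
    Matrix (((Fin Pr.dAp × Fin Pr.dY) × Fin Pr.dAg) × (Fin n → β))
      (((Fin Pr.dAp × Fin Pr.dY) × Fin Pr.dAg) × (Fin n → β)) ℂ :=
  (Pr.UA ⊗ₖ (1 : Matrix (Fin n → β) (Fin n → β) ℂ)) * inputState ρ Pr *
    (Pr.UA ⊗ₖ (1 : Matrix (Fin n → β) (Fin n → β) ℂ))ᴴ

/-- Dephase the first tensor factor in a fixed basis. -/
def dephaseFst {κ γ : Type*} [DecidableEq κ] (ρ : Matrix (κ × γ) (κ × γ) ℂ) :
    Matrix (κ × γ) (κ × γ) ℂ :=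
  fun p q => if p.1 = q.1 then ρ p q else 0

/-- The state after Alice's unitary and the dephasing channel on `Y`. -/
def stateAfterDephasing (ρ : Matrix (α × β) (α × β) ℂ) {n : ℕ} (Pr : Protocol α β n) :
    Matrix (((Fin Pr.dAp × Fin Pr.dY) × Fin Pr.dAg) × (Fin n → β))
      (((Fin Pr.dAp × Fin Pr.dY) × Fin Pr.dAg) × (Fin n → β)) ℂ :=
  Matrix.reindex (pullY (Fin Pr.dAp) (Fin Pr.dY) (Fin Pr.dAg) (Fin n → β)).symm
    (pullY (Fin Pr.dAp) (Fin Pr.dY) (Fin Pr.dAg) (Fin n → β)).symm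
    (dephaseFst (Matrix.reindex (pullY (Fin Pr.dAp) (Fin Pr.dY) (Fin Pr.dAg) (Fin n → β))
      (pullY (Fin Pr.dAp) (Fin Pr.dY) (Fin Pr.dAg) (Fin n → β)) (stateAfterUA ρ Pr)))

/-- The final state `Υ`, after Bob's unitary, on `(B_p × B_g) × (A_p × A_g)`. -/
def stateAfterUB (ρ : Matrix (α × β) (α × β) ℂ) {n : ℕ} (Pr : Protocol α β n) :
    Matrix ((Fin Pr.dBp × Fin Pr.dBg) × (Fin Pr.dAp × Fin Pr.dAg))
      ((Fin Pr.dBp × Fin Pr.dBg) × (Fin Pr.dAp × Fin Pr.dAg)) ℂ :=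
  (Pr.UB ⊗ₖ (1 : Matrix (Fin Pr.dAp × Fin Pr.dAg) (Fin Pr.dAp × Fin Pr.dAg) ℂ)) *
    Matrix.reindex (pullBY (Fin Pr.dAp) (Fin Pr.dY) (Fin Pr.dAg) (Fin n → β))
      (pullBY (Fin Pr.dAp) (Fin Pr.dY) (Fin Pr.dAg) (Fin n → β)) (stateAfterDephasing ρ Pr) *
    (Pr.UB ⊗ₖ (1 : Matrix (Fin Pr.dAp × Fin Pr.dAg) (Fin Pr.dAp × Fin Pr.dAg) ℂ))ᴴ

/-- The reduced output state `Υ^{A_p B_p}`. -/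
def outputReduced (ρ : Matrix (α × β) (α × β) ℂ) {n : ℕ} (Pr : Protocol α β n) :
    Matrix (Fin Pr.dAp × Fin Pr.dBp) (Fin Pr.dAp × Fin Pr.dBp) ℂ :=
  ptraceRight (Matrix.reindex
    (sortOut (Fin Pr.dBp) (Fin Pr.dBg) (Fin Pr.dAp) (Fin Pr.dAg))
    (sortOut (Fin Pr.dBp) (Fin Pr.dBg) (Fin Pr.dAp) (Fin Pr.dAg)) (stateAfterUB ρ Pr))

/-- The error of a protocol: trace distance of `Υ^{A_p B_p}` from `|0⟩⟨0| ⊗ |0⟩⟨0|`. -/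
def protocolError (ρ : Matrix (α × β) (α × β) ℂ) {n : ℕ} (Pr : Protocol α β n) : ℝ :=
  traceNorm (outputReduced ρ Pr - pureZero Pr.dAp ⊗ₖ pureZero Pr.dBp)

/-- The classical communication rate `(1/n) log d_Y` of a protocol. -/
def commRate {n : ℕ} (Pr : Protocol α β n) : ℝ := Real.log Pr.dY / n

/-- The purity rate `(1/n)(log d_{A_p}d_{B_p} - log d_C)` of a protocol. -/
def purityRate {n : ℕ} (Pr : Protocol α β n) : ℝ :=
  (Real.log (Pr.dAp * Pr.dBp) - Real.log Pr.dC) / n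

/-- Achievability of a rate pair `(P, R)`: for all `ε, δ > 0` and all sufficiently large `n`
there is an `(n, R+δ, P-δ, ε)` protocol. -/
def Achievable (ρ : Matrix (α × β) (α × β) ℂ) (P R : ℝ) : Prop :=
  ∀ ε > (0 : ℝ), ∀ δ > (0 : ℝ), ∃ N : ℕ, ∀ n ≥ N, ∃ Pr : Protocol α β n,
    commRate Pr ≤ R + δ ∧ P - δ ≤ purityRate Pr ∧ protocolError ρ Pr ≤ ε

/-- The 1-way distillable local purity `κ_→(ρ^{AB}, R)`. -/
def kappaArrow (ρ : Matrix (α × β) (α × β) ℂ) (R : ℝ) : ℝ :=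
  sSup { P : ℝ | Achievable ρ P R }

/-- `I(Y;B^n)` on the pre-dephasing state `U_A((ρ^{AB})^{⊗n} ⊗ |0⟩⟨0|^C)`. -/
def preDephIYB (ρ : Matrix (α × β) (α × β) ℂ) {n : ℕ} (Pr : Protocol α β n) : ℝ :=
  mutualInfo (ptraceRight (Matrix.reindex
    (pullYB (Fin Pr.dAp) (Fin Pr.dY) (Fin Pr.dAg) (Fin n → β))
    (pullYB (Fin Pr.dAp) (Fin Pr.dY) (Fin Pr.dAg) (Fin n → β)) (stateAfterUA ρ Pr)))

/-- The pre-dephasing state together with the purifying environment `E^n`: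
`(U_A ⊗ 1^{B^nE^n})((Ψ^{ABE})^{⊗n} ⊗ |0⟩⟨0|^C)`, where `Ψ` is the canonical purification. -/
def preDephWithEnv (ρ : Matrix (α × β) (α × β) ℂ) {n : ℕ} (Pr : Protocol α β n) :
    Matrix (((Fin Pr.dAp × Fin Pr.dY) × Fin Pr.dAg) × (Fin n → β × (α × β)))
      (((Fin Pr.dAp × Fin Pr.dY) × Fin Pr.dAg) × (Fin n → β × (α × β))) ℂ :=
  (Pr.UA ⊗ₖ (1 : Matrix (Fin n → β × (α × β)) (Fin n → β × (α × β)) ℂ)) *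
    Matrix.reindex (swapE (Fin n → α) (Fin n → β × (α × β)) (Fin Pr.dC))
      (swapE (Fin n → α) (Fin n → β × (α × β)) (Fin Pr.dC))
      (tpowAB (purifyAssoc ρ) n ⊗ₖ pureZero Pr.dC) *
    (Pr.UA ⊗ₖ (1 : Matrix (Fin n → β × (α × β)) (Fin n → β × (α × β)) ℂ))ᴴ

/-- `I(Y;B^nE^n)` on the pre-dephasing state, including the purifying environment. -/
def preDephIYBE (ρ : Matrix (α × β) (α × β) ℂ) {n : ℕ} (Pr : Protocol α β n) : ℝ :=
  mutualInfo (ptraceRight (Matrix.reindex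
    (pullYB (Fin Pr.dAp) (Fin Pr.dY) (Fin Pr.dAg) (Fin n → β × (α × β)))
    (pullYB (Fin Pr.dAp) (Fin Pr.dY) (Fin Pr.dAg) (Fin n → β × (α × β)))
    (preDephWithEnv ρ Pr)))

/-- `H(Y)` on the pre-dephasing state. -/
def preDephHY (ρ : Matrix (α × β) (α × β) ℂ) {n : ℕ} (Pr : Protocol α β n) : ℝ :=
  entropy (ptraceRight (Matrix.reindex
    (pullY (Fin Pr.dAp) (Fin Pr.dY) (Fin Pr.dAg) (Fin n → β))
    (pullY (Fin Pr.dAp) (Fin Pr.dY) (Fin Pr.dAg) (Fin n → β)) (stateAfterUA ρ Pr)))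

/-! ### Single-party purity concentration -/

/-- An `(n, ·, ·)` purity concentration protocol: a unitary
`U : H_{A^n} → H_{A_p} ⊗ H_{A_g}`. -/
structure ConcProtocol (α : Type*) [Fintype α] [DecidableEq α] (n : ℕ) where
  dAp : ℕ
  dAg : ℕ
  dAp_pos : 0 < dAp
  dAg_pos : 0 < dAg
  U : Matrix (Fin dAp × Fin dAg) (Fin n → α) ℂ
  U_unitary : Uᴴ * U = 1 ∧ U * Uᴴ = 1

/-- The reduced state `Υ^{A_p}` of `U ρ^{⊗n} U†`. -/
def concOutput {α : Type*} [Fintype α] [DecidableEq α] (ρ : Matrix α α ℂ) {n : ℕ}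
    (Pr : ConcProtocol α n) : Matrix (Fin Pr.dAp) (Fin Pr.dAp) ℂ :=
  ptraceRight (Pr.U * tpow ρ n * Pr.Uᴴ)

/-- Achievability of a purity-concentration rate `P`. -/
def ConcAchievable {α : Type*} [Fintype α] [DecidableEq α] (ρ : Matrix α α ℂ) (P : ℝ) :
    Prop :=
  ∀ ε > (0 : ℝ), ∀ δ > (0 : ℝ), ∃ N : ℕ, ∀ n ≥ N, ∃ Pr : ConcProtocol α n,
    P - δ ≤ Real.log Pr.dAp / n ∧ traceNorm (concOutput ρ Pr - pureZero Pr.dAp) ≤ ε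

/-- The purity `κ(ρ)`: the supremum of all achievable concentration rates. -/
def kappaConc {α : Type*} [Fintype α] [DecidableEq α] (ρ : Matrix α α ℂ) : ℝ :=
  sSup { P : ℝ | ConcAchievable ρ P }

/-! ### Measurement compression -/

/-- The averaged compressed-measurement map
`σ ↦ (1/|L|) Σ_l Σ_m Tr(Λ̃^{(l)}_m σ) |f(m,l)⟩⟨f(m,l)|`, applied to the first factor. -/
def mcMap {A Ω γ' : Type*} [Fintype A] [DecidableEq A] [Fintype Ω] [DecidableEq Ω]
    (L M : ℕ) (Λt : Fin L → POVM A (Fin M)) (f : Fin M → Fin L → Ω)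
    (ρ : Matrix (A × γ') (A × γ') ℂ) : Matrix (Ω × γ') (Ω × γ') ℂ :=
  fun p q => (L : ℂ)⁻¹ * ∑ l, ∑ m, (if f m l = p.1 ∧ f m l = q.1 then 1 else 0) *
    ∑ a, ∑ a', ((Λt l).elem m) a a' * ρ (a', p.2) (a, q.2)

/-! ### Classical-quantum states and classical channels -/

/-- The classical-quantum state `Σ_x p(x) |x⟩⟨x| ⊗ ρ_x`. -/
def cqState {𝒳 B : Type*} [DecidableEq 𝒳] (p : 𝒳 → ℝ) (ρx : 𝒳 → Matrix B B ℂ) :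
    Matrix (𝒳 × B) (𝒳 × B) ℂ :=
  fun P Q => if P.1 = Q.1 then (p P.1 : ℂ) * ρx P.1 P.2 Q.2 else 0

/-- The state on `Y × (X × W)` obtained from a purification vector `ψ` of a cq state
(with classical system `X` and the rest `W`) by applying a classical channel `q(y|x)`
to the classical system: `Σ_{x,y} q(y|x) |y⟩⟨y| ⊗ |x⟩⟨x|-block of p(x)·(BE state given x)`. -/
def chanState {𝒳 W 𝒴 : Type*} [DecidableEq 𝒳] [DecidableEq 𝒴]
    (ψ : 𝒳 × W → ℂ) (q : 𝒳 → 𝒴 → ℝ) :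
    Matrix (𝒴 × (𝒳 × W)) (𝒴 × (𝒳 × W)) ℂ :=
  fun P Q => if P.1 = Q.1 ∧ P.2.1 = Q.2.1
    then (q P.2.1 P.1 : ℂ) * ψ P.2 * star (ψ Q.2) else 0

/-- The `n`-fold tensor power of a purification vector of a cq state, with the
classical, `B` and `E` registers collected. -/
def vecPowBE {𝒳 B E : Type*} (ψ : 𝒳 × (B × E) → ℂ) (n : ℕ) :
    (Fin n → 𝒳) × ((Fin n → B) × (Fin n → E)) → ℂ :=
  fun xw => ∏ k, ψ (xw.1 k, (xw.2.1 k, xw.2.2 k))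

variable {𝒴' 𝒳 B E : Type*} [Fintype 𝒴'] [DecidableEq 𝒴'] [Fintype 𝒳] [DecidableEq 𝒳]
  [Fintype B] [DecidableEq B] [Fintype E] [DecidableEq E]

/-- `I(Y;B)` on a state of the form `τ^{Y(X(BE))}`. -/
def miYB (τ : Matrix (𝒴' × (𝒳 × (B × E))) (𝒴' × (𝒳 × (B × E))) ℂ) : ℝ :=
  mutualInfo (ptraceRight (Matrix.reindex (exYB 𝒴' 𝒳 B E) (exYB 𝒴' 𝒳 B E) τ))

/-- `I(Y;BE)` on a state of the form `τ^{Y(X(BE))}`. -/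
def miYBE (τ : Matrix (𝒴' × (𝒳 × (B × E))) (𝒴' × (𝒳 × (B × E))) ℂ) : ℝ :=
  mutualInfo (ptraceRight (Matrix.reindex (exYW 𝒴' 𝒳 (B × E)) (exYW 𝒴' 𝒳 (B × E)) τ))

/-- `I(Y;X)` on a state of the form `τ^{Y(X(BE))}`. -/
def miYX (τ : Matrix (𝒴' × (𝒳 × (B × E))) (𝒴' × (𝒳 × (B × E))) ℂ) : ℝ :=
  mutualInfo (ptraceRight (Matrix.reindex (exYX 𝒴' 𝒳 (B × E)) (exYX 𝒴' 𝒳 (B × E)) τ))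

/-- A classical channel: entrywise nonnegative with rows summing to one. -/
def IsChannel {X Y : Type*} [Fintype Y] (q : X → Y → ℝ) : Prop :=
  (∀ x y, 0 ≤ q x y) ∧ ∀ x, ∑ y, q x y = 1

/-- `P_n(R) = max_{Y|X^n} { (1/n) I(Y;B^n) : (1/n) I(Y;B^nE^n) ≤ R }` for a cq state
with purification vector `ψ`. -/
def Pn (ψ : 𝒳 × (B × E) → ℂ) (n : ℕ) (R : ℝ) : ℝ :=
  sSup { v : ℝ | ∃ (m : ℕ) (q : (Fin n → 𝒳) → Fin m → ℝ), IsChannel q ∧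
    (1 / n : ℝ) * miYBE (chanState (vecPowBE ψ n) q) ≤ R ∧
    v = (1 / n : ℝ) * miYB (chanState (vecPowBE ψ n) q) }

/-- `D_n(R) = max_{Y|X^n} { (1/n) I(Y;B^n) : (1/n)(I(Y;X^n) - I(Y;B^n)) ≤ R }` for a cq
state with purification vector `ψ`. -/
def Dn (ψ : 𝒳 × (B × E) → ℂ) (n : ℕ) (R : ℝ) : ℝ :=
  sSup { v : ℝ | ∃ (m : ℕ) (q : (Fin n → 𝒳) → Fin m → ℝ), IsChannel q ∧
    (1 / n : ℝ) * (miYX (chanState (vecPowBE ψ n) q)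
      - miYB (chanState (vecPowBE ψ n) q)) ≤ R ∧
    v = (1 / n : ℝ) * miYB (chanState (vecPowBE ψ n) q) }

/-! ### Quantum channels -/

/-- A completely positive trace-preserving map between matrix algebras. -/
structure CPTP (ι κ : Type*) [Fintype ι] [DecidableEq ι] [Fintype κ] [DecidableEq κ] where
  map : Matrix ι ι ℂ →ₗ[ℂ] Matrix κ κ ℂ
  trace_preserving : ∀ ρ, (map ρ).trace = ρ.trace
  completely_positive : ∀ (n : ℕ) (ρ : Matrix (ι × Fin n) (ι × Fin n) ℂ), ρ.PosSemidef →
    (Matrix.of fun p q : κ × Fin n =>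
      map (Matrix.of fun i i' => ρ (i, p.2) (i', q.2)) p.1 q.1).PosSemidef

set_option linter.unusedSectionVars false
set_option linter.unusedSimpArgs false
set_option linter.unusedVariables false
set_option linter.unusedDecidableInType false
set_option linter.unusedFintypeInType false


/-! ### Linear algebra helpers -/

/-- squared Hilbert-Schmidt norm -/
def hs {m n : Type*} [Fintype m] [Fintype n] (X : Matrix m n ℂ) : ℝ := ∑ i, ∑ j, ‖X i j‖ ^ 2

theorem hs_nonneg {m n : Type*} [Fintype m] [Fintype n] (X : Matrix m n ℂ) : 0 ≤ hs X := by
  unfold hs; positivity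

theorem trace_mul_conjT {m n : Type*} [Fintype m] [Fintype n] (X : Matrix m n ℂ) :
    (X * Xᴴ).trace = (hs X : ℂ) := by
  simp only [Matrix.trace, Matrix.diag_apply, Matrix.mul_apply, Matrix.conjTranspose_apply, hs]
  push_cast
  refine Finset.sum_congr rfl fun i _ => Finset.sum_congr rfl fun j _ => ?_
  rw [← Complex.mul_conj']
  rfl

theorem trace_conjT_mul {m n : Type*} [Fintype m] [Fintype n] (X : Matrix m n ℂ) :
    (Xᴴ * X).trace = (hs X : ℂ) := by
  rw [Matrix.trace_mul_comm, trace_mul_conjT]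

theorem hs_conjT {m n : Type*} [Fintype m] [Fintype n] (X : Matrix m n ℂ) : hs Xᴴ = hs X := by
  have h := trace_mul_conjT Xᴴ
  rw [conjTranspose_conjTranspose, trace_conjT_mul] at h
  exact_mod_cast h.symm

theorem hs_neg {m n : Type*} [Fintype m] [Fintype n] (X : Matrix m n ℂ) : hs (-X) = hs X := by
  simp [hs]

theorem norm_add_sq_le' (a b : ℂ) {s : ℝ} (hs : 0 < s) :
    ‖a + b‖ ^ 2 ≤ (1 + s) * ‖a‖ ^ 2 + (1 + 1 / s) * ‖b‖ ^ 2 := by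
  have h1 : ‖a + b‖ ≤ ‖a‖ + ‖b‖ := norm_add_le a b
  have h2 : ‖a + b‖ ^ 2 ≤ (‖a‖ + ‖b‖) ^ 2 := by gcongr
  have h3 : 0 ≤ (s * ‖a‖ - ‖b‖) ^ 2 / s := by positivity
  have h4 : (s * ‖a‖ - ‖b‖) ^ 2 / s = s * ‖a‖ ^ 2 - 2 * ‖a‖ * ‖b‖ + 1 / s * ‖b‖ ^ 2 := by
    field_simp
    ring
  nlinarith

theorem hs_add_le {m n : Type*} [Fintype m] [Fintype n] (X Y : Matrix m n ℂ) {s : ℝ}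
    (hs0 : 0 < s) : hs (X + Y) ≤ (1 + s) * hs X + (1 + 1 / s) * hs Y := by
  unfold hs
  rw [Finset.mul_sum, Finset.mul_sum, ← Finset.sum_add_distrib]
  refine Finset.sum_le_sum fun i _ => ?_
  rw [Finset.mul_sum, Finset.mul_sum, ← Finset.sum_add_distrib]
  exact Finset.sum_le_sum fun j _ => norm_add_sq_le' _ _ hs0

/-- Cauchy-Schwarz -/
theorem hs_cs {m n : Type*} [Fintype m] [Fintype n] (X Y : Matrix m n ℂ) :
    (Xᴴ * Y).trace.re ^ 2 ≤ hs X * hs Y := by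
  have h1 : |(Xᴴ * Y).trace.re| ≤ ∑ i, ∑ j, ‖X i j‖ * ‖Y i j‖ := by
    refine (Complex.abs_re_le_norm _).trans ?_
    simp only [Matrix.trace, Matrix.diag_apply, Matrix.mul_apply, Matrix.conjTranspose_apply]
    rw [Finset.sum_comm]
    refine (norm_sum_le _ _).trans (Finset.sum_le_sum fun i _ => ?_)
    refine (norm_sum_le _ _).trans (Finset.sum_le_sum fun j _ => ?_)
    simp
  have h2 : (∑ i, ∑ j, ‖X i j‖ * ‖Y i j‖) ^ 2 ≤ hs X * hs Y := by
    simp only [hs, ← Fintype.sum_prod_type']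
    exact Finset.sum_mul_sq_le_sq_mul_sq _ _ _
  calc (Xᴴ * Y).trace.re ^ 2 = |(Xᴴ * Y).trace.re| ^ 2 := (sq_abs _).symm
    _ ≤ (∑ i, ∑ j, ‖X i j‖ * ‖Y i j‖) ^ 2 := by gcongr
    _ ≤ _ := h2

/-- `U diag(x) Uᴴ` -/
def fc {ι κ : Type*} [Fintype κ] [DecidableEq κ] (U : Matrix ι κ ℂ) (x : κ → ℝ) :
    Matrix ι ι ℂ := U * diagonal (fun i => (x i : ℂ)) * Uᴴ

section fc
variable {ι κ : Type*} [Fintype ι] [DecidableEq ι] [Fintype κ] [DecidableEq κ]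

theorem fc_conjT (U : Matrix ι κ ℂ) (x : κ → ℝ) : (fc U x)ᴴ = fc U x := by
  simp only [fc, conjTranspose_mul, conjTranspose_conjTranspose, diagonal_conjTranspose,
    Matrix.mul_assoc]
  congr 3
  ext i; simp

theorem fc_mul {U : Matrix ι κ ℂ} (hU : Uᴴ * U = 1) (x y : κ → ℝ) :
    fc U x * fc U y = fc U (fun i => x i * y i) := by
  unfold fc
  calc U * diagonal (fun i => (x i : ℂ)) * Uᴴ * (U * diagonal (fun i => (y i : ℂ)) * Uᴴ)
      = U * diagonal (fun i => (x i : ℂ)) * (Uᴴ * U) * diagonal (fun i => (y i : ℂ)) * Uᴴ := by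
        simp only [Matrix.mul_assoc]
    _ = _ := by rw [hU, Matrix.mul_one, Matrix.mul_assoc U, diagonal_mul_diagonal]; simp

theorem fc_sub (U : Matrix ι κ ℂ) (x y : κ → ℝ) :
    fc U x - fc U y = fc U (fun i => x i - y i) := by
  unfold fc
  rw [← Matrix.sub_mul, ← Matrix.mul_sub, diagonal_sub]; simp

theorem fc_one {U : Matrix ι κ ℂ} (hU : U * Uᴴ = 1) : fc U (fun _ => 1) = 1 := by
  unfold fc; simp [hU]

theorem fc_smul (U : Matrix ι κ ℂ) (c : ℝ) (x : κ → ℝ) :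
    (c : ℂ) • fc U x = fc U (fun i => c * x i) := by
  unfold fc
  rw [← Matrix.smul_mul, ← Matrix.mul_smul]
  congr 2
  ext i j
  by_cases h : i = j <;> simp [diagonal, h]

theorem fc_posSemidef (U : Matrix ι κ ℂ) {x : κ → ℝ} (hx : ∀ i, 0 ≤ x i) :
    (fc U x).PosSemidef := by
  unfold fc
  apply PosSemidef.mul_mul_conjTranspose_same
  apply PosSemidef.diagonal
  intro i; simpa using hx i

theorem fc_trace {U : Matrix ι κ ℂ} (hU : Uᴴ * U = 1) (x : κ → ℝ) :
    (fc U x).trace = ((∑ i, x i : ℝ) : ℂ) := by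
  unfold fc
  rw [Matrix.trace_mul_comm, ← Matrix.mul_assoc, hU, Matrix.one_mul, trace_diagonal]; simp

end fc

theorem exists_fc {ι : Type*} [Fintype ι] [DecidableEq ι] {M : Matrix ι ι ℂ}
    (h : M.IsHermitian) : ∃ (U : Matrix ι ι ℂ) (x : ι → ℝ), Uᴴ * U = 1 ∧ U * Uᴴ = 1 ∧
      M = fc U x := by
  refine ⟨h.eigenvectorUnitary.1, h.eigenvalues, ?_, ?_, ?_⟩
  · exact (Matrix.mem_unitaryGroup_iff').1 h.eigenvectorUnitary.2
  · exact (Matrix.mem_unitaryGroup_iff).1 h.eigenvectorUnitary.2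
  · have := h.spectral_theorem
    rw [Unitary.conjStarAlgAut_apply] at this
    exact this

theorem fc_nonneg_of_psd {ι κ : Type*} [Fintype ι] [Fintype κ] [DecidableEq κ]
    {U : Matrix ι κ ℂ} (hU : Uᴴ * U = 1)
    {x : κ → ℝ} (h : (fc U x).PosSemidef) (i : κ) : 0 ≤ x i := by
  have h2 := h.conjTranspose_mul_mul_same U
  have h3 : Uᴴ * fc U x * U = diagonal (fun i => (x i : ℂ)) := by
    unfold fc
    calc Uᴴ * (U * diagonal (fun i => (x i : ℂ)) * Uᴴ) * U
        = (Uᴴ * U) * diagonal (fun i => (x i : ℂ)) * (Uᴴ * U) := by simp only [Matrix.mul_assoc]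
      _ = _ := by rw [hU]; simp
  rw [h3] at h2
  have := h2.diag_nonneg (i := i)
  simpa using this

theorem exists_fc_psd {ι : Type*} [Fintype ι] [DecidableEq ι] {M : Matrix ι ι ℂ}
    (h : M.PosSemidef) : ∃ (U : Matrix ι ι ℂ) (x : ι → ℝ), Uᴴ * U = 1 ∧ U * Uᴴ = 1 ∧
      M = fc U x ∧ ∀ i, 0 ≤ x i := by
  obtain ⟨U, x, h1, h2, h3⟩ := exists_fc h.1
  exact ⟨U, x, h1, h2, h3, fc_nonneg_of_psd h1 (h3 ▸ h)⟩

theorem psd_sqrt {ι : Type*} [Fintype ι] [DecidableEq ι] {M : Matrix ι ι ℂ}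
    (h : M.PosSemidef) : ∃ X : Matrix ι ι ℂ, M = X * Xᴴ := by
  obtain ⟨U, x, h1, h2, h3, h4⟩ := exists_fc_psd h
  refine ⟨fc U (fun i => √(x i)), ?_⟩
  rw [fc_conjT, fc_mul h1, h3]
  congr 1; ext i; rw [Real.mul_self_sqrt (h4 i)]

theorem trace_mul_psd {ι : Type*} [Fintype ι] [DecidableEq ι] {P Q : Matrix ι ι ℂ}
    (hP : P.PosSemidef) (hQ : Q.PosSemidef) : 0 ≤ (P * Q).trace.re := by
  obtain ⟨X, rfl⟩ := psd_sqrt hQ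
  rw [← Matrix.mul_assoc, Matrix.trace_mul_comm, ← Matrix.mul_assoc]
  exact (Complex.nonneg_iff.1 (hP.conjTranspose_mul_mul_same X).trace_nonneg).1

theorem psd_proj {ι : Type*} [Fintype ι] {P : Matrix ι ι ℂ}
    (h1 : Pᴴ = P) (h2 : P * P = P) : P.PosSemidef := by
  rw [← h2]; nth_rewrite 1 [← h1]; exact posSemidef_conjTranspose_mul_self P

theorem psd_one_sub_proj {ι : Type*} [Fintype ι] [DecidableEq ι] {P : Matrix ι ι ℂ}
    (h1 : Pᴴ = P) (h2 : P * P = P) : (1 - P).PosSemidef := by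
  apply psd_proj
  · simp [h1]
  · rw [Matrix.sub_mul, Matrix.mul_sub P, h2]; simp

/-- spectral sums do not depend on the diagonalisation -/
theorem spectral_sum {ι : Type*} [Fintype ι] [DecidableEq ι] {M : Matrix ι ι ℂ}
    (h : M.IsHermitian) {U : Matrix ι ι ℂ} {x : ι → ℝ} (hU : Uᴴ * U = 1)
    (hM : M = fc U x) (f : ℝ → ℝ) : ∑ i, f (h.eigenvalues i) = ∑ i, f (x i) := by
  have h1 := h.roots_charpoly_eq_eigenvalues
  have h2 : M.charpoly.roots = Multiset.map (fun i => (x i : ℂ)) Finset.univ.val := by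
    have : M.charpoly = (diagonal (fun i => (x i : ℂ))).charpoly := by
      rw [hM, fc, charpoly_mul_comm, ← Matrix.mul_assoc, hU, Matrix.one_mul]
    rw [this, charpoly_diagonal, Polynomial.roots_prod]
    · simp
    · simp [Finset.prod_ne_zero_iff, Polynomial.X_sub_C_ne_zero]
  rw [h1] at h2
  have h3 := congrArg (fun s => (s.map (fun z : ℂ => f z.re)).sum) h2
  simpa [Multiset.map_map, Function.comp_def] using h3

theorem entropy_fc {ι : Type*} [Fintype ι] [DecidableEq ι] {U : Matrix ι ι ℂ} {x : ι → ℝ}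
    (hU : Uᴴ * U = 1) : entropy (fc U x) = -∑ i, x i * Real.log (x i) := by
  have h : (fc U x).IsHermitian := fc_conjT U x
  unfold entropy
  rw [dif_pos h, spectral_sum h hU rfl (fun t => t * Real.log t)]

theorem entropy_eq_roots {ι : Type*} [Fintype ι] [DecidableEq ι] {M : Matrix ι ι ℂ}
    (h : M.IsHermitian) :
    entropy M = -(M.charpoly.roots.map (fun z : ℂ => z.re * Real.log z.re)).sum := by
  unfold entropy
  rw [dif_pos h, h.roots_charpoly_eq_eigenvalues]
  simp [Multiset.map_map, Function.comp_def]

theorem entropy_mul_comm {ι κ : Type*} [Fintype ι] [DecidableEq ι] [Fintype κ] [DecidableEq κ]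
    (X : Matrix ι κ ℂ) : entropy (X * Xᴴ) = entropy (Xᴴ * X) := by
  rw [entropy_eq_roots (isHermitian_mul_conjTranspose_self X),
    entropy_eq_roots (isHermitian_conjTranspose_mul_self X)]
  have h := congrArg Polynomial.roots (charpoly_mul_comm' X Xᴴ)
  rw [Polynomial.roots_mul, Polynomial.roots_mul] at h
  · have h3 := congrArg (fun s => (s.map (fun z : ℂ => z.re * Real.log z.re)).sum) h
    simpa [Multiset.map_nsmul, Multiset.sum_nsmul] using h3
  · exact mul_ne_zero (pow_ne_zero _ Polynomial.X_ne_zero) (charpoly_monic _).ne_zero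
  · exact mul_ne_zero (pow_ne_zero _ Polynomial.X_ne_zero) (charpoly_monic _).ne_zero

theorem entropy_transpose {ι : Type*} [Fintype ι] [DecidableEq ι] {M : Matrix ι ι ℂ}
    (h : M.IsHermitian) : entropy Mᵀ = entropy M := by
  rw [entropy_eq_roots h, entropy_eq_roots h.transpose, charpoly_transpose]

/-- polar decomposition -/
theorem polar {W X : Type*} [Fintype W] [DecidableEq W] [Fintype X] [DecidableEq X]
    (T : Matrix W X ℂ) : ∃ (S : Matrix W W ℂ) (L : Matrix W X ℂ), S.PosSemidef ∧
      S * S = T * Tᴴ ∧ S * L = T ∧ T * Lᴴ = S ∧ (1 - L * Lᴴ).PosSemidef ∧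
      (1 - Lᴴ * L).PosSemidef := by
  obtain ⟨U, x, h1, h2, h3, h4⟩ := exists_fc_psd (posSemidef_self_mul_conjTranspose T)
  set Pr := fc U (fun i => if x i = 0 then 0 else 1) with hPr
  set I := fc U (fun i => (√(x i))⁻¹) with hI
  set S := fc U (fun i => √(x i)) with hS
  have hIc : Iᴴ = I := fc_conjT _ _
  have hSI : S * I = Pr := by
    rw [hS, hI, fc_mul h1, hPr]; congr 1; ext i
    by_cases hx : x i = 0
    · simp [hx]
    · have : 0 < x i := lt_of_le_of_ne (h4 i) (Ne.symm hx)
      have : √(x i) ≠ 0 := by positivity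
      simp [hx, this]
  have hGI : fc U x * I = S := by
    rw [hI, fc_mul h1, hS]; congr 1; ext i
    by_cases hx : x i = 0
    · simp [hx]
    · have hp : 0 < x i := lt_of_le_of_ne (h4 i) (Ne.symm hx)
      have : √(x i) ≠ 0 := by positivity
      field_simp
      rw [Real.sq_sqrt (h4 i)]
  have hIS : I * S = Pr := by
    have := congrArg conjTranspose hSI
    rwa [conjTranspose_mul, hIc, fc_conjT, hPr, fc_conjT] at this
  have hPc : Prᴴ = Pr := fc_conjT _ _
  have hPP : Pr * Pr = Pr := by
    rw [hPr, fc_mul h1]; congr 1; ext i; by_cases hx : x i = 0 <;> simp [hx]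
  have hPT : Pr * T = T := by
    have h0 : ((1 - Pr) * T) * ((1 - Pr) * T)ᴴ = 0 := by
      rw [conjTranspose_mul, Matrix.mul_assoc, ← Matrix.mul_assoc T, h3, ← Matrix.mul_assoc]
      have : (1 - Pr) * fc U x = 0 := by
        rw [Matrix.sub_mul, hPr, fc_mul h1, Matrix.one_mul, fc_sub]
        have : (fun i => x i - (if x i = 0 then 0 else 1) * x i) = fun _ => (0:ℝ) := by
          ext i; by_cases hx : x i = 0 <;> simp [hx]
        rw [this]; unfold fc; simp
      rw [this, Matrix.zero_mul]
    have h00 := Matrix.self_mul_conjTranspose_eq_zero.1 h0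
    rw [Matrix.sub_mul, Matrix.one_mul, sub_eq_zero] at h00
    exact h00.symm
  refine ⟨S, I * T, fc_posSemidef _ fun i => Real.sqrt_nonneg _, ?_, ?_, ?_, ?_, ?_⟩
  · rw [h3, hS, fc_mul h1]; congr 1; ext i; rw [Real.mul_self_sqrt (h4 i)]
  · rw [← Matrix.mul_assoc, hSI, hPT]
  · rw [conjTranspose_mul, hIc, ← Matrix.mul_assoc, h3, hGI]
  · have : I * T * (I * T)ᴴ = Pr := by
      rw [conjTranspose_mul, hIc, Matrix.mul_assoc, ← Matrix.mul_assoc T, h3, hGI, hIS]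
    rw [this]; exact psd_one_sub_proj hPc hPP
  · apply psd_one_sub_proj
    · simp
    · have : (I * T)ᴴ * (I * T) * ((I * T)ᴴ * (I * T)) = (I * T)ᴴ * ((I * T) * (I * T)ᴴ) * (I * T) := by
        simp only [Matrix.mul_assoc]
      rw [this]
      have : I * T * (I * T)ᴴ = Pr := by
        rw [conjTranspose_mul, hIc, Matrix.mul_assoc, ← Matrix.mul_assoc T, h3, hGI, hIS]
      rw [this, Matrix.mul_assoc, ← Matrix.mul_assoc Pr]
      congr 1
      have : Pr * I = I := by
        rw [hPr, hI, fc_mul h1]; congr 1; ext i; by_cases hx : x i = 0 <;> simp [hx]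
      rw [this]

/-- Powers-Stormer inequality, variational form -/
theorem powers_stormer {W : Type*} [Fintype W] [DecidableEq W] {A B : Matrix W W ℂ}
    (hA : A.PosSemidef) (hB : B.PosSemidef) :
    ∃ V : Matrix W W ℂ, Vᴴ = V ∧ V * V = 1 ∧ hs (A - B) ≤ (V * (A * A - B * B)).trace.re := by
  obtain ⟨U, d, h1, h2, h3⟩ := exists_fc (hA.1.sub hB.1)
  set sg : W → ℝ := fun i => if 0 ≤ d i then 1 else -1
  refine ⟨fc U sg, fc_conjT _ _, ?_, ?_⟩
  · rw [fc_mul h1, ← fc_one h2]; congr 1; ext i; simp only [sg]; split_ifs <;> norm_num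
  set A' := Uᴴ * A * U with hA'
  set B' := Uᴴ * B * U with hB'
  have hA2 := hA.conjTranspose_mul_mul_same U
  have hB2 := hB.conjTranspose_mul_mul_same U
  rw [← hA'] at hA2
  rw [← hB'] at hB2
  have hD : A' - B' = diagonal (fun i => (d i : ℂ)) := by
    rw [hA', hB', ← Matrix.sub_mul, ← Matrix.mul_sub, h3, fc]
    calc Uᴴ * (U * diagonal (fun i => (d i : ℂ)) * Uᴴ) * U
        = (Uᴴ * U) * diagonal (fun i => (d i : ℂ)) * (Uᴴ * U) := by simp only [Matrix.mul_assoc]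
      _ = _ := by rw [h1]; simp
  have hhs : hs (A - B) = ∑ i, d i * d i := by
    have h5 := trace_mul_conjT (A - B)
    rw [h3, fc_conjT, fc_mul h1, fc_trace h1, ← h3] at h5
    exact_mod_cast h5.symm
  have htr : (fc U sg * (A * A - B * B)).trace =
      (diagonal (fun i => (sg i : ℂ)) * (A' * A' - B' * B')).trace := by
    have e1 : A' * A' - B' * B' = Uᴴ * (A * A - B * B) * U := by
      have key : ∀ C : Matrix W W ℂ, Uᴴ * C * U * (Uᴴ * C * U) = Uᴴ * (C * C) * U := by
        intro C
        calc Uᴴ * C * U * (Uᴴ * C * U) = Uᴴ * C * (U * Uᴴ) * C * U := by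
              simp only [Matrix.mul_assoc]
          _ = _ := by rw [h2]; simp only [Matrix.mul_assoc, Matrix.one_mul]
      rw [hA', hB', key, key, Matrix.mul_sub, Matrix.sub_mul]
    rw [e1, fc, Matrix.mul_assoc, Matrix.mul_assoc, Matrix.trace_mul_comm]
    simp only [Matrix.mul_assoc]
  rw [hhs, htr]
  have hent : ∀ i k, A' i k = B' i k + if i = k then (d i : ℂ) else 0 := by
    intro i k
    have := congrFun (congrFun hD i) k
    rw [Matrix.sub_apply, diagonal_apply] at this
    rw [← this]; ring
  have hdiag : ∀ i, (A' * A' - B' * B') i i = d i * (A' i i + B' i i) := by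
    intro i
    rw [Matrix.sub_apply, Matrix.mul_apply, Matrix.mul_apply, ← Finset.sum_sub_distrib,
      Finset.sum_eq_single i]
    · have := hent i i
      rw [if_pos rfl] at this
      rw [this]; ring
    · intro k _ hk
      rw [hent i k, hent k i, if_neg hk, if_neg (Ne.symm hk)]; ring
    · simp
  have : (diagonal (fun i => (sg i : ℂ)) * (A' * A' - B' * B')).trace.re
      = ∑ i, sg i * (d i * ((A' i i).re + (B' i i).re)) := by
    simp only [Matrix.trace, Matrix.diag_apply, diagonal_mul, hdiag, Complex.re_sum]
    refine Finset.sum_congr rfl fun i _ => ?_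
    simp
  rw [this]
  refine Finset.sum_le_sum fun i _ => ?_
  have a0 : 0 ≤ (A' i i).re := (Complex.nonneg_iff.1 (hA2.diag_nonneg (i := i))).1
  have b0 : 0 ≤ (B' i i).re := (Complex.nonneg_iff.1 (hB2.diag_nonneg (i := i))).1
  have hdi : (A' i i).re - (B' i i).re = d i := by
    have := hent i i
    rw [if_pos rfl] at this
    rw [this]; simp
  simp only [sg]
  split_ifs with h
  · nlinarith
  · nlinarith



/-! ### Greedy derandomised covering -/

theorem hs_add_eq {m n : Type*} [Fintype m] [Fintype n] (X Y : Matrix m n ℂ) :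
    hs (X + Y) = hs X + hs Y + 2 * (Xᴴ * Y).trace.re := by
  have h := trace_conjT_mul (X + Y)
  have h1 := trace_conjT_mul X
  have h2 := trace_conjT_mul Y
  have h3 : (Yᴴ * X).trace.re = (Xᴴ * Y).trace.re := by
    have : (Yᴴ * X) = (Xᴴ * Y)ᴴ := by simp
    rw [this, trace_conjTranspose]; simp
  rw [conjTranspose_add, Matrix.add_mul, Matrix.mul_add, Matrix.mul_add, trace_add, trace_add,
    trace_add] at h
  have := congrArg Complex.re h
  have h1' := congrArg Complex.re h1
  have h2' := congrArg Complex.re h2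
  simp only [Complex.add_re, Complex.ofReal_re] at this h1' h2'
  linarith

theorem exists_le_avg {Y : Type*} [Fintype Y] {p : Y → ℝ} (hp : ∀ y, 0 ≤ p y)
    (hp1 : ∑ y, p y = 1) (f : Y → ℝ) {a : ℝ} (h : ∑ y, p y * f y ≤ a) : ∃ y, f y ≤ a := by
  by_contra hc
  push Not at hc
  have h1 : ∑ y, p y * a < ∑ y, p y * f y := by
    apply Finset.sum_lt_sum
    · intro y _; exact mul_le_mul_of_nonneg_left (hc y).le (hp y)
    · by_contra hall
      push Not at hall
      have : ∑ y, p y = 0 := by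
        refine Finset.sum_eq_zero fun y hy => ?_
        by_contra hne
        have hpos : 0 < p y := lt_of_le_of_ne (hp y) (Ne.symm hne)
        have := hall y hy
        nlinarith [hc y]
      rw [hp1] at this; exact one_ne_zero this
  rw [← Finset.sum_mul, hp1, one_mul] at h1
  linarith

theorem sum_cross {Y m n : Type*} [Fintype Y] [Fintype m] [Fintype n] {p : Y → ℝ}
    (hp1 : ∑ y, p y = 1)
    (X : Y → Matrix m n ℂ) (V : Matrix m n ℂ) :
    ∑ y, p y * (Vᴴ * (X y - ∑ z, (p z : ℂ) • X z)).trace.re = 0 := by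
  have h : ∑ y, (p y : ℂ) • (X y - ∑ z, (p z : ℂ) • X z) = 0 := by
    simp only [smul_sub, Finset.sum_sub_distrib]
    rw [← Finset.sum_smul, ← Complex.ofReal_sum, hp1]; simp
  have h2 : (Vᴴ * ∑ y, (p y : ℂ) • (X y - ∑ z, (p z : ℂ) • X z)).trace.re = 0 := by
    rw [h]; simp
  rw [Matrix.mul_sum, trace_sum, Complex.re_sum] at h2
  rw [← h2]
  refine Finset.sum_congr rfl fun y _ => ?_
  rw [Matrix.mul_smul, trace_smul]; simp

theorem greedy {Y m n : Type*} [Fintype Y] [Fintype m] [Fintype n] {p : Y → ℝ}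
    (hp : ∀ y, 0 ≤ p y) (hp1 : ∑ y, p y = 1) (X : Y → Matrix m n ℂ) (g : Y → ℝ) (M : ℕ) :
    ∃ J : Fin M → Y, hs (∑ j, (X (J j) - ∑ z, (p z : ℂ) • X z)) + ∑ j, g (J j) ≤
      M * ∑ y, p y * (hs (X y) + g y) := by
  set mu := ∑ z, (p z : ℂ) • X z with hmu
  have hvar : ∑ y, p y * hs (X y - mu) ≤ ∑ y, p y * hs (X y) := by
    have : ∀ y, hs (X y) = hs (X y - mu) + hs mu + 2 * (muᴴ * (X y - mu)).trace.re := by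
      intro y
      have := hs_add_eq mu (X y - mu)
      rw [add_sub_cancel] at this; linarith
    have h2 := sum_cross hp1 X mu
    calc ∑ y, p y * hs (X y - mu)
        ≤ ∑ y, (p y * hs (X y - mu) + p y * hs mu + 2 * (p y * (muᴴ * (X y - mu)).trace.re)) := by
          rw [Finset.sum_add_distrib, Finset.sum_add_distrib, ← Finset.mul_sum, h2,
            ← Finset.sum_mul, hp1]
          linarith [hs_nonneg mu]
      _ = _ := by
          refine Finset.sum_congr rfl fun y _ => ?_
          rw [this y]; ring
  induction M with
  | zero => exact ⟨Fin.elim0, by simp [hs]⟩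
  | succ M ih =>
    obtain ⟨J, hJ⟩ := ih
    set V := ∑ j, (X (J j) - mu) with hV
    have : ∑ y, p y * (hs (V + (X y - mu)) + g y) ≤ hs V + ∑ y, p y * (hs (X y) + g y) := by
      have h2 := sum_cross hp1 X V
      calc ∑ y, p y * (hs (V + (X y - mu)) + g y)
          = ∑ y, (p y * hs V + p y * hs (X y - mu) + 2 * (p y * (Vᴴ * (X y - mu)).trace.re)
            + p y * g y) := by
            refine Finset.sum_congr rfl fun y _ => ?_
            rw [hs_add_eq]; ring
        _ = hs V + ∑ y, p y * hs (X y - mu) + ∑ y, p y * g y := by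
            rw [Finset.sum_add_distrib, Finset.sum_add_distrib, Finset.sum_add_distrib,
              ← Finset.mul_sum, h2, ← Finset.sum_mul, hp1]; ring
        _ ≤ _ := by
            simp only [mul_add, Finset.sum_add_distrib]; linarith
    obtain ⟨y, hy⟩ := exists_le_avg hp hp1 _ this
    refine ⟨Fin.snoc J y, ?_⟩
    rw [Fin.sum_univ_castSucc, Fin.sum_univ_castSucc]
    simp only [Fin.snoc_castSucc, Fin.snoc_last]
    push_cast
    rw [← hV]
    linarith

theorem hs_mul_left_le {m n l : Type*} [Fintype m] [Fintype n] [Fintype l] [DecidableEq m]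
    [DecidableEq n]
    {Q : Matrix l m ℂ} (hQ : (1 - Qᴴ * Q).PosSemidef) (X : Matrix m n ℂ) :
    hs (Q * X) ≤ hs X := by
  have h := (hQ.conjTranspose_mul_mul_same X).trace_nonneg
  rw [Matrix.mul_sub, Matrix.sub_mul, trace_sub, Matrix.mul_one, trace_conjT_mul] at h
  have e : Xᴴ * (Qᴴ * Q) * X = (Q * X)ᴴ * (Q * X) := by
    rw [conjTranspose_mul]; simp only [Matrix.mul_assoc]
  rw [e, trace_conjT_mul] at h
  have := (Complex.nonneg_iff.1 h).1
  simp at this; exact this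

theorem hs_mul_right_le {m n l : Type*} [Fintype m] [Fintype n] [Fintype l] [DecidableEq m]
    [DecidableEq n]
    {Q : Matrix n l ℂ} (hQ : (1 - Q * Qᴴ).PosSemidef) (X : Matrix m n ℂ) :
    hs (X * Q) ≤ hs X := by
  rw [← hs_conjT, ← hs_conjT X, conjTranspose_mul]
  apply hs_mul_left_le
  simpa using hQ

theorem hs_proj_le {m n : Type*} [Fintype m] [Fintype n] [DecidableEq m] [DecidableEq n]
    {Q : Matrix m m ℂ} (h1 : Qᴴ = Q) (h2 : Q * Q = Q) (X : Matrix m n ℂ) :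
    hs (Q * X) ≤ hs X := by
  apply hs_mul_left_le
  rw [h1, h2]; exact psd_one_sub_proj h1 h2

theorem hs_proj_trace {m n : Type*} [Fintype m] [Fintype n] [DecidableEq m] [DecidableEq n]
    {Q : Matrix m m ℂ} (h1 : Qᴴ = Q) (h2 : Q * Q = Q) (X : Matrix m n ℂ) :
    hs (Q * X) = (Q * (X * Xᴴ)).trace.re := by
  have := trace_mul_conjT (Q * X)
  rw [conjTranspose_mul, h1, ← Matrix.mul_assoc, Matrix.trace_mul_comm,
    ← Matrix.mul_assoc, ← Matrix.mul_assoc, h2, Matrix.mul_assoc] at this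
  rw [this]; simp

theorem hs_proj_compl {m n : Type*} [Fintype m] [Fintype n] [DecidableEq m] [DecidableEq n]
    {Q : Matrix m m ℂ} (h1 : Qᴴ = Q) (h2 : Q * Q = Q) (X : Matrix m n ℂ) :
    hs ((1 - Q) * X) = hs X - hs (Q * X) := by
  rw [hs_proj_trace (Q := 1 - Q) (by simp [h1]) (by rw [Matrix.sub_mul, Matrix.mul_sub Q, h2]; simp),
    hs_proj_trace h1 h2, Matrix.sub_mul, trace_sub, Matrix.one_mul, trace_mul_conjT]
  simp

/-- One-shot covering data. -/
structure Cov {A W Y : Type*} [Fintype A] [DecidableEq A] [Fintype W] [DecidableEq W]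
    [Fintype Y] {D : ℕ} (Φ : Matrix W A ℂ) (p : Y → ℝ) (t : Y → Matrix W (Fin D) ℂ)
    (Pi : Matrix W W ℂ) (Q : Y → Matrix W W ℂ) (d c η : ℝ) : Prop where
  hΦ : hs Φ = 1
  hp : ∀ y, 0 ≤ p y
  hp1 : ∑ y, p y = 1
  hle : (Φ * Φᴴ - ∑ y, (p y : ℂ) • (t y * (t y)ᴴ)).PosSemidef
  ht1 : ∀ y, hs (t y) ≤ 1
  htc : ∀ y, ((c : ℂ) • (1 : Matrix W W ℂ) - t y * (t y)ᴴ).PosSemidef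
  hc : 0 ≤ c
  Pi1 : Piᴴ = Pi
  Pi2 : Pi * Pi = Pi
  PiG : Pi * (Φ * Φᴴ) = (Φ * Φᴴ) * Pi
  Pid : Pi.trace.re ≤ d
  hd : 0 < d
  Q1 : ∀ y, (Q y)ᴴ = Q y
  Q2 : ∀ y, Q y * Q y = Q y
  e1 : 1 - η ≤ ∑ y, p y * hs (t y)
  e2 : hs ((1 - Pi) * Φ) ≤ η
  e3 : ∑ y, p y * hs ((1 - Q y) * t y) ≤ η

section cov
variable {A W Y : Type*} [Fintype A] [DecidableEq A] [Fintype W] [DecidableEq W]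
    [Fintype Y] {D : ℕ} {Φ : Matrix W A ℂ} {p : Y → ℝ} {t : Y → Matrix W (Fin D) ℂ}
    {Pi : Matrix W W ℂ} {Q : Y → Matrix W W ℂ} {d c η : ℝ}

theorem Cov.piC (h : Cov Φ p t Pi Q d c η) : (1 - Pi)ᴴ = 1 - Pi ∧ (1 - Pi) * (1 - Pi) = 1 - Pi := by
  constructor
  · simp [h.Pi1]
  · rw [Matrix.sub_mul, Matrix.mul_sub Pi, h.Pi2]; simp

theorem Cov.piT (h : Cov Φ p t Pi Q d c η) : ∑ y, p y * hs ((1 - Pi) * t y) ≤ η := by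
  refine le_trans ?_ h.e2
  have h1 := trace_mul_psd (psd_proj h.piC.1 h.piC.2) h.hle
  rw [Matrix.mul_sub, trace_sub, Matrix.mul_sum, trace_sum] at h1
  rw [hs_proj_trace h.piC.1 h.piC.2]
  have h2 : ∀ y, ((1 - Pi) * ((p y : ℂ) • (t y * (t y)ᴴ))).trace.re = p y * hs ((1 - Pi) * t y) := by
    intro y
    rw [Matrix.mul_smul, trace_smul, hs_proj_trace h.piC.1 h.piC.2]; simp
  simp only [Complex.sub_re, Complex.re_sum, h2] at h1
  linarith

theorem Cov.piT' (h : Cov Φ p t Pi Q d c η) : 1 - 2 * η ≤ ∑ y, p y * hs (Pi * t y) := by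
  have h1 := h.piT
  have h2 : ∀ y, hs ((1 - Pi) * t y) = hs (t y) - hs (Pi * t y) := fun y =>
    hs_proj_compl h.Pi1 h.Pi2 _
  simp only [h2, mul_sub, Finset.sum_sub_distrib] at h1
  linarith [h.e1]

theorem Cov.dc (h : Cov Φ p t Pi Q d c η) : 1 - 2 * η ≤ c * d := by
  refine h.piT'.trans ?_
  have : ∀ y, hs (Pi * t y) ≤ c * d := by
    intro y
    rw [hs_proj_trace h.Pi1 h.Pi2]
    have h1 := trace_mul_psd (psd_proj h.Pi1 h.Pi2) (h.htc y)
    rw [Matrix.mul_sub, trace_sub, Matrix.mul_smul, trace_smul, Matrix.mul_one] at h1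
    simp at h1
    have := mul_le_mul_of_nonneg_left h.Pid h.hc
    linarith
  calc ∑ y, p y * hs (Pi * t y) ≤ ∑ y, p y * (c * d) :=
        Finset.sum_le_sum fun y _ => mul_le_mul_of_nonneg_left (this y) (h.hp y)
    _ = c * d := by rw [← Finset.sum_mul, h.hp1, one_mul]

theorem Cov.hsX (h : Cov Φ p t Pi Q d c η) (y : Y) : hs ((Pi * t y) * (Pi * t y)ᴴ) ≤ c := by
  set X := (Pi * t y) * (Pi * t y)ᴴ with hX
  have hXc : Xᴴ = X := by simp [hX]
  have hXp : X.PosSemidef := posSemidef_self_mul_conjTranspose _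
  have h1 := trace_mul_psd hXp (h.htc y)
  rw [Matrix.mul_sub, trace_sub, Matrix.mul_smul, trace_smul, Matrix.mul_one] at h1
  have h2 : X * (t y * (t y)ᴴ) = Pi * (X * (t y * (t y)ᴴ)) := by
    rw [hX]; simp only [Matrix.mul_assoc]; rw [← Matrix.mul_assoc Pi Pi, h.Pi2]
  have h3 : (X * (t y * (t y)ᴴ)).trace = hs X := by
    rw [← trace_mul_conjT, hXc, h2, Matrix.trace_mul_comm, Matrix.mul_assoc]
    have e : X = Pi * X := by
      rw [hX]; simp only [Matrix.mul_assoc]; rw [← Matrix.mul_assoc Pi Pi, h.Pi2]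
    have e' : X = X * Pi := by
      have := congrArg conjTranspose e
      rw [hXc, conjTranspose_mul Pi X, h.Pi1, hXc] at this
      exact this
    conv_lhs => rw [e']
    rw [Matrix.mul_assoc]
    congr 2
    rw [hX, conjTranspose_mul, h.Pi1]; simp only [Matrix.mul_assoc]
  have h4 : X.trace = hs (Pi * t y) := by rw [hX, trace_mul_conjT]
  rw [h3, h4] at h1
  have h5 : hs (Pi * t y) ≤ 1 := (hs_proj_le h.Pi1 h.Pi2 _).trans (h.ht1 y)
  have := mul_le_mul_of_nonneg_left h5 h.hc
  simp at h1
  linarith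

theorem hs_blocks {W : Type*} [Fintype W] {M D : ℕ} (X : Matrix W (Fin M × Fin D) ℂ) :
    hs X = ∑ j, hs (X.submatrix id (fun k => (j, k))) := by
  have : ∀ j, hs (X.submatrix id (fun k => (j, k))) = ∑ i, ∑ k, ‖X i (j, k)‖ ^ 2 := fun j => rfl
  simp only [this]
  rw [Finset.sum_comm]
  unfold hs
  refine Finset.sum_congr rfl fun i _ => ?_
  rw [Fintype.sum_prod_type]

theorem hs_smul {m n : Type*} [Fintype m] [Fintype n] (a : ℝ) (X : Matrix m n ℂ) :
    hs ((a : ℂ) • X) = a ^ 2 * hs X := by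
  simp only [hs, Finset.mul_sum, Matrix.smul_apply, norm_smul, mul_pow]
  simp

theorem covering {u : ℝ} (hu : 0 < u) (hu1 : u ≤ 1) (h : Cov Φ p t Pi Q d c (u ^ 4)) (M : ℕ)
    (hM : 0 < M) (e4 : d * c ≤ u ^ 4 * M) :
    ∃ (J : Fin M → Y) (nn : Matrix A (Fin M × Fin D) ℂ), (1 - nn * nnᴴ).PosSemidef ∧
      1 - 85 * u ≤ ∑ j, hs (Q (J j) * (Φ * nn.submatrix id (fun k => (j, k)))) := by
  have hM' : (0 : ℝ) < M := by exact_mod_cast hM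
  set η := u ^ 4 with hη
  have hd := h.hd
  set X : Y → Matrix W W ℂ := fun y => (Pi * t y) * (Pi * t y)ᴴ with hX
  set g : Y → ℝ := fun y => (M / d) * ((1 - hs (t y)) + hs ((1 - Pi) * t y) + hs ((1 - Q y) * t y))
    with hg
  obtain ⟨J, hJ⟩ := greedy h.hp h.hp1 X g M
  set mu := ∑ z, (p z : ℂ) • X z with hmu
  have hEX : ∑ y, p y * hs (X y) ≤ c := by
    calc ∑ y, p y * hs (X y) ≤ ∑ y, p y * c :=
        Finset.sum_le_sum fun y _ => mul_le_mul_of_nonneg_left (h.hsX y) (h.hp y)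
      _ = c := by rw [← Finset.sum_mul, h.hp1, one_mul]
  have hEg : ∑ y, p y * g y ≤ (M / d) * (3 * η) := by
    have : ∑ y, p y * g y = (M / d) * ((∑ y, p y - ∑ y, p y * hs (t y)) +
        ∑ y, p y * hs ((1 - Pi) * t y) + ∑ y, p y * hs ((1 - Q y) * t y)) := by
      rw [← Finset.sum_sub_distrib, ← Finset.sum_add_distrib, ← Finset.sum_add_distrib,
        Finset.mul_sum]
      refine Finset.sum_congr rfl fun y _ => ?_
      simp only [hg]; ring
    rw [this]
    apply mul_le_mul_of_nonneg_left _ (by positivity)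
    linarith [h.hp1, h.piT, h.e3, h.e1]
  set V := ∑ j, (X (J j) - mu) with hV
  -- normalised bound
  have hbound : d / M ^ 2 * hs V + (1 / M) * ∑ j, ((1 - hs (t (J j))) + hs ((1 - Pi) * t (J j))
      + hs ((1 - Q (J j)) * t (J j))) ≤ 4 * η := by
    have h1 : hs V + ∑ j, g (J j) ≤ M * (c + (M / d) * (3 * η)) := by
      refine hJ.trans ?_
      apply mul_le_mul_of_nonneg_left _ hM'.le
      simp only [mul_add, Finset.sum_add_distrib]
      linarith
    have h2 := mul_le_mul_of_nonneg_left h1 (show 0 ≤ d / (M:ℝ) ^ 2 by positivity)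
    have h3 : ∑ j, g (J j) = (M / d) * ∑ j, ((1 - hs (t (J j))) + hs ((1 - Pi) * t (J j))
      + hs ((1 - Q (J j)) * t (J j))) := by rw [Finset.mul_sum]
    rw [h3] at h2
    have h4 : d / (M:ℝ) ^ 2 * (M * (c + M / d * (3 * η))) = d * c / M + 3 * η := by
      field_simp
    have h5 : d * c / M ≤ η := by rw [div_le_iff₀ hM']; exact e4
    rw [h4, mul_add] at h2
    have h6 : ∀ x : ℝ, d / (M:ℝ) ^ 2 * (M / d * x) = 1 / M * x := by intro x; field_simp
    rw [h6] at h2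
    linarith
  have n1 : 0 ≤ ∑ j, (1 - hs (t (J j))) :=
    Finset.sum_nonneg fun j _ => by linarith [h.ht1 (J j)]
  have n2 : 0 ≤ ∑ j, hs ((1 - Pi) * t (J j)) := Finset.sum_nonneg fun j _ => hs_nonneg _
  have n3 : 0 ≤ ∑ j, hs ((1 - Q (J j)) * t (J j)) := Finset.sum_nonneg fun j _ => hs_nonneg _
  have hMi : (0:ℝ) ≤ 1 / M := by positivity
  rw [Finset.sum_add_distrib, Finset.sum_add_distrib, mul_add, mul_add] at hbound
  have n0 : 0 ≤ d / (M:ℝ) ^ 2 * hs V := mul_nonneg (by positivity) (hs_nonneg _)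
  have m1 := mul_nonneg hMi n1
  have m2 := mul_nonneg hMi n2
  have m3 := mul_nonneg hMi n3
  -- the target matrices
  set r : ℝ := (√(M:ℝ))⁻¹ with hr
  have hr2 : r ^ 2 = 1 / M := by rw [hr, inv_pow, Real.sq_sqrt hM'.le, one_div]
  set T : Matrix W (Fin M × Fin D) ℂ := fun w jk => (r : ℂ) * (Pi * t (J jk.1)) w jk.2 with hT
  have hTb : ∀ j, T.submatrix id (fun k => (j, k)) = (r : ℂ) • (Pi * t (J j)) := by
    intro j; ext w k; rfl
  have hTT : T * Tᴴ = ((1 / M : ℝ) : ℂ) • ∑ j, X (J j) := by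
    ext w w'
    simp only [Matrix.mul_apply, Matrix.smul_apply, Matrix.sum_apply, conjTranspose_apply,
      Fintype.sum_prod_type, hX, smul_eq_mul, Finset.mul_sum]
    refine Finset.sum_congr rfl fun j _ => Finset.sum_congr rfl fun k _ => ?_
    rw [← hr2]
    simp only [hT, Matrix.mul_apply, star_mul', Complex.star_def, Complex.conj_ofReal]
    push_cast; ring
  obtain ⟨S, L, hS, hSS, hSL, -, hL1, hL2⟩ := polar T
  obtain ⟨R, K, hR, hRR, -, hRK, hK1, hK2⟩ := polar Φ
  obtain ⟨Vs, hV1, hV2, hV3⟩ := powers_stormer hR hS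
  have hps : hs (R - S) ≤ 2 * η + 2 * u ^ 2 := by
    refine hV3.trans ?_
    have hdec : R * R - S * S = (Φ * Φᴴ - mu) + (((1 / M : ℝ) : ℂ) • (-V)) := by
      rw [hRR, hSS, hTT, hV, Finset.sum_sub_distrib]
      simp only [neg_sub, smul_sub, Finset.sum_const, Finset.card_univ, Fintype.card_fin]
      have : ((1 / M : ℝ) : ℂ) • (M • mu) = mu := by
        rw [← Nat.cast_smul_eq_nsmul ℂ, smul_smul]
        have : ((1 / M : ℝ) : ℂ) * (M : ℂ) = 1 := by
          push_cast; field_simp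
        rw [this, one_smul]
      rw [this]; abel
    have hmuPi : mu = Pi * (∑ y, (p y : ℂ) • (t y * (t y)ᴴ)) * Pi := by
      rw [hmu, Matrix.mul_sum, Matrix.sum_mul]
      refine Finset.sum_congr rfl fun y _ => ?_
      simp only [hX, conjTranspose_mul, h.Pi1, Matrix.mul_smul, Matrix.smul_mul, Matrix.mul_assoc]
    have hpsd1 : (Φ * Φᴴ - mu).PosSemidef := by
      have e : Φ * Φᴴ - mu = (1 - Pi) * (Φ * Φᴴ) * (1 - Pi)ᴴ +
          Pi * (Φ * Φᴴ - ∑ y, (p y : ℂ) • (t y * (t y)ᴴ)) * Piᴴ := by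
        rw [hmuPi, h.piC.1, h.Pi1]
        have e1 : (1 - Pi) * (Φ * Φᴴ) * (1 - Pi) = Φ * Φᴴ - Pi * (Φ * Φᴴ) * Pi := by
          simp only [Matrix.sub_mul, Matrix.mul_sub, Matrix.one_mul, Matrix.mul_one]
          have : Pi * (Φ * Φᴴ) = Pi * (Φ * Φᴴ) * Pi := by
            conv_rhs => rw [Matrix.mul_assoc, ← h.PiG, ← Matrix.mul_assoc, h.Pi2]
          rw [← this, h.PiG]; abel
        rw [e1, Matrix.mul_sub, Matrix.sub_mul]; abel
      rw [e]
      exact ((posSemidef_self_mul_conjTranspose Φ).mul_mul_conjTranspose_same _).add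
        (h.hle.mul_mul_conjTranspose_same _)
    have htrmu : mu.trace.re = ∑ y, p y * hs (Pi * t y) := by
      rw [hmu, trace_sum, Complex.re_sum]
      refine Finset.sum_congr rfl fun y _ => ?_
      rw [trace_smul, hX, trace_mul_conjT]; simp
    have hA : (Vs * (Φ * Φᴴ - mu)).trace.re ≤ 2 * η := by
      have hW : (1 - Vs).PosSemidef := by
        have : (1 - Vs) = ((1/2 : ℝ) : ℂ) • ((1 - Vs)ᴴ * (1 - Vs)) := by
          rw [conjTranspose_sub, conjTranspose_one, hV1, Matrix.sub_mul, Matrix.mul_sub,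
            Matrix.mul_sub, hV2]
          simp only [Matrix.one_mul, Matrix.mul_one]
          ext i j; simp; ring
        rw [this]
        refine (posSemidef_conjTranspose_mul_self _).smul ?_
        rw [Complex.zero_le_real]; norm_num
      have h1 := trace_mul_psd hW hpsd1
      rw [Matrix.sub_mul, Matrix.one_mul, trace_sub, trace_sub, trace_mul_conjT, h.hΦ] at h1
      simp only [Complex.sub_re, Complex.ofReal_re, htrmu] at h1
      linarith [h.piT']
    have hB : (Vs * (((1 / M : ℝ) : ℂ) • (-V))).trace.re ≤ 2 * u ^ 2 := by
      set Z := ((1 / M : ℝ) : ℂ) • (-V) with hZ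
      have hZs : hs Z = (1 / M) ^ 2 * hs V := by rw [hZ, hs_smul, hs_neg]
      have hVP : V = Pi * V := by
        have hXP : ∀ y, Pi * X y = X y := by
          intro y; simp only [hX]
          rw [← Matrix.mul_assoc, ← Matrix.mul_assoc, h.Pi2]
        have hmP : Pi * mu = mu := by
          rw [hmuPi]; simp only [← Matrix.mul_assoc, h.Pi2]
        rw [hV, Matrix.mul_sum]
        refine Finset.sum_congr rfl fun j _ => ?_
        rw [Matrix.mul_sub, hXP, hmP]
      have hZP : Vs * Z = (Pi * Vs)ᴴ * Z := by
        rw [conjTranspose_mul, h.Pi1, hV1, hZ, Matrix.mul_assoc]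
        congr 1
        rw [Matrix.mul_smul, Matrix.mul_neg, ← hVP]
      have hcs := hs_cs (Pi * Vs) Z
      rw [← hZP] at hcs
      have hPV : hs (Pi * Vs) ≤ d := by
        rw [hs_proj_trace h.Pi1 h.Pi2, hV1, hV2, Matrix.mul_one]; exact h.Pid
      have hfin : (Vs * Z).trace.re ^ 2 ≤ (2 * u ^ 2) ^ 2 := by
        calc (Vs * Z).trace.re ^ 2 ≤ d * hs Z :=
              hcs.trans (mul_le_mul_of_nonneg_right hPV (hs_nonneg _))
          _ = d / (M:ℝ) ^ 2 * hs V := by rw [hZs]; ring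
          _ ≤ 4 * η := by linarith
          _ = _ := by rw [hη]; ring
      exact le_of_abs_le (abs_le_of_sq_le_sq hfin (by positivity))
    rw [hdec, Matrix.mul_add, trace_add, Complex.add_re]
    linarith
  refine ⟨J, Kᴴ * L, ?_, ?_⟩
  · have e : 1 - Kᴴ * L * (Kᴴ * L)ᴴ = (1 - Kᴴ * K) + Kᴴ * (1 - L * Lᴴ) * K := by
      rw [conjTranspose_mul, conjTranspose_conjTranspose, Matrix.mul_sub, Matrix.sub_mul]
      simp only [Matrix.mul_assoc, Matrix.mul_one, Matrix.one_mul]; abel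
    rw [e]
    exact hK2.add (hL1.conjTranspose_mul_mul_same K)
  · have hdiff : hs (T - Φ * (Kᴴ * L)) ≤ 2 * η + 2 * u ^ 2 := by
      have : T - Φ * (Kᴴ * L) = -((R - S) * L) := by
        rw [← Matrix.mul_assoc, hRK, Matrix.sub_mul, hSL]; abel
      rw [this, hs_neg]
      exact (hs_mul_right_le hL1 _).trans hps
    rw [hs_blocks] at hdiff
    set F : Fin M → Matrix W (Fin D) ℂ := fun j => Φ * (Kᴴ * L).submatrix id (fun k => (j, k))
      with hF
    have hFb : ∀ j, (T - Φ * (Kᴴ * L)).submatrix id (fun k => (j, k)) =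
        (r : ℂ) • (Pi * t (J j)) - F j := by
      intro j
      rw [← hTb]
      ext w k
      simp [hF, Matrix.mul_apply]
    simp only [hFb] at hdiff
    have hj : ∀ j, (1 / M) * hs (t (J j)) ≤ (1 + u) * hs (Q (J j) * F j) +
        (1 + 1 / u) * (2 * hs ((r : ℂ) • (Pi * t (J j)) - F j) +
          4 * ((1 / M) * hs ((1 - Pi) * t (J j))) + 4 * ((1 / M) * hs ((1 - Q (J j)) * t (J j)))) := by
      intro j
      set q := Q (J j)
      set tt := t (J j)
      have hq1 : qᴴ = q := h.Q1 _
      have hq2 : q * q = q := h.Q2 _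
      have e : (r : ℂ) • tt = q * F j + (q * ((r : ℂ) • (Pi * tt) - F j) +
          (q * ((r : ℂ) • ((1 - Pi) * tt)) + (r : ℂ) • ((1 - q) * tt))) := by
        rw [Matrix.mul_sub, Matrix.sub_mul, Matrix.sub_mul]
        simp only [smul_sub, Matrix.mul_smul, Matrix.mul_sub, Matrix.one_mul]
        abel
      have b0 := hs_add_le (q * F j) (q * ((r : ℂ) • (Pi * tt) - F j) +
          (q * ((r : ℂ) • ((1 - Pi) * tt)) + (r : ℂ) • ((1 - q) * tt))) hu
      rw [← e, hs_smul, hr2] at b0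
      have b1 := hs_add_le (q * ((r : ℂ) • (Pi * tt) - F j))
          (q * ((r : ℂ) • ((1 - Pi) * tt)) + (r : ℂ) • ((1 - q) * tt)) one_pos
      have b2 := hs_add_le (q * ((r : ℂ) • ((1 - Pi) * tt))) ((r : ℂ) • ((1 - q) * tt)) one_pos
      have b3 := hs_proj_le hq1 hq2 ((r : ℂ) • (Pi * tt) - F j)
      have b4 := hs_proj_le hq1 hq2 ((r : ℂ) • ((1 - Pi) * tt))
      rw [hs_smul, hr2] at b4
      rw [hs_smul, hr2] at b2
      refine b0.trans ?_
      have : 0 ≤ 1 + 1 / u := by positivity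
      gcongr
      linarith
    have hsum := Finset.sum_le_sum fun j (_ : j ∈ Finset.univ) => hj j
    simp only [Finset.sum_add_distrib, ← Finset.mul_sum] at hsum
    set succ := ∑ j, hs (Q (J j) * F j) with hsucc
    have hone : 1 - 4 * η ≤ 1 / M * ∑ j, hs (t (J j)) := by
      have : 1 / (M:ℝ) * ∑ j, (1 - hs (t (J j))) ≤ 4 * η := by linarith
      rw [Finset.sum_sub_distrib, mul_sub] at this
      simp at this
      rw [inv_mul_cancel₀ hM'.ne'] at this
      simp; linarith
    have hb1 : 2 * ∑ j, hs ((r : ℂ) • (Pi * t (J j)) - F j) +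
        4 * (1 / M * ∑ j, hs ((1 - Pi) * t (J j))) +
        4 * (1 / M * ∑ j, hs ((1 - Q (J j)) * t (J j))) ≤ 40 * u ^ 2 := by
      have : η ≤ u ^ 2 := by rw [hη]; exact pow_le_pow_of_le_one hu.le hu1 (by norm_num)
      have z : 1 / (M:ℝ) * ∑ j, hs ((1 - Pi) * t (J j)) +
        (1 / M * ∑ j, hs ((1 - Q (J j)) * t (J j))) ≤ 4 * η := by linarith
      linarith
    have hb2 := mul_le_mul_of_nonneg_left hb1 (show 0 ≤ 1 + 1 / u by positivity)
    have hb3 : (1 + 1 / u) * (40 * u ^ 2) ≤ 80 * u := by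
      have : (1 + 1 / u) * (40 * u ^ 2) = 40 * u ^ 2 + 40 * u := by field_simp
      rw [this]; nlinarith
    have hη1 : η ≤ u := by
      have : u ^ 3 ≤ 1 := pow_le_one₀ hu.le hu1
      rw [hη]; nlinarith
    have hfin : 1 - 84 * u ≤ (1 + u) * succ := by linarith
    have hu2 : 0 ≤ u * u := mul_nonneg hu.le hu.le
    by_contra hcon
    have hlt : succ < 1 - 85 * u := not_le.mp hcon
    have := mul_lt_mul_of_pos_left hlt (show 0 < 1 + u by linarith)
    have e9 : (1 + u) * (1 - 85 * u) = 1 - 84 * u - 85 * (u * u) := by ring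
    linarith

end cov



/-! ### Typicality -/

theorem sum_prod_pow {Ω : Type*} [Fintype Ω] (n : ℕ) (g : Fin n → Ω → ℝ) :
    ∑ x : Fin n → Ω, ∏ k, g k (x k) = ∏ k, ∑ y, g k y := by
  classical
  rw [Finset.prod_univ_sum]; simp

theorem sum_cons {Ω M : Type*} [Fintype Ω] [AddCommMonoid M] (n : ℕ) (F : (Fin (n + 1) → Ω) → M) :
    ∑ x, F x = ∑ a, ∑ x : Fin n → Ω, F (Fin.cons a x) := by
  rw [← Fintype.sum_prod_type']
  exact (Fintype.sum_equiv (Fin.consEquiv (fun _ => Ω)) _ _ (fun x => rfl)).symm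

theorem moments {Ω : Type*} [Fintype Ω] {d f : Ω → ℝ} (hd1 : ∑ x, d x = 1)
    (hf : ∑ x, d x * f x = 0) (n : ℕ) :
    (∑ x : Fin n → Ω, ∏ k, d (x k) = 1) ∧ (∑ x : Fin n → Ω, (∏ k, d (x k)) * ∑ k, f (x k) = 0) ∧
    (∑ x : Fin n → Ω, (∏ k, d (x k)) * (∑ k, f (x k)) ^ 2 = n * ∑ x, d x * f x ^ 2) := by
  induction n with
  | zero => simp
  | succ n ih =>
    obtain ⟨h0, h1, h2⟩ := ih
    refine ⟨?_, ?_, ?_⟩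
    · rw [sum_prod_pow (n+1) (fun _ => d)]; simp [hd1]
    · rw [sum_cons]
      simp only [Fin.prod_univ_succ, Fin.sum_univ_succ, Fin.cons_zero, Fin.cons_succ]
      have : ∀ a (x : Fin n → Ω), d a * (∏ k, d (x k)) * (f a + ∑ k, f (x k)) =
        d a * f a * (∏ k, d (x k)) + d a * ((∏ k, d (x k)) * ∑ k, f (x k)) := by
        intros; ring
      simp only [this, Finset.sum_add_distrib, ← Finset.mul_sum, h0, h1, ← Finset.sum_mul, hf]
      simp
    · rw [sum_cons]
      simp only [Fin.prod_univ_succ, Fin.sum_univ_succ, Fin.cons_zero, Fin.cons_succ]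
      have : ∀ a (x : Fin n → Ω), d a * (∏ k, d (x k)) * (f a + ∑ k, f (x k)) ^ 2 =
        d a * f a ^ 2 * (∏ k, d (x k)) + 2 * (d a * f a) * ((∏ k, d (x k)) * ∑ k, f (x k))
          + d a * ((∏ k, d (x k)) * (∑ k, f (x k)) ^ 2) := by
        intros; ring
      simp only [this, Finset.sum_add_distrib, ← Finset.mul_sum, h0, h1, h2, ← Finset.sum_mul, hf,
        hd1]
      push_cast; ring

theorem typicality {Ω : Type*} [Fintype Ω] {d r : Ω → ℝ} (hd : ∀ x, 0 ≤ d x) (hd1 : ∑ x, d x = 1)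
    (hr : ∀ x, 0 < d x → 0 < r x) {h : ℝ} (hh : h = -∑ x, d x * Real.log (r x))
    {ε δ : ℝ} (hε : 0 < ε) (hδ : 0 < δ) : ∃ N : ℕ, ∀ n ≥ N, ∀ S : (Fin n → Ω) → Prop,
      ∀ [DecidablePred S], (∀ x, Real.exp (-(n * (h + δ))) ≤ ∏ k, r (x k) →
        ∏ k, r (x k) ≤ Real.exp (-(n * (h - δ))) → S x) →
      ∑ x : Fin n → Ω, (if S x then 0 else ∏ k, d (x k)) ≤ ε := by
  set f : Ω → ℝ := fun x => - Real.log (r x) - h with hf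
  have hf0 : ∑ x, d x * f x = 0 := by
    simp only [hf, mul_sub, Finset.sum_sub_distrib, ← Finset.sum_mul, hd1, mul_neg,
      Finset.sum_neg_distrib]
    linarith
  set V := ∑ x, d x * f x ^ 2 with hV
  have hV0 : 0 ≤ V := Finset.sum_nonneg fun x _ => mul_nonneg (hd x) (sq_nonneg _)
  obtain ⟨N, hN⟩ := exists_nat_gt (V / (δ ^ 2 * ε))
  refine ⟨N + 1, fun n hn S _ hS => ?_⟩
  have hn0 : 0 < (n : ℝ) := by exact_mod_cast (by omega : 0 < n)
  have hnV : V / (δ ^ 2 * ε) < n := hN.trans (by exact_mod_cast (by omega : N < n))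
  obtain ⟨-, -, h2⟩ := moments (d := d) (f := f) hd1 hf0 n
  have key : ∀ x : Fin n → Ω, (n * δ) ^ 2 * (if S x then 0 else ∏ k, d (x k)) ≤
      (∏ k, d (x k)) * (∑ k, f (x k)) ^ 2 := by
    intro x
    have hpd : 0 ≤ ∏ k, d (x k) := Finset.prod_nonneg fun k _ => hd _
    split_ifs with hs
    · rw [mul_zero]; positivity
    · rcases hpd.eq_or_lt with h0 | h0
      · rw [← h0]; simp
      · have hdk : ∀ k, 0 < d (x k) := by
          intro k
          refine lt_of_le_of_ne (hd _) fun hc => ?_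
          rw [Finset.prod_eq_zero (Finset.mem_univ k) hc.symm] at h0
          exact lt_irrefl _ h0
        have hprod : ∏ k, r (x k) = Real.exp (-(∑ k, f (x k) + n * h)) := by
          have : ∀ k, r (x k) = Real.exp (-(f (x k) + h)) := by
            intro k
            rw [hf]; simp only [sub_add_cancel, neg_neg]
            rw [Real.exp_log (hr _ (hdk k))]
          rw [Finset.prod_congr rfl fun k _ => this k, ← Real.exp_sum]
          congr 1
          rw [Finset.sum_neg_distrib, Finset.sum_add_distrib]; simp
        have hbad : n * δ ≤ |∑ k, f (x k)| := by
          by_contra hc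
          push Not at hc
          obtain ⟨c1, c2⟩ := abs_lt.mp hc
          apply hs
          apply hS <;> rw [hprod] <;> apply Real.exp_le_exp.mpr <;> linarith
        have : (n * δ) ^ 2 ≤ (∑ k, f (x k)) ^ 2 := by
          rw [← sq_abs (∑ k, f (x k))]; exact pow_le_pow_left₀ (by positivity) hbad 2
        rw [mul_comm]
        exact mul_le_mul_of_nonneg_left this hpd
  have hsum := Finset.sum_le_sum fun x (_ : x ∈ Finset.univ) => key x
  rw [← Finset.mul_sum, h2, ← hV] at hsum
  have hpos : 0 < (n * δ) ^ 2 := by positivity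
  rw [div_lt_iff₀ (by positivity)] at hnV
  have : (n:ℝ) * V ≤ (n * δ) ^ 2 * ε := by nlinarith
  exact le_of_mul_le_mul_left (hsum.trans this) hpos


/-! ### Building covering data from spectral data -/

theorem exists_inj {I : Type*} [Fintype I] [DecidableEq I] (S : Finset I) {D : ℕ} (h : S.card ≤ D) :
    ∃ J : Matrix I (Fin D) ℂ, J * Jᴴ = diagonal (fun i => if i ∈ S then (1 : ℂ) else 0) := by
  let f : S → Fin D := fun i => Fin.castLE h (S.equivFin i)
  have hf : Function.Injective f := fun a b hab => by
    apply S.equivFin.injective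
    exact Fin.castLE_injective h hab
  refine ⟨Matrix.of fun i k => if h : i ∈ S then (if f ⟨i, h⟩ = k then 1 else 0) else 0, ?_⟩
  ext i i'
  rw [Matrix.mul_apply]
  by_cases hi : i ∈ S <;> by_cases hi' : i' ∈ S
  · simp only [conjTranspose_apply, Matrix.of_apply, hi, hi', dite_true]
    by_cases e : i = i'
    · subst e; simp [hi]
    · have : f ⟨i', hi'⟩ ≠ f ⟨i, hi⟩ := fun hc => e (by have := hf hc; simpa using this.symm)
      simp [e, this.symm]
  · have : i ≠ i' := fun e => hi' (e ▸ hi)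
    simp [hi, hi', this]
  · have : i ≠ i' := fun e => hi (e ▸ hi')
    simp [hi, hi', this]
  · by_cases e : i = i'
    · subst e; simp [hi]
    · simp [hi, hi', e]

theorem cov_of_spectral {A W Y : Type*} [Fintype A] [DecidableEq A] [Fintype W] [DecidableEq W]
    [Fintype Y] {D : ℕ} {Φ : Matrix W A ℂ} (hΦ : hs Φ = 1) {σ : Y → Matrix W W ℂ}
    (hσ : ∑ y, σ y = Φ * Φᴴ)
    {U : Y → Matrix W W ℂ} {m : Y → W → ℝ} (hU : ∀ y, (U y)ᴴ * U y = 1)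
    (hU' : ∀ y, U y * (U y)ᴴ = 1)
    (hm : ∀ y i, 0 ≤ m y i) (hσm : ∀ y, σ y = fc (U y) (m y))
    {p : Y → ℝ} (hp : ∀ y, p y = ∑ i, m y i)
    {UG : Matrix W W ℂ} {g : W → ℝ} (hUG : UGᴴ * UG = 1) (hUG' : UG * UGᴴ = 1)
    (hG : Φ * Φᴴ = fc UG g)
    {S : Y → Finset W} {T : Finset W} {Q : Y → Matrix W W ℂ} {d c η : ℝ} (hc : 0 ≤ c)
    (hS : ∀ y, ∀ i ∈ S y, m y i ≤ p y * c) (hSD : ∀ y, (S y).card ≤ D)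
    (hSη : ∑ y, ∑ i, (if i ∈ S y then 0 else m y i) ≤ η)
    (hT : (T.card : ℝ) ≤ d) (hd : 0 < d) (hTη : ∑ i, (if i ∈ T then 0 else g i) ≤ η)
    (Q1 : ∀ y, (Q y)ᴴ = Q y) (Q2 : ∀ y, Q y * Q y = Q y)
    (hQ : ∑ y, ((1 - Q y) * σ y).trace.re ≤ η) :
    ∃ (t : Y → Matrix W (Fin D) ℂ) (Pi : Matrix W W ℂ), Cov Φ p t Pi Q d c η := by
  classical
  have hp0 : ∀ y, 0 ≤ p y := fun y => by rw [hp]; exact Finset.sum_nonneg fun i _ => hm y i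
  have hmp : ∀ y i, m y i ≤ p y := fun y i => by
    rw [hp]; exact Finset.single_le_sum (fun i _ => hm y i) (Finset.mem_univ i)
  have hpm : ∀ y i, p y * (m y i / p y) = m y i := fun y i => by
    by_cases h0 : p y = 0
    · have := hmp y i; have := hm y i
      rw [h0]; linarith
    · field_simp
  choose J hJ using fun y => exists_inj (S y) (hSD y)
  let q : Y → W → ℝ := fun y i => if i ∈ S y then m y i / p y else 0
  have hq0 : ∀ y i, 0 ≤ q y i := fun y i => by
    simp only [q]; split_ifs
    · exact div_nonneg (hm y i) (hp0 y)
    · exact le_rfl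
  let t : Y → Matrix W (Fin D) ℂ := fun y =>
    U y * diagonal (fun i => ((√(m y i / p y) : ℝ) : ℂ)) * J y
  have htt : ∀ y, t y * (t y)ᴴ = fc (U y) (q y) := by
    intro y
    simp only [t, conjTranspose_mul, diagonal_conjTranspose, fc]
    rw [Matrix.mul_assoc, ← Matrix.mul_assoc (J y), hJ]
    simp only [← Matrix.mul_assoc]
    rw [Matrix.mul_assoc (U y), Matrix.mul_assoc (U y), diagonal_mul_diagonal, diagonal_mul_diagonal]
    congr 3
    ext i
    simp only [q, Pi.star_apply, RCLike.star_def, Complex.conj_ofReal]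
    split_ifs
    · rw [mul_one, ← Complex.ofReal_mul, Real.mul_self_sqrt (div_nonneg (hm y i) (hp0 y))]
    · simp
  have hst : ∀ y, hs (t y) = ∑ i, q y i := by
    intro y
    have := trace_mul_conjT (t y)
    rw [htt, fc_trace (hU y)] at this
    exact_mod_cast this.symm
  have hpq : ∀ y i, p y * q y i = if i ∈ S y then m y i else 0 := by
    intro y i; simp only [q, mul_ite, mul_zero, hpm]
  have hpq' : ∀ y i, p y * q y i ≤ m y i := by
    intro y i; rw [hpq]; split_ifs
    · exact le_rfl
    · exact hm y i
  have hdiff : ∀ y, (σ y - (p y : ℂ) • (t y * (t y)ᴴ)).PosSemidef := by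
    intro y
    rw [htt, fc_smul, hσm, fc_sub]
    exact fc_posSemidef _ fun i => by linarith [hpq' y i]
  have htot : ∑ y, p y = 1 := by
    have h1 := trace_mul_conjT Φ
    rw [← hσ, trace_sum, hΦ] at h1
    simp only [hσm, fc_trace (hU _), ← hp] at h1
    exact_mod_cast h1
  have hm1 : ∑ y, ∑ i, m y i = 1 := by rw [← htot]; simp only [hp]
  set P : Matrix W W ℂ := fc UG (fun i => if i ∈ T then 1 else 0) with hP
  have hPi2 : P * P = P := by
    rw [hP, fc_mul hUG]; congr 1; ext i; split_ifs <;> simp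
  have hPi1 : Pᴴ = P := fc_conjT _ _
  refine ⟨t, P, ⟨hΦ, hp0, htot, ?_, ?_, ?_, hc, hPi1, hPi2, ?_, ?_, hd, Q1, Q2, ?_, ?_, ?_⟩⟩
  · rw [← hσ, ← Finset.sum_sub_distrib]
    exact posSemidef_sum _ fun y _ => hdiff y
  · intro y
    rw [hst]
    have h1 : ∑ i, q y i ≤ ∑ i, m y i / p y := Finset.sum_le_sum fun i _ => by
      simp only [q]; split_ifs
      · exact le_rfl
      · exact div_nonneg (hm y i) (hp0 y)
    rw [← Finset.sum_div, ← hp] at h1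
    exact h1.trans (div_self_le_one _)
  · intro y
    rw [htt, ← fc_one (hU' y), fc_smul, fc_sub]
    apply fc_posSemidef
    intro i
    simp only [q]
    split_ifs with hi
    · rcases (hp0 y).eq_or_lt with h0 | h0
      · rw [← h0]; simpa using hc
      · have := hS y i hi
        rw [mul_comm] at this
        have := (div_le_iff₀ h0).mpr this
        linarith
    · simpa using hc
  · rw [hG, hP, fc_mul hUG, fc_mul hUG]; congr 1; ext i; ring
  · rw [hP, fc_trace hUG, Complex.ofReal_re]; simpa using hT
  · have : ∑ y, p y * hs (t y) = ∑ y, ∑ i, (if i ∈ S y then m y i else 0) := by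
      simp only [hst, Finset.mul_sum, hpq]
    rw [this]
    have h2 : ∑ y, ∑ i, (if i ∈ S y then m y i else 0) + ∑ y, ∑ i, (if i ∈ S y then 0 else m y i) = 1 := by
      rw [← hm1]; simp only [← Finset.sum_add_distrib]
      refine Finset.sum_congr rfl fun y _ => Finset.sum_congr rfl fun i _ => ?_
      split_ifs <;> simp
    linarith
  · rw [hs_proj_trace (by simp [hPi1]) (by rw [Matrix.sub_mul, Matrix.mul_sub P, hPi2]; simp)]
    rw [hG, hP, ← fc_one hUG', fc_sub, fc_mul hUG, fc_trace hUG, Complex.ofReal_re]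
    refine le_of_eq_of_le (Finset.sum_congr rfl fun i _ => ?_) hTη
    split_ifs <;> simp
  · refine le_trans (Finset.sum_le_sum fun y _ => ?_) hQ
    have hq1 : (1 - Q y)ᴴ = 1 - Q y := by simp [Q1]
    have hq2 : (1 - Q y) * (1 - Q y) = 1 - Q y := by
      rw [Matrix.sub_mul, Matrix.mul_sub (Q y), Q2]; simp
    rw [hs_proj_trace hq1 hq2]
    have := trace_mul_psd (psd_proj hq1 hq2) (hdiff y)
    rw [Matrix.mul_sub, trace_sub, Matrix.mul_smul, trace_smul, Complex.sub_re, smul_eq_mul,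
      Complex.re_ofReal_mul] at this
    linarith


/-! ### Tensor products of families of matrices -/

def tpr {n : ℕ} {m k : Type*} (F : Fin n → Matrix m k ℂ) : Matrix (Fin n → m) (Fin n → k) ℂ :=
  Matrix.of fun x y => ∏ i, F i (x i) (y i)

section tpr
variable {n : ℕ} {m k l : Type*} [Fintype m] [Fintype k] [Fintype l] [DecidableEq m]
  [DecidableEq k] [DecidableEq l]

theorem tpr_apply (F : Fin n → Matrix m k ℂ) (x y) : tpr F x y = ∏ i, F i (x i) (y i) := rfl

theorem sum_prod_powC {Ω : Type*} [Fintype Ω] {R : Type*} [CommSemiring R] (g : Fin n → Ω → R) :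
    ∑ x : Fin n → Ω, ∏ k, g k (x k) = ∏ k, ∑ y, g k y := by
  classical
  rw [Finset.prod_univ_sum]; simp

theorem tpr_mul (F : Fin n → Matrix m k ℂ) (G : Fin n → Matrix k l ℂ) :
    tpr F * tpr G = tpr (fun i => F i * G i) := by
  ext x y
  rw [Matrix.mul_apply]
  simp only [tpr_apply, Matrix.mul_apply, ← Finset.prod_mul_distrib]
  rw [sum_prod_powC (fun i z => F i (x i) z * G i z (y i))]

theorem tpr_conjT (F : Fin n → Matrix m k ℂ) : (tpr F)ᴴ = tpr (fun i => (F i)ᴴ) := by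
  ext x y
  simp [tpr_apply, conjTranspose_apply]

theorem tpr_diagonal (v : Fin n → m → ℂ) :
    tpr (fun i => diagonal (v i)) = diagonal (fun x => ∏ i, v i (x i)) := by
  ext x y
  rw [tpr_apply]
  by_cases h : x = y
  · subst h; simp
  · rw [diagonal_apply_ne _ h]
    obtain ⟨i, hi⟩ := Function.ne_iff.mp h
    exact Finset.prod_eq_zero (Finset.mem_univ i) (diagonal_apply_ne _ hi)

theorem tpr_one : tpr (fun _ : Fin n => (1 : Matrix m m ℂ)) = 1 := by
  rw [← diagonal_one, tpr_diagonal (fun _ _ => 1)]; simp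

theorem tpr_fc (U : Fin n → Matrix m k ℂ) (v : Fin n → k → ℝ) :
    tpr (fun i => fc (U i) (v i)) = fc (tpr U) (fun x => ∏ i, v i (x i)) := by
  unfold fc
  rw [← tpr_mul, ← tpr_mul, tpr_conjT, tpr_diagonal]
  simp

theorem tpr_sum {Y : Type*} [Fintype Y] (F : Y → Matrix m k ℂ) :
    ∑ y : Fin n → Y, tpr (fun i => F (y i)) = tpr (fun _ => ∑ y, F y) := by
  ext x z
  rw [Matrix.sum_apply]
  simp only [tpr_apply, Matrix.sum_apply]
  rw [sum_prod_powC (fun i y => F y (x i) (z i))]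

theorem tpr_trace (F : Fin n → Matrix m m ℂ) : (tpr F).trace = ∏ i, (F i).trace := by
  simp only [Matrix.trace, diag_apply, tpr_apply]
  rw [sum_prod_powC (fun i x => F i x x)]

theorem hs_tpr (F : Fin n → Matrix m k ℂ) : hs (tpr F) = ∏ i, hs (F i) := by
  have h := trace_mul_conjT (tpr F)
  rw [tpr_conjT, tpr_mul, tpr_trace] at h
  simp only [trace_mul_conjT] at h
  exact_mod_cast h.symm

end tpr

theorem sum_arrow {n : ℕ} {Y W M : Type*} [Fintype Y] [Fintype W] [AddCommMonoid M]
    (F : (Fin n → Y) → (Fin n → W) → M) :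
    ∑ y, ∑ w, F y w = ∑ x : Fin n → Y × W, F (fun k => (x k).1) (fun k => (x k).2) := by
  rw [← Fintype.sum_prod_type']
  exact (Fintype.sum_equiv (Equiv.arrowProdEquivProdArrow (Fin n) (fun _ => Y) (fun _ => W)) _ _
    (fun x => rfl)).symm

theorem card_le_exp {I : Type*} [Fintype I] {q : I → ℝ} (hq : ∀ i, 0 ≤ q i) (h1 : ∑ i, q i ≤ 1)
    (S : Finset I) {a : ℝ} (hS : ∀ i ∈ S, Real.exp (-a) ≤ q i) : (S.card : ℝ) ≤ Real.exp a := by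
  have h2 : ∑ i ∈ S, Real.exp (-a) ≤ ∑ i ∈ S, q i := Finset.sum_le_sum hS
  have h3 : ∑ i ∈ S, q i ≤ ∑ i, q i :=
    Finset.sum_le_sum_of_subset_of_nonneg (Finset.subset_univ _) fun i _ _ => hq i
  rw [Finset.sum_const, nsmul_eq_mul] at h2
  have h4 : (S.card : ℝ) * Real.exp (-a) ≤ 1 := by linarith
  rw [Real.exp_neg, mul_inv_le_iff₀ (Real.exp_pos a)] at h4
  linarith


/-! ### The i.i.d. covering -/

structure SD (α β E Y : Type*) [Fintype α] [DecidableEq α] [Fintype β] [DecidableEq β]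
    [Fintype E] [DecidableEq E] [Fintype Y] [DecidableEq Y] where
  Φ : Matrix (β × E) α ℂ
  σ : Y → Matrix (β × E) (β × E) ℂ
  U : Y → Matrix (β × E) (β × E) ℂ
  μ : Y → β × E → ℝ
  p : Y → ℝ
  UG : Matrix (β × E) (β × E) ℂ
  g : β × E → ℝ
  V : Y → Matrix β β ℂ
  ν : Y → β → ℝ
  hΦ : hs Φ = 1
  hσ : ∑ y, σ y = Φ * Φᴴ
  hU : ∀ y, (U y)ᴴ * U y = 1
  hU' : ∀ y, U y * (U y)ᴴ = 1
  hμ : ∀ y w, 0 ≤ μ y w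
  hσμ : ∀ y, σ y = fc (U y) (μ y)
  hp : ∀ y, p y = ∑ w, μ y w
  hUG : UGᴴ * UG = 1
  hUG' : UG * UGᴴ = 1
  hg : ∀ w, 0 ≤ g w
  hG : Φ * Φᴴ = fc UG g
  hV : ∀ y, (V y)ᴴ * V y = 1
  hV' : ∀ y, V y * (V y)ᴴ = 1
  hν : ∀ y i, ∑ e, ((V y ⊗ₖ (1 : Matrix E E ℂ)) * σ y * (V y ⊗ₖ (1 : Matrix E E ℂ))ᴴ) (i, e) (i, e)
    = (ν y i : ℂ)

namespace SD
variable {α β E Y : Type*} [Fintype α] [DecidableEq α] [Fintype β] [DecidableEq β]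
    [Fintype E] [DecidableEq E] [Fintype Y] [DecidableEq Y] (s : SD α β E Y)

def H : ℝ := -∑ w, s.g w * Real.log (s.g w)
def h2 : ℝ := -∑ y, ∑ w, s.μ y w * Real.log (s.μ y w / s.p y)
def h3 : ℝ := -∑ y, ∑ i, s.ν y i * Real.log (s.ν y i / s.p y)
def Vt (y : Y) : Matrix (β × E) (β × E) ℂ := s.V y ⊗ₖ (1 : Matrix E E ℂ)
def dd (y : Y) (w : β × E) : ℝ := ((s.Vt y * s.σ y * (s.Vt y)ᴴ) w w).re

theorem Vt1 (y : Y) : (s.Vt y)ᴴ * s.Vt y = 1 := by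
  rw [Vt, conjTranspose_kronecker, ← mul_kronecker_mul, s.hV]; simp

theorem Vt2 (y : Y) : s.Vt y * (s.Vt y)ᴴ = 1 := by
  rw [Vt, conjTranspose_kronecker, ← mul_kronecker_mul, s.hV']; simp

theorem psdσ (y : Y) : (s.σ y).PosSemidef := by
  rw [s.hσμ]; exact fc_posSemidef _ (s.hμ y)

theorem ddC (y : Y) (w : β × E) : (s.Vt y * s.σ y * (s.Vt y)ᴴ) w w = (s.dd y w : ℂ) ∧ 0 ≤ s.dd y w := by
  have h := ((s.psdσ y).mul_mul_conjTranspose_same (s.Vt y)).diag_nonneg (i := w)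
  have h2 := Complex.nonneg_iff.1 h
  refine ⟨Complex.ext rfl ?_, h2.1⟩
  rw [← h2.2]; simp

theorem dd_sum (y : Y) (i : β) : ∑ e, s.dd y (i, e) = s.ν y i := by
  have h := s.hν y i
  have : ∀ e, ((s.V y ⊗ₖ (1 : Matrix E E ℂ)) * s.σ y * (s.V y ⊗ₖ (1 : Matrix E E ℂ))ᴴ) (i, e) (i, e)
      = (s.dd y (i, e) : ℂ) := fun e => (s.ddC y (i, e)).1
  simp only [this] at h
  exact_mod_cast h

theorem ν0 (y : Y) (i : β) : 0 ≤ s.ν y i := by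
  rw [← s.dd_sum]; exact Finset.sum_nonneg fun e _ => (s.ddC y _).2

theorem dd_tot (y : Y) : ∑ w, s.dd y w = s.p y := by
  have h1 : (s.Vt y * s.σ y * (s.Vt y)ᴴ).trace = (s.p y : ℂ) := by
    rw [Matrix.trace_mul_comm, ← Matrix.mul_assoc, s.Vt1, Matrix.one_mul, s.hσμ, fc_trace (s.hU y),
      ← s.hp]
  simp only [Matrix.trace, diag_apply, (s.ddC y _).1] at h1
  exact_mod_cast h1

theorem ν_tot (y : Y) : ∑ i, s.ν y i = s.p y := by
  rw [← s.dd_tot, Fintype.sum_prod_type]; simp only [s.dd_sum]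

theorem p0 (y : Y) : 0 ≤ s.p y := by rw [s.hp]; exact Finset.sum_nonneg fun w _ => s.hμ y w

theorem p_tot : ∑ y, s.p y = 1 := by
  have h1 := trace_mul_conjT s.Φ
  rw [← s.hσ, trace_sum, s.hΦ] at h1
  simp only [s.hσμ, fc_trace (s.hU _), ← s.hp] at h1
  exact_mod_cast h1

theorem g_tot : ∑ w, s.g w = 1 := by
  have h1 := trace_mul_conjT s.Φ
  rw [s.hG, fc_trace s.hUG, s.hΦ] at h1
  exact_mod_cast h1

theorem cnt {X : Type*} [Fintype X] (f : Y → X → ℝ) (hf : ∀ y x, 0 ≤ f y x)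
    (hf1 : ∀ y, ∑ x, f y x = s.p y) {n : ℕ} (y : Fin n → Y) :
    ∑ x : Fin n → X, ∏ k, (f (y k) (x k) / s.p (y k)) ≤ 1 := by
  rw [sum_prod_powC (fun k x => f (y k) x / s.p (y k))]
  refine Finset.prod_le_one (fun k _ => Finset.sum_nonneg fun x _ => div_nonneg (hf _ _) (s.p0 _)) ?_
  intro k _
  rw [← Finset.sum_div, hf1]; exact div_self_le_one _

/-- typicality, packaged for the data -/
theorem typ {η δ : ℝ} (hη : 0 < η) (hδ : 0 < δ) : ∃ N : ℕ, ∀ n ≥ N,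
    ∃ (S : (Fin n → Y) → Finset (Fin n → β × E)) (T : Finset (Fin n → β × E))
      (Gd : (Fin n → Y) → Finset (Fin n → β)),
      (∀ y, ((S y).card : ℝ) ≤ Real.exp (n * (s.h2 + δ))) ∧
      (∀ y, ∀ w ∈ S y, ∏ k, s.μ (y k) (w k) ≤ (∏ k, s.p (y k)) * Real.exp (-(n * (s.h2 - δ)))) ∧
      (∑ y, ∑ w, (if w ∈ S y then 0 else ∏ k, s.μ (y k) (w k)) ≤ η) ∧
      ((T.card : ℝ) ≤ Real.exp (n * (s.H + δ))) ∧
      (∑ w, (if w ∈ T then 0 else ∏ k, s.g (w k)) ≤ η) ∧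
      (∀ y, ((Gd y).card : ℝ) ≤ Real.exp (n * (s.h3 + δ))) ∧
      (∑ y, ∑ w : Fin n → β × E, (if (fun k => (w k).1) ∈ Gd y then 0 else
        ∏ k, s.dd (y k) (w k)) ≤ η) := by
  classical
  have hμp : ∀ y w, s.μ y w ≤ s.p y := fun y w => by
    rw [s.hp]; exact Finset.single_le_sum (fun w _ => s.hμ y w) (Finset.mem_univ w)
  have hνp : ∀ y i, s.ν y i ≤ s.p y := fun y i => by
    rw [← s.ν_tot]; exact Finset.single_le_sum (fun w _ => s.ν0 y w) (Finset.mem_univ i)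
  obtain ⟨N1, hN1⟩ := typicality (d := s.g) (r := s.g) s.hg s.g_tot (fun _ h => h) (h := s.H) rfl hη hδ
  obtain ⟨N2, hN2⟩ := typicality (Ω := Y × (β × E)) (d := fun x => s.μ x.1 x.2)
    (r := fun x => s.μ x.1 x.2 / s.p x.1) (fun x => s.hμ _ _)
    (by rw [Fintype.sum_prod_type]; simp only [← s.hp, s.p_tot])
    (fun x h => div_pos h (h.trans_le (hμp _ _))) (h := s.h2)
    (by rw [h2, Fintype.sum_prod_type]) hη hδ
  obtain ⟨N3, hN3⟩ := typicality (Ω := Y × (β × E)) (d := fun x => s.dd x.1 x.2)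
    (r := fun x => s.ν x.1 x.2.1 / s.p x.1) (fun x => (s.ddC _ _).2)
    (by rw [Fintype.sum_prod_type]; simp only [s.dd_tot, s.p_tot])
    (fun x h => by
      have : s.dd x.1 x.2 ≤ s.ν x.1 x.2.1 := by
        rw [← s.dd_sum]
        exact Finset.single_le_sum (f := fun e => s.dd x.1 (x.2.1, e))
          (fun e _ => (s.ddC _ _).2) (Finset.mem_univ x.2.2)
      exact div_pos (h.trans_le this) (h.trans_le (this.trans (hνp _ _)))) (h := s.h3)
    (by
      rw [h3, Fintype.sum_prod_type]
      simp only [Fintype.sum_prod_type (α₁ := β), ← Finset.sum_mul, s.dd_sum]) hη hδ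
  refine ⟨max N1 (max N2 N3), fun n hn => ?_⟩
  have hn1 : N1 ≤ n := (le_max_left _ _).trans hn
  have hn2 : N2 ≤ n := ((le_max_left _ _).trans (le_max_right _ _)).trans hn
  have hn3 : N3 ≤ n := ((le_max_right _ _).trans (le_max_right _ _)).trans hn
  refine ⟨fun y => Finset.univ.filter fun w => Real.exp (-(n * (s.h2 + δ))) ≤
      ∏ k, (s.μ (y k) (w k) / s.p (y k)) ∧ ∏ k, (s.μ (y k) (w k) / s.p (y k)) ≤
        Real.exp (-(n * (s.h2 - δ))),
    Finset.univ.filter fun w => Real.exp (-(n * (s.H + δ))) ≤ ∏ k, s.g (w k),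
    fun y => Finset.univ.filter fun w => Real.exp (-(n * (s.h3 + δ))) ≤
      ∏ k, (s.ν (y k) (w k) / s.p (y k)), ?_, ?_, ?_, ?_, ?_, ?_, ?_⟩
  · intro y
    refine card_le_exp (fun w => Finset.prod_nonneg fun k _ => div_nonneg (s.hμ _ _) (s.p0 _))
      (s.cnt s.μ s.hμ (fun y => (s.hp y).symm) y) _ ?_
    intro w hw
    exact (Finset.mem_filter.mp hw).2.1
  · intro y w hw
    have h := (Finset.mem_filter.mp hw).2.2
    calc ∏ k, s.μ (y k) (w k) = (∏ k, s.p (y k)) * ∏ k, (s.μ (y k) (w k) / s.p (y k)) := by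
          rw [← Finset.prod_mul_distrib]
          refine Finset.prod_congr rfl fun k _ => ?_
          by_cases h0 : s.p (y k) = 0
          · have := hμp (y k) (w k); have := s.hμ (y k) (w k)
            rw [h0] at *; linarith
          · field_simp
      _ ≤ _ := mul_le_mul_of_nonneg_left h (Finset.prod_nonneg fun k _ => s.p0 _)
  · rw [sum_arrow]
    simp only [Finset.mem_filter, Finset.mem_univ, true_and]
    exact hN2 n hn2 _ (fun x h1 h2 => ⟨h1, h2⟩)
  · refine card_le_exp (q := fun w : Fin n → β × E => ∏ k, s.g (w k)) (fun w => Finset.prod_nonneg fun k _ => s.hg _) ?_ _ ?_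
    · rw [sum_prod_powC (fun _ => s.g)]; simp [s.g_tot]
    · intro w hw
      exact (Finset.mem_filter.mp hw).2
  · simp only [Finset.mem_filter, Finset.mem_univ, true_and]
    exact hN1 n hn1 _ (fun x h1 h2 => h1)
  · intro y
    refine card_le_exp (fun w => Finset.prod_nonneg fun k _ => div_nonneg (s.ν0 _ _) (s.p0 _))
      (s.cnt s.ν s.ν0 s.ν_tot y) _ ?_
    intro w hw
    exact (Finset.mem_filter.mp hw).2
  · rw [sum_arrow]
    simp only [Finset.mem_filter, Finset.mem_univ, true_and]
    exact hN3 n hn3 _ (fun x h1 h2 => h1)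

end SD


theorem trace_fc_mul {W X : Type*} [Fintype W] [DecidableEq W] [Fintype X] [DecidableEq X]
    (U : Matrix W X ℂ) (v : X → ℝ) (S : Matrix W W ℂ) :
    (fc U v * S).trace.re = ∑ x, v x * ((Uᴴ * S * U) x x).re := by
  rw [fc, Matrix.mul_assoc, Matrix.mul_assoc, Matrix.trace_mul_comm, Matrix.mul_assoc,
    Matrix.trace, Complex.re_sum]
  refine Finset.sum_congr rfl fun x _ => ?_
  rw [diag_apply, diagonal_mul, Complex.re_ofReal_mul]

namespace SD
variable {α β E Y : Type*} [Fintype α] [DecidableEq α] [Fintype β] [DecidableEq β]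
    [Fintype E] [DecidableEq E] [Fintype Y] [DecidableEq Y] (s : SD α β E Y)

theorem iid {ε δ : ℝ} (hε : 0 < ε) (hδ : 0 < δ) : ∃ N : ℕ, ∀ n ≥ N, ∃ M D K : ℕ,
    0 < M ∧ 0 < D ∧ 0 < K ∧ Real.log M ≤ n * (s.H - s.h2 + δ) ∧
    Real.log M + Real.log D ≤ n * (s.H + δ) ∧ Real.log K ≤ n * (s.h3 + δ) ∧
    ∃ (J : Fin M → Fin n → Y) (Gd : (Fin n → Y) → Finset (Fin n → β))
      (nn : Matrix (Fin n → α) (Fin M × Fin D) ℂ), (∀ y, (Gd y).card ≤ K) ∧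
      (1 - nn * nnᴴ).PosSemidef ∧
      1 - ε ≤ ∑ j, hs (diagonal (fun w : Fin n → β × E =>
          if (fun k => (w k).1) ∈ Gd (J j) then (1 : ℂ) else 0) *
        (tpr (fun k : Fin n => s.Vt (J j k)) * (tpr (fun _ : Fin n => s.Φ) * nn.submatrix id (fun k : Fin D => (j, k))))) := by
  classical
  set u : ℝ := min (ε / 85) (1 / 170) with hu
  have hu0 : 0 < u := lt_min (by positivity) (by norm_num)
  have hue : 85 * u ≤ ε := by
    have : u ≤ ε / 85 := min_le_left _ _
    linarith
  have hu2 : u ≤ 1 / 170 := min_le_right _ _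
  have hu4 : 0 < u ^ 4 := by positivity
  have hu5 : u ^ 4 ≤ 1 / 4 := by
    have : u ^ 4 ≤ u ^ 1 := pow_le_pow_of_le_one hu0.le (by linarith) (by norm_num)
    rw [pow_one] at this; linarith
  set δ' := δ / 5 with hδ'
  have hδ0 : 0 < δ' := by positivity
  obtain ⟨N, hN⟩ := s.typ hu4 hδ0
  obtain ⟨N', hN'⟩ := exists_nat_gt (max 2 (-Real.log (u ^ 4)) / δ')
  refine ⟨max N N', fun n hn => ?_⟩
  have hn1 : N ≤ n := (le_max_left _ _).trans hn
  have hn2 : max 2 (-Real.log (u ^ 4)) < n * δ' := by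
    have : (N' : ℝ) ≤ n := by exact_mod_cast (le_max_right _ _).trans hn
    rw [div_lt_iff₀ hδ0] at hN'
    exact hN'.trans_le (mul_le_mul_of_nonneg_right this hδ0.le)
  have hn3 : 2 < n * δ' := (le_max_left _ _).trans_lt hn2
  have hn4 : -Real.log (u ^ 4) < n * δ' := (le_max_right _ _).trans_lt hn2
  obtain ⟨S, T, Gd, hS1, hS2, hS3, hT1, hT2, hG1, hG2⟩ := hN n hn1
  set x : ℝ := n * (s.H - s.h2 + 3 * δ') with hx
  set M : ℕ := ⌈Real.exp x⌉₊ with hM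
  have hM0 : 0 < M := Nat.ceil_pos.mpr (Real.exp_pos _)
  set D : ℕ := ⌊Real.exp (n * (s.h2 + δ'))⌋₊ with hD
  set K : ℕ := ⌊Real.exp (n * (s.h3 + δ'))⌋₊ with hK
  set d := Real.exp (n * (s.H + δ')) with hd
  set c := Real.exp (-(n * (s.h2 - δ'))) with hc
  have hdc : d * c = Real.exp (n * (s.H - s.h2 + 2 * δ')) := by
    rw [hd, hc, ← Real.exp_add]; congr 1; ring
  -- spectral data
  let ind : (Fin n → Y) → (Fin n → β × E) → ℝ := fun y w => if (fun k => (w k).1) ∈ Gd y then 1 else 0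
  let VV : (Fin n → Y) → Matrix (Fin n → β × E) (Fin n → β × E) ℂ := fun y => tpr (fun k => s.Vt (y k))
  have VV1 : ∀ y, (VV y)ᴴ * VV y = 1 := by
    intro y; simp only [VV]; rw [tpr_conjT, tpr_mul]; simp only [s.Vt1, tpr_one]
  have VV2 : ∀ y, VV y * (VV y)ᴴ = 1 := by
    intro y; simp only [VV]; rw [tpr_conjT, tpr_mul]; simp only [s.Vt2, tpr_one]
  let Q : (Fin n → Y) → Matrix (Fin n → β × E) (Fin n → β × E) ℂ := fun y => fc (VV y)ᴴ (ind y)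
  have Q1 : ∀ y, (Q y)ᴴ = Q y := fun y => fc_conjT _ _
  have Q2 : ∀ y, Q y * Q y = Q y := by
    intro y
    simp only [Q]
    rw [fc_mul (by rw [conjTranspose_conjTranspose]; exact VV2 y)]
    congr 1; ext w; simp only [ind]; split_ifs <;> simp
  obtain ⟨t, Pi, hcov⟩ := cov_of_spectral (D := D) (Φ := tpr (fun _ : Fin n => s.Φ))
    (σ := fun y : Fin n → Y => tpr (fun k => s.σ (y k)))
    (U := fun y : Fin n → Y => tpr (fun k => s.U (y k)))
    (m := fun y w => ∏ k, s.μ (y k) (w k)) (p := fun y => ∏ k, s.p (y k))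
    (UG := tpr (fun _ => s.UG)) (g := fun w => ∏ k, s.g (w k)) (S := S) (T := T) (Q := Q)
    (d := d) (c := c) (η := u ^ 4)
    (by rw [hs_tpr]; simp [s.hΦ])
    (by rw [tpr_sum, s.hσ, tpr_conjT, tpr_mul])
    (by intro y; rw [tpr_conjT, tpr_mul]; simp only [s.hU, tpr_one])
    (by intro y; rw [tpr_conjT, tpr_mul]; simp only [s.hU', tpr_one])
    (fun y w => Finset.prod_nonneg fun k _ => s.hμ _ _)
    (by intro y; simp only [s.hσμ]; rw [tpr_fc])
    (by intro y; rw [sum_prod_powC (fun k w => s.μ (y k) w)]; simp only [s.hp])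
    (by rw [tpr_conjT, tpr_mul]; simp only [s.hUG, tpr_one])
    (by rw [tpr_conjT, tpr_mul]; simp only [s.hUG', tpr_one])
    (by rw [tpr_conjT, tpr_mul, s.hG, tpr_fc])
    (Real.exp_pos _).le hS2 (fun y => Nat.le_floor (hS1 y)) hS3 hT1 (Real.exp_pos _) hT2 Q1 Q2
    (by
      refine le_of_eq_of_le (Finset.sum_congr rfl fun y _ => ?_) hG2
      have hX : ((VV y)ᴴ)ᴴ * (VV y)ᴴ = 1 := by rw [conjTranspose_conjTranspose]; exact VV2 y
      have e : 1 - Q y = fc (VV y)ᴴ (fun w => 1 - ind y w) := by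
        rw [← fc_sub, fc_one (by rw [conjTranspose_conjTranspose]; exact VV1 y)]
      rw [e, trace_fc_mul, conjTranspose_conjTranspose]
      refine Finset.sum_congr rfl fun w _ => ?_
      have : (VV y * tpr (fun k => s.σ (y k)) * (VV y)ᴴ) w w = ((∏ k, s.dd (y k) (w k) : ℝ) : ℂ) := by
        simp only [VV]
        rw [tpr_conjT, tpr_mul, tpr_mul, tpr_apply, Complex.ofReal_prod]
        exact Finset.prod_congr rfl fun k _ => (s.ddC _ _).1
      rw [this, Complex.ofReal_re]
      simp only [ind]; split_ifs <;> simp)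
  have hMx : Real.exp x ≤ M := Nat.le_ceil _
  have e4 : d * c ≤ u ^ 4 * M := by
    rw [hdc]
    calc Real.exp (n * (s.H - s.h2 + 2 * δ')) ≤ Real.exp (Real.log (u ^ 4) + x) := by
          apply Real.exp_le_exp.mpr; rw [hx]; linarith
      _ = u ^ 4 * Real.exp x := by rw [Real.exp_add, Real.exp_log hu4]
      _ ≤ _ := mul_le_mul_of_nonneg_left hMx hu4.le
  obtain ⟨J, nn, hnn, hsucc⟩ := covering hu0 (by linarith) hcov M hM0 e4
  have hfin : 1 - 85 * u ≤ ∑ j, hs (diagonal (fun w : Fin n → β × E =>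
          if (fun k => (w k).1) ∈ Gd (J j) then (1 : ℂ) else 0) *
        (tpr (fun k : Fin n => s.Vt (J j k)) * (tpr (fun _ : Fin n => s.Φ) * nn.submatrix id (fun k : Fin D => (j, k))))) := by
    refine hsucc.trans (Finset.sum_le_sum fun j _ => ?_)
    have e : Q (J j) = (VV (J j))ᴴ * (diagonal (fun w : Fin n → β × E =>
          if (fun k => (w k).1) ∈ Gd (J j) then (1 : ℂ) else 0) * VV (J j)) := by
      simp only [Q, fc, conjTranspose_conjTranspose, Matrix.mul_assoc]
      congr 3; ext w; simp only [ind]; split_ifs <;> simp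
    rw [e, Matrix.mul_assoc, Matrix.mul_assoc]
    apply hs_mul_left_le
    rw [conjTranspose_conjTranspose, VV2, sub_self]
    exact PosSemidef.zero
  have hpos : 1 / 2 ≤ 1 - 85 * u := by linarith
  have hD0 : 0 < D := by
    rcases Nat.eq_zero_or_pos D with h0 | h0
    · exfalso
      have : IsEmpty (Fin D) := by rw [h0]; infer_instance
      have : ∀ X : Matrix (Fin n → β × E) (Fin D) ℂ, hs X = 0 := by intro X; simp [hs]
      rw [Finset.sum_eq_zero fun j _ => this _] at hfin
      linarith
    · exact h0
  have hcard : ∀ y, (Gd y).card ≤ K := fun y => Nat.le_floor (hG1 y)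
  have hK0 : 0 < K := by
    rcases Nat.eq_zero_or_pos K with h0 | h0
    · exfalso
      have hem : ∀ y, Gd y = ∅ := fun y => Finset.card_eq_zero.mp (by have := hcard y; omega)
      simp only [hem] at hfin
      simp [hs] at hfin
      linarith
    · exact h0
  have hxl : 1 / 2 ≤ Real.exp x := by
    have h1 := hcov.dc
    rw [mul_comm c d, hdc] at h1
    have h2 : Real.exp (n * (s.H - s.h2 + 2 * δ')) ≤ Real.exp x := by
      apply Real.exp_le_exp.mpr; rw [hx]; linarith
    linarith
  have hlogM : Real.log M ≤ n * (s.H - s.h2 + 4 * δ') := by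
    have h1 : (M : ℝ) ≤ Real.exp (2 + x) := by
      have h2 : (M : ℝ) < Real.exp x + 1 := Nat.ceil_lt_add_one (Real.exp_pos _).le
      have h3 : (3 : ℝ) ≤ Real.exp 2 := by have := Real.add_one_le_exp (2:ℝ); linarith
      rw [Real.exp_add]
      nlinarith [mul_le_mul_of_nonneg_right h3 (Real.exp_pos x).le]
    have h4 := Real.log_le_log (by exact_mod_cast hM0) h1
    rw [Real.log_exp] at h4
    rw [hx] at h4; linarith
  have hlogD : Real.log D ≤ n * (s.h2 + δ') := by
    have := Real.log_le_log (by exact_mod_cast hD0) (Nat.floor_le (Real.exp_pos (n * (s.h2 + δ'))).le)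
    rwa [Real.log_exp] at this
  have hlogK : Real.log K ≤ n * (s.h3 + δ') := by
    have := Real.log_le_log (by exact_mod_cast hK0) (Nat.floor_le (Real.exp_pos (n * (s.h3 + δ'))).le)
    rwa [Real.log_exp] at this
  have hnδ : 0 < n * δ' := by linarith
  have hδ5 : δ = 5 * δ' := by rw [hδ']; ring
  refine ⟨M, D, K, hM0, hD0, hK0, ?_, ?_, ?_, J, Gd, nn, hcard, hnn, ?_⟩
  · rw [hδ5]; linarith
  · rw [hδ5]; linarith
  · rw [hδ5]; linarith
  · linarith

end SD


/-! ### One-shot codes -/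

def CodeVal {A B X : Type*} [Fintype A] [Fintype B] [Fintype X] (ρ : Matrix (A × B) (A × B) ℂ)
    {M : ℕ} (N : Matrix (Fin M × X) A ℂ) (V : Fin M → Matrix B B ℂ) (G : Fin M → Finset B) : ℝ :=
  ∑ j, ∑ x, ∑ i ∈ G j, (((N ⊗ₖ V j) * ρ * (N ⊗ₖ V j)ᴴ) ((j, x), i) ((j, x), i)).re

def Code {A B : Type*} [Fintype A] [DecidableEq A] [Fintype B] [DecidableEq B]
    (ρ : Matrix (A × B) (A × B) ℂ) (M : ℕ) (X : Type*) [Fintype X] (K : ℕ) (ε : ℝ) : Prop :=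
  ∃ (N : Matrix (Fin M × X) A ℂ) (V : Fin M → Matrix B B ℂ) (G : Fin M → Finset B),
    (1 - Nᴴ * N).PosSemidef ∧ (∀ j, (V j)ᴴ * V j = 1 ∧ V j * (V j)ᴴ = 1) ∧
    (∀ j, (G j).card ≤ K) ∧ 1 - ε ≤ CodeVal ρ N V G

theorem Code.extend {A B A1 A2 B1 B2 X : Type*} [Fintype A] [DecidableEq A] [Fintype B] [DecidableEq B]
    [Fintype A1] [DecidableEq A1] [Fintype B1] [DecidableEq B1]
    [Fintype A2] [DecidableEq A2] [Fintype B2] [DecidableEq B2] [Fintype X]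
    (eA : A ≃ A1 × A2) (eB : B ≃ B1 × B2) {ρ : Matrix (A × B) (A × B) ℂ}
    {ρ1 : Matrix (A1 × B1) (A1 × B1) ℂ} {ρ2 : Matrix (A2 × B2) (A2 × B2) ℂ}
    (hρ : ∀ a b a' b', ρ (a, b) (a', b') = ρ1 ((eA a).1, (eB b).1) ((eA a').1, (eB b').1) *
      ρ2 ((eA a).2, (eB b).2) ((eA a').2, (eB b').2)) (h2 : ρ2.trace = 1) {M K : ℕ} {ε : ℝ}
    (hc : Code ρ1 M X K ε) : Code ρ M (X × A2) (K * Fintype.card B2) ε := by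
  obtain ⟨N, V, G, hN, hV, hG, hs⟩ := hc
  let gN : Fin M × (X × A2) ≃ (Fin M × X) × A2 := (Equiv.prodAssoc _ _ _).symm
  let e : A × B ≃ (A1 × B1) × (A2 × B2) := (eA.prodCongr eB).trans (Equiv.prodProdProdComm _ _ _ _)
  let f : (Fin M × (X × A2)) × B ≃ ((Fin M × X) × B1) × (A2 × B2) :=
    (gN.prodCongr eB).trans (Equiv.prodProdProdComm _ _ _ _)
  let N' : Matrix (Fin M × (X × A2)) A ℂ := (N ⊗ₖ (1 : Matrix A2 A2 ℂ)).submatrix gN eA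
  let V' : Fin M → Matrix B B ℂ := fun j => (V j ⊗ₖ (1 : Matrix B2 B2 ℂ)).submatrix eB eB
  have hρ' : ρ = (ρ1 ⊗ₖ ρ2).submatrix e e := by
    ext ⟨a, b⟩ ⟨a', b'⟩
    rw [hρ]; rfl
  have hNV : ∀ j, N' ⊗ₖ V' j = ((N ⊗ₖ V j) ⊗ₖ (1 : Matrix (A2 × B2) (A2 × B2) ℂ)).submatrix f e := by
    intro j
    rw [← one_kronecker_one]
    ext ⟨x, b⟩ ⟨a', b'⟩
    simp only [N', V', kroneckerMap_apply, submatrix_apply, f, e, Equiv.trans_apply,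
      Equiv.prodCongr_apply, Prod.map, Equiv.prodProdProdComm_apply]
    ring
  have hval : ∀ j, (N' ⊗ₖ V' j) * ρ * (N' ⊗ₖ V' j)ᴴ =
      (((N ⊗ₖ V j) * ρ1 * (N ⊗ₖ V j)ᴴ) ⊗ₖ ρ2).submatrix f f := by
    intro j
    rw [hNV, hρ', conjTranspose_submatrix, submatrix_mul_equiv, submatrix_mul_equiv,
      conjTranspose_kronecker (N ⊗ₖ V j), conjTranspose_one, ← mul_kronecker_mul, ← mul_kronecker_mul,
      Matrix.one_mul, Matrix.mul_one]
  refine ⟨N', V', fun j => Finset.univ.filter fun b => (eB b).1 ∈ G j, ?_, ?_, ?_, ?_⟩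
  · have : 1 - N'ᴴ * N' = ((1 - Nᴴ * N) ⊗ₖ (1 : Matrix A2 A2 ℂ)).submatrix eA eA := by
      have h1 : N'ᴴ * N' = ((Nᴴ * N) ⊗ₖ (1 : Matrix A2 A2 ℂ)).submatrix eA eA := by
        simp only [N']
        rw [conjTranspose_submatrix, submatrix_mul_equiv, conjTranspose_kronecker, conjTranspose_one,
          ← mul_kronecker_mul, Matrix.one_mul]
      have h2 : (1 : Matrix A A ℂ) = ((1 : Matrix A1 A1 ℂ) ⊗ₖ (1 : Matrix A2 A2 ℂ)).submatrix eA eA := by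
        rw [one_kronecker_one, submatrix_one_equiv]
      rw [h1, h2]; ext a a'; simp only [Matrix.sub_apply, submatrix_apply, kroneckerMap_apply, sub_mul]
    rw [this]
    exact (hN.kronecker PosSemidef.one).submatrix eA
  · intro j
    simp only [V', conjTranspose_submatrix, submatrix_mul_equiv, conjTranspose_kronecker,
      conjTranspose_one, ← mul_kronecker_mul, (hV j).1, (hV j).2, Matrix.one_mul, one_kronecker_one,
      submatrix_one_equiv, and_self]
  · intro j
    calc (Finset.univ.filter fun b => (eB b).1 ∈ G j).card ≤ (G j ×ˢ (Finset.univ : Finset B2)).card := by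
          apply Finset.card_le_card_of_injOn eB
          · intro b hb
            simpa using hb
          · exact eB.injective.injOn
      _ = (G j).card * Fintype.card B2 := by rw [Finset.card_product, Finset.card_univ]
      _ ≤ _ := Nat.mul_le_mul_right _ (hG j)
  · refine hs.trans (le_of_eq ?_)
    unfold CodeVal
    refine Finset.sum_congr rfl fun j _ => ?_
    rw [Fintype.sum_prod_type]
    refine Finset.sum_congr rfl fun x _ => ?_
    simp only [hval, submatrix_apply]
    have key : ∀ a2 : A2, ∑ i ∈ Finset.univ.filter (fun b => (eB b).1 ∈ G j),
        (((((N ⊗ₖ V j) * ρ1 * (N ⊗ₖ V j)ᴴ) ⊗ₖ ρ2) (f ((j, (x, a2)), i)) (f ((j, (x, a2)), i)))).re =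
        ∑ i ∈ G j, ∑ b2, (((N ⊗ₖ V j) * ρ1 * (N ⊗ₖ V j)ᴴ) ((j, x), i) ((j, x), i) *
          ρ2 (a2, b2) (a2, b2)).re := by
      intro a2
      rw [← Finset.sum_product']
      refine Finset.sum_equiv eB ?_ ?_
      · intro b; simp
      · intro b _
        rfl
    rw [Finset.sum_congr rfl fun a2 _ => key a2, Finset.sum_comm]
    refine Finset.sum_congr rfl fun i _ => ?_
    simp only [← Complex.re_sum, ← Finset.mul_sum]
    have : ∑ a2, ∑ b2, ρ2 (a2, b2) (a2, b2) = 1 := by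
      rw [← h2, Matrix.trace, Fintype.sum_prod_type]; rfl
    rw [this, mul_one]

theorem tpowAB_apply {α β : Type*} (ρ : Matrix (α × β) (α × β) ℂ) (n : ℕ) (a b a' b') :
    tpowAB ρ n (a, b) (a', b') = ∏ k, ρ (a k, b k) (a' k, b' k) := rfl

section
variable {α β E Y : Type*} [Fintype α] [DecidableEq α] [Fintype β] [DecidableEq β]
    [Fintype E] [DecidableEq E] [Fintype Y] [DecidableEq Y]

theorem SD.code (s : SD α β E Y) {ρ : Matrix (α × β) (α × β) ℂ}
    (hρ : ∀ a b a' b', ρ (a, b) (a', b') = ∑ e, s.Φ (b, e) a * star (s.Φ (b', e) a'))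
    {ε δ : ℝ} (hε : 0 < ε) (hδ : 0 < δ) : ∃ N : ℕ, ∀ n ≥ N, ∃ M D K : ℕ,
    0 < M ∧ 0 < D ∧ 0 < K ∧ Real.log M ≤ n * (s.H - s.h2 + δ) ∧
    Real.log M + Real.log D ≤ n * (s.H + δ) ∧ Real.log K ≤ n * (s.h3 + δ) ∧
    Code (tpowAB ρ n) M (Fin D) K ε := by
  obtain ⟨N0, hN0⟩ := s.iid hε hδ
  refine ⟨N0, fun n hn => ?_⟩
  obtain ⟨M, D, K, h1, h2, h3, h4, h5, h6, J, Gd, nn, h7, h8, h9⟩ := hN0 n hn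
  refine ⟨M, D, K, h1, h2, h3, h4, h5, h6, nnᵀ, fun j => tpr (fun k => s.V (J j k)), fun j => Gd (J j),
    ?_, ?_, fun j => h7 _, ?_⟩
  · have : 1 - nnᵀᴴ * nnᵀ = (1 - nn * nnᴴ)ᵀ := by
      rw [transpose_sub, transpose_mul, transpose_one]; rfl
    rw [this]; exact h8.transpose
  · intro j
    simp only [tpr_conjT, tpr_mul, s.hV, s.hV', tpr_one, and_self]
  · refine h9.trans (le_of_eq ?_)
    unfold CodeVal
    refine Finset.sum_congr rfl fun j _ => ?_
    let Ψ : Matrix ((Fin n → α) × (Fin n → β)) (Fin n → E) ℂ :=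
      Matrix.of fun ab e => ∏ k, s.Φ (ab.2 k, e k) (ab.1 k)
    have hΨ : tpowAB ρ n = Ψ * Ψᴴ := by
      ext ⟨a, b⟩ ⟨a', b'⟩
      rw [tpowAB_apply, Matrix.mul_apply]
      simp only [hρ, conjTranspose_apply, Ψ, Matrix.of_apply, star_prod, ← Finset.prod_mul_distrib]
      rw [sum_prod_powC (fun k e => s.Φ (b k, e) (a k) * star (s.Φ (b' k, e) (a' k)))]
    set V := tpr (fun k => s.V (J j k)) with hV
    have hent : ∀ x i, (((nnᵀ ⊗ₖ V) * tpowAB ρ n * (nnᵀ ⊗ₖ V)ᴴ) ((j, x), i) ((j, x), i)).re =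
        ∑ e, ‖((nnᵀ ⊗ₖ V) * Ψ) ((j, x), i) e‖ ^ 2 := by
      intro x i
      have : (nnᵀ ⊗ₖ V) * tpowAB ρ n * (nnᵀ ⊗ₖ V)ᴴ = ((nnᵀ ⊗ₖ V) * Ψ) * ((nnᵀ ⊗ₖ V) * Ψ)ᴴ := by
        rw [hΨ, conjTranspose_mul]; simp only [Matrix.mul_assoc]
      rw [this, Matrix.mul_apply, Complex.re_sum]
      refine Finset.sum_congr rfl fun e _ => ?_
      rw [conjTranspose_apply, RCLike.star_def, Complex.mul_conj, Complex.normSq_eq_norm_sq, Complex.ofReal_re]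
    -- left side
    have hL : ∀ (i : Fin n → β) (e : Fin n → E) (x : Fin D),
        (tpr (fun k : Fin n => s.Vt (J j k)) * (tpr (fun _ : Fin n => s.Φ) *
          nn.submatrix id (fun k : Fin D => (j, k)))) (fun k => (i k, e k)) x =
        ((nnᵀ ⊗ₖ V) * Ψ) ((j, x), i) e := by
      intro i e x
      rw [← Matrix.mul_assoc, tpr_mul, Matrix.mul_apply, Matrix.mul_apply, Fintype.sum_prod_type]
      refine Finset.sum_congr rfl fun a _ => ?_
      have e1 : ∀ k, (s.Vt (J j k) * s.Φ) (i k, e k) (a k) = ∑ b, s.V (J j k) (i k) b * s.Φ (b, e k) (a k) := by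
        intro k
        rw [Matrix.mul_apply, Fintype.sum_prod_type]
        refine Finset.sum_congr rfl fun b _ => ?_
        simp only [SD.Vt, kroneckerMap_apply]
        rw [Finset.sum_eq_single (e k)]
        · simp
        · intro e' _ hne; simp [Matrix.one_apply_ne hne.symm]
        · simp
      rw [tpr_apply]
      simp only [e1]
      rw [← sum_prod_powC (fun k b => s.V (J j k) (i k) b * s.Φ (b, e k) (a k)), Finset.sum_mul]
      refine Finset.sum_congr rfl fun b _ => ?_
      simp only [kroneckerMap_apply, transpose_apply, submatrix_apply, id, hV, tpr_apply, Ψ,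
        Matrix.of_apply, Finset.prod_mul_distrib]
      ring
    simp only [hs, diagonal_mul]
    rw [← sum_arrow (fun i e => ∑ x, ‖(if i ∈ Gd (J j) then (1:ℂ) else 0) *
      (tpr (fun k : Fin n => s.Vt (J j k)) * (tpr (fun _ : Fin n => s.Φ) *
          nn.submatrix id (fun k : Fin D => (j, k)))) (fun k => (i k, e k)) x‖ ^ 2)]
    simp only [hL]
    have : ∀ i : Fin n → β, ∑ e : Fin n → E, ∑ x, ‖(if i ∈ Gd (J j) then (1:ℂ) else 0) *
        ((nnᵀ ⊗ₖ V) * Ψ) ((j, x), i) e‖ ^ 2 = if i ∈ Gd (J j) then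
          ∑ x, ∑ e, ‖((nnᵀ ⊗ₖ V) * Ψ) ((j, x), i) e‖ ^ 2 else 0 := by
      intro i
      split_ifs
      · rw [Finset.sum_comm]; simp
      · simp
    rw [Finset.sum_congr rfl fun i _ => this i, ← Finset.sum_filter, Finset.sum_comm,
      Finset.filter_univ_mem]
    refine Finset.sum_congr rfl fun x _ => Finset.sum_congr rfl fun i _ => ?_
    exact (hent x i).symm

end


/-! ### Trace norm estimate -/

theorem traceNorm_eq {ι : Type*} [Fintype ι] [DecidableEq ι] {ω : Matrix ι ι ℂ} (h : ωᴴ = ω) :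
    ∃ W : Matrix ι ι ℂ, Wᴴ = W ∧ W * W = 1 ∧ traceNorm ω = (W * ω).trace.re := by
  obtain ⟨U, x, h1, h2, h3⟩ := exists_fc (M := ω) h
  refine ⟨fc U (fun i => if 0 ≤ x i then 1 else -1), fc_conjT _ _, ?_, ?_⟩
  · rw [fc_mul h1, ← fc_one h2]
    congr 1; ext i; split_ifs <;> norm_num
  · have e1 : ωᴴ * ω = fc U (fun i => x i * x i) := by rw [h, h3, fc_mul h1]
    have hh := (Matrix.posSemidef_conjTranspose_mul_self ω)
    have e2 : traceNorm ω = ∑ i, √(hh.1.eigenvalues i) := by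
      have e3 : hh.sqrt = fc hh.1.eigenvectorUnitary.1 (fun i => √(hh.1.eigenvalues i)) := rfl
      unfold traceNorm
      rw [e3, fc_trace, Complex.ofReal_re]
      exact (Matrix.mem_unitaryGroup_iff').1 hh.1.eigenvectorUnitary.2
    rw [e2, spectral_sum hh.1 h1 e1 Real.sqrt]
    conv_rhs => rw [h3]
    rw [fc_mul h1, fc_trace h1, Complex.ofReal_re]
    refine Finset.sum_congr rfl fun i _ => ?_
    rw [Real.sqrt_mul_self_eq_abs]
    split_ifs with h0
    · rw [abs_of_nonneg h0]; ring
    · rw [abs_of_neg (not_le.1 h0)]; ring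

theorem traceNorm_le {ι : Type*} [Fintype ι] [DecidableEq ι] {Υ : Matrix ι ι ℂ} (h : IsDensity Υ)
    (i0 : ι) : traceNorm (Υ - Matrix.single i0 i0 1) ≤ 3 * √(1 - (Υ i0 i0).re) := by
  set Q : Matrix ι ι ℂ := Matrix.single i0 i0 1 with hQ
  have hQ1 : Qᴴ = Q := by simp [hQ, conjTranspose_single]
  have hQ2 : Q * Q = Q := by simp [hQ]
  obtain ⟨W, hW1, hW2, hW3⟩ := traceNorm_eq (ω := Υ - Q) (by rw [conjTranspose_sub, hQ1, h.1.1])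
  obtain ⟨T, hT⟩ := psd_sqrt h.1
  set s := (Υ i0 i0).re with hs'
  have hsΥ : Υ i0 i0 = (s : ℂ) := by
    have := h.1.1.apply i0 i0
    apply Complex.ext
    · simp [hs']
    · have := congrArg Complex.im this
      simp at this; simp; linarith
  have t1 : hs T = 1 := by
    have := trace_mul_conjT T
    rw [← hT, h.2] at this
    exact_mod_cast this.symm
  have t2 : hs (Q * T) = s := by
    rw [hs_proj_trace hQ1 hQ2, ← hT, hQ, Matrix.trace_single_mul]; simp [hs']
  have t3 : hs ((1 - Q) * T) = 1 - s := by rw [hs_proj_compl hQ1 hQ2, t1, t2]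
  have t4 : hs Q = 1 := by
    have := trace_mul_conjT Q
    rw [hQ1, hQ2, hQ, Matrix.trace_single_eq_same] at this
    exact_mod_cast this.symm
  have hWc : ∀ X : Matrix ι ι ℂ, hs (W * X) ≤ hs X := fun X => by
    apply hs_mul_left_le; rw [hW1, hW2]; simp [Matrix.PosSemidef.zero]
  have hs0 : 0 ≤ s := t2 ▸ hs_nonneg _
  have hs1 : 0 ≤ 1 - s := t3 ▸ hs_nonneg _
  have c1 := hs_cs ((1 - Q) * T) (W * (T + Q * T))
  have c2 := hs_cs Q (W * Q)
  have b1 : hs (T + Q * T) ≤ 4 := by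
    have := hs_add_le T (Q * T) one_pos
    rw [t1, t2] at this; linarith
  have c1' : (((1 - Q) * T)ᴴ * (W * (T + Q * T))).trace.re ≤ 2 * √(1 - s) := by
    refine le_of_abs_le (abs_le_of_sq_le_sq ?_ (by positivity))
    rw [mul_pow, Real.sq_sqrt hs1]
    refine c1.trans ?_
    rw [t3]
    nlinarith [hWc (T + Q * T)]
  have c2' : |(Qᴴ * (W * Q)).trace.re| ≤ 1 := by
    rw [← sq_le_one_iff_abs_le_one]
    refine c2.trans ?_
    rw [t4, one_mul]; exact (hWc Q).trans t4.le
  have key : (W * (Υ - Q)).trace.re = (((1 - Q) * T)ᴴ * (W * (T + Q * T))).trace.re -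
      (1 - s) * (Qᴴ * (W * Q)).trace.re := by
    have k1 : (((1 - Q) * T)ᴴ * (W * (T + Q * T))).trace = (W * (T * Tᴴ)).trace -
        (W * (Q * T * (Q * T)ᴴ)).trace + ((Tᴴ * W * (Q * T)).trace - ((Q * T)ᴴ * W * T).trace) := by
      rw [← Matrix.mul_assoc W, ← Matrix.mul_assoc W (Q * T), Matrix.trace_mul_comm (W * T),
        Matrix.trace_mul_comm (W * (Q * T)), ← Matrix.mul_assoc, ← Matrix.mul_assoc, ← trace_sub,
        ← trace_sub, ← trace_add]
      congr 1
      have : ((1 - Q) * T)ᴴ = Tᴴ - (Q * T)ᴴ := by rw [Matrix.sub_mul, conjTranspose_sub, Matrix.one_mul]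
      rw [this]
      noncomm_ring
    have k2 : ((Q * T)ᴴ * W * T).trace = star ((Tᴴ * W * (Q * T)).trace) := by
      rw [← trace_conjTranspose, conjTranspose_mul (Tᴴ * W), conjTranspose_mul Tᴴ, hW1,
        conjTranspose_conjTranspose, Matrix.mul_assoc]
    have k3 : Q * T * (Q * T)ᴴ = (s : ℂ) • Q := by
      rw [conjTranspose_mul, hQ1]
      have : Q * T * (Tᴴ * Q) = Q * Υ * Q := by rw [hT]; simp only [Matrix.mul_assoc]
      rw [this, hQ, Matrix.single_mul_mul_single, hsΥ]; simp
    have k4 : (Qᴴ * (W * Q)).trace = (W * Q).trace := by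
      rw [hQ1, Matrix.trace_mul_comm, Matrix.mul_assoc, hQ2]
    rw [k1, k2, k3, k4, ← hT, Matrix.mul_sub, trace_sub, Matrix.mul_smul, trace_smul]
    simp
    ring
  rw [hW3, key]
  have b2 : 1 - s ≤ √(1 - s) := by
    apply Real.le_sqrt_of_sq_le; nlinarith
  have := abs_le.1 c2'
  nlinarith

/-! ### Isometry completion -/

theorem exists_unitary_ext {R A C : Type*} [Fintype R] [DecidableEq R] [Fintype A] [DecidableEq A]
    [Fintype C] [DecidableEq C] (c0 : C) (hc : Fintype.card R = Fintype.card (A × C))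
    {J : Matrix R A ℂ} (hJ : Jᴴ * J = 1) : ∃ U : Matrix R (A × C) ℂ, Uᴴ * U = 1 ∧ U * Uᴴ = 1 ∧
      ∀ r a, U r (a, c0) = J r a := by
  let v : A × C → EuclideanSpace ℂ R := fun p => WithLp.toLp 2 (fun r => J r p.1)
  let s : Set (A × C) := {p | p.2 = c0}
  have hin : ∀ a a', inner ℂ (WithLp.toLp 2 (fun r => J r a) : EuclideanSpace ℂ R)
      (WithLp.toLp 2 (fun r => J r a')) = (1 : Matrix A A ℂ) a a' := by
    intro a a'
    rw [← hJ, Matrix.mul_apply, PiLp.inner_apply]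
    refine Finset.sum_congr rfl fun r _ => ?_
    simp [mul_comm]
  have hv : Orthonormal ℂ (s.domRestrict v) := by
    rw [orthonormal_iff_ite]
    rintro ⟨⟨a, c⟩, h⟩ ⟨⟨a', c'⟩, h'⟩
    have e : inner ℂ (s.domRestrict v ⟨⟨a, c⟩, h⟩) (s.domRestrict v ⟨⟨a', c'⟩, h'⟩) = _ := hin a a'
    rw [e]
    simp only [s, Set.mem_setOf_eq] at h h'
    subst h h'
    simp [Matrix.one_apply]
  obtain ⟨b, hb⟩ := hv.exists_orthonormalBasis_extension_of_card_eq (by simp [hc])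
  let U : Matrix R (A × C) ℂ := Matrix.of fun r p => b p r
  have hU : Uᴴ * U = 1 := by
    ext p q
    have := orthonormal_iff_ite.1 b.orthonormal p q
    rw [Matrix.one_apply, ← this, Matrix.mul_apply, PiLp.inner_apply]
    refine Finset.sum_congr rfl fun r _ => ?_
    simp [U, mul_comm]
  refine ⟨U, hU, (mul_eq_one_comm_of_card_eq _ _ _ (A := Uᴴ) (B := U) hc.symm).1 hU, fun r a => ?_⟩
  have := hb (a, c0) rfl
  simp only [U, Matrix.of_apply, this, v]

theorem exists_UA {A : Type*} [Fintype A] [DecidableEq A] [Nonempty A] {M D : ℕ} (hM : 0 < M) (hD : 0 < D)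
    {N : Matrix (Fin M × Fin D) A ℂ} (hN : (1 - Nᴴ * N).PosSemidef) (h0 : 0 < 2 * Fintype.card A)
    (hc0 : 0 < 2 * M * D) :
    ∃ U : Matrix ((Fin (2 * Fintype.card A) × Fin M) × Fin D) (A × Fin (2 * M * D)) ℂ,
      Uᴴ * U = 1 ∧ U * Uᴴ = 1 ∧ ∀ y g a, U ((⟨0, h0⟩, y), g) (a, ⟨0, hc0⟩) = N (y, g) a := by
  obtain ⟨X, hX⟩ := psd_sqrt hN
  have hA : 0 < Fintype.card A := Fintype.card_pos
  let φ : (Fin M × Fin D) ⊕ A → (Fin (2 * Fintype.card A) × Fin M) × Fin D := Sum.elim (fun yg => ((⟨0, h0⟩, yg.1), yg.2))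
    (fun a => ((⟨Fintype.card A + (Fintype.equivFin A a).val, by
      have := (Fintype.equivFin A a).2; omega⟩, ⟨0, hM⟩), ⟨0, hD⟩))
  have hφ : Function.Injective φ := by
    rintro (⟨y, g⟩ | a) (⟨y', g'⟩ | a') h
    · simp only [φ, Sum.elim_inl, Prod.mk.injEq] at h; simp [h]
    · simp only [φ, Sum.elim_inl, Sum.elim_inr, Prod.mk.injEq, Fin.mk.injEq] at h; omega
    · simp only [φ, Sum.elim_inl, Sum.elim_inr, Prod.mk.injEq, Fin.mk.injEq] at h; omega
    · simp only [φ, Sum.elim_inr, Prod.mk.injEq, Fin.mk.injEq] at h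
      have h' : (Fintype.equivFin A a).val = (Fintype.equivFin A a').val := by omega
      rw [Fin.val_inj] at h'
      simpa using h'
  let F : Matrix ((Fin M × Fin D) ⊕ A) A ℂ := Matrix.fromRows N Xᴴ
  let Pm : Matrix ((Fin (2 * Fintype.card A) × Fin M) × Fin D) ((Fin M × Fin D) ⊕ A) ℂ :=
    (1 : Matrix ((Fin (2 * Fintype.card A) × Fin M) × Fin D) ((Fin (2 * Fintype.card A) × Fin M) × Fin D) ℂ).submatrix id φ
  have hP : Pmᴴ * Pm = 1 := by
    ext p q
    rw [Matrix.mul_apply, Finset.sum_eq_single (φ p)]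
    · simp [Pm, Matrix.one_apply, hφ.eq_iff]
    · intro r _ hr
      simp [Pm, Matrix.one_apply, hr]
    · simp
  have hF : Fᴴ * F = 1 := by
    simp only [F]
    rw [Matrix.conjTranspose_fromRows_eq_fromCols_conjTranspose, Matrix.fromCols_mul_fromRows,
      conjTranspose_conjTranspose, ← hX]
    simp
  have hJ : (Pm * F)ᴴ * (Pm * F) = 1 := by
    rw [conjTranspose_mul, Matrix.mul_assoc, ← Matrix.mul_assoc Pmᴴ, hP, Matrix.one_mul, hF]
  obtain ⟨U, hU1, hU2, hU3⟩ := exists_unitary_ext (C := Fin (2 * M * D)) ⟨0, hc0⟩ (by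
    simp; ring) hJ
  refine ⟨U, hU1, hU2, fun y g a => ?_⟩
  rw [hU3, Matrix.mul_apply, Finset.sum_eq_single (Sum.inl (y, g))]
  · have : Pm ((⟨0, h0⟩, y), g) (Sum.inl (y, g)) = 1 := Matrix.one_apply_eq _
    rw [this, one_mul]; rfl
  · intro t _ ht
    have : ((⟨0, h0⟩, y), g) ≠ φ t := fun h => ht (hφ h.symm)
    have h2 : Pm ((⟨0, h0⟩, y), g) t = 0 := Matrix.one_apply_ne this
    rw [h2, zero_mul]
  · simp

theorem exists_pos {B : Type*} [Fintype B] [DecidableEq B] {P L : ℕ} (hP : 0 < P)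
    (hB : Fintype.card B = P * L) (G : Finset B) (hG : G.card ≤ L) :
    ∃ e : B ≃ Fin P × Fin L, ∀ i ∈ G, (e i).1 = ⟨0, hP⟩ := by
  obtain ⟨G', hG', hc⟩ := Finset.exists_superset_card_eq hG (by
    rw [hB]; exact Nat.le_mul_of_pos_left _ hP)
  let e0 : B ≃ Fin P × Fin L := Fintype.equivOfCardEq (by simp [hB])
  have hcard : Fintype.card {x // x ∈ G'} = Fintype.card {x // (e0 x).1 = ⟨0, hP⟩} := by
    rw [Fintype.card_coe, hc]
    have : {x // (e0 x).1 = ⟨0, hP⟩} ≃ Fin L :=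
      { toFun := fun x => (e0 x.1).2
        invFun := fun l => ⟨e0.symm (⟨0, hP⟩, l), by simp⟩
        left_inv := by
          rintro ⟨x, hx⟩
          apply Subtype.ext
          simp only [← hx, Prod.mk.eta, Equiv.symm_apply_apply]
        right_inv := by intro l; simp }
    rw [Fintype.card_congr this, Fintype.card_fin]
  let e1 := Fintype.equivOfCardEq hcard
  refine ⟨e1.extendSubtype.trans e0, fun i hi => ?_⟩
  exact e1.extendSubtype_mem i (hG' hi)


/-! ### From codes to protocols -/

theorem tpow_eq_tpr {ι : Type*} (ρ : Matrix ι ι ℂ) (n : ℕ) : tpow ρ n = tpr (fun _ : Fin n => ρ) := rfl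

theorem density_reindex {ι κ : Type*} [Fintype ι] [Fintype κ] {X : Matrix ι ι ℂ} (h : IsDensity X) (e : ι ≃ κ) :
    IsDensity (Matrix.reindex e e X) := by
  refine ⟨h.1.submatrix _, ?_⟩
  rw [← h.2]
  exact Fintype.sum_equiv e.symm _ _ fun i => rfl

theorem density_tpow {ι : Type*} [Fintype ι] [DecidableEq ι] {X : Matrix ι ι ℂ} (h : IsDensity X) (n : ℕ) :
    IsDensity (tpow X n) := by
  obtain ⟨T, hT⟩ := psd_sqrt h.1
  rw [tpow_eq_tpr]
  constructor
  · rw [hT, ← tpr_mul, ← tpr_conjT]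
    exact posSemidef_self_mul_conjTranspose _
  · rw [tpr_trace]; simp [h.2]

theorem density_tpowAB {α β : Type*} [Fintype α] [DecidableEq α] [Fintype β] [DecidableEq β]
    {ρ : Matrix (α × β) (α × β) ℂ} (h : IsDensity ρ) (n : ℕ) : IsDensity (tpowAB ρ n) :=
  density_reindex (density_tpow h n) _

theorem density_conj {ι κ : Type*} [Fintype ι] [Fintype κ] [DecidableEq ι] {X : Matrix ι ι ℂ}
    (h : IsDensity X) {U : Matrix κ ι ℂ} (hU : Uᴴ * U = 1) : IsDensity (U * X * Uᴴ) := by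
  refine ⟨h.1.mul_mul_conjTranspose_same U, ?_⟩
  rw [Matrix.trace_mul_comm, ← Matrix.mul_assoc, hU, Matrix.one_mul, h.2]

theorem density_ptraceRight {ι κ : Type*} [Fintype ι] [Fintype κ] {X : Matrix (ι × κ) (ι × κ) ℂ}
    (h : IsDensity X) : IsDensity (ptraceRight X) := by
  constructor
  · have : ptraceRight X = ∑ b, X.submatrix (fun a => (a, b)) (fun a => (a, b)) := by
      ext a a'; rw [Matrix.sum_apply]; rfl
    rw [this]
    exact Matrix.posSemidef_sum _ fun b _ => h.1.submatrix _
  · rw [← h.2, Matrix.trace, Matrix.trace, Fintype.sum_prod_type]; rfl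

theorem density_ptraceLeft {ι κ : Type*} [Fintype ι] [Fintype κ] {X : Matrix (ι × κ) (ι × κ) ℂ}
    (h : IsDensity X) : IsDensity (ptraceLeft X) := by
  constructor
  · have : ptraceLeft X = ∑ b, X.submatrix (fun a => (b, a)) (fun a => (b, a)) := by
      ext a a'; rw [Matrix.sum_apply]; rfl
    rw [this]
    exact Matrix.posSemidef_sum _ fun b _ => h.1.submatrix _
  · rw [← h.2, Matrix.trace, Matrix.trace, Fintype.sum_prod_type_right]; rfl

theorem density_dephase {ι κ : Type*} [Fintype ι] [Fintype κ] [DecidableEq ι] [DecidableEq κ]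
    {X : Matrix (ι × κ) (ι × κ) ℂ} (h : IsDensity X) : IsDensity (dephaseFst X) := by
  constructor
  · have : dephaseFst X = ∑ y, diagonal (fun p : ι × κ => if p.1 = y then (1:ℂ) else 0) * X *
        (diagonal (fun p : ι × κ => if p.1 = y then (1:ℂ) else 0))ᴴ := by
      ext p q
      rw [Matrix.sum_apply]
      simp only [diagonal_conjTranspose, Matrix.mul_diagonal, Matrix.diagonal_mul]
      rw [Finset.sum_eq_single p.1]
      · simp only [dephaseFst, Pi.star_apply]
        by_cases hpq : p.1 = q.1
        · simp [hpq]
        · simp [hpq, Ne.symm hpq]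
      · intro y _ hy
        simp [hy.symm]
      · simp
    rw [this]
    exact Matrix.posSemidef_sum _ fun b _ => h.1.mul_mul_conjTranspose_same _
  · rw [← h.2]
    refine Finset.sum_congr rfl fun i _ => ?_
    simp [dephaseFst]

theorem density_pureZero {d : ℕ} (hd : 0 < d) : IsDensity (pureZero d) := by
  have : pureZero d = Matrix.single ⟨0, hd⟩ ⟨0, hd⟩ 1 := by
    ext i j
    simp [pureZero, Matrix.single_apply, Fin.ext_iff, eq_comm]
  rw [this]
  constructor
  · apply psd_proj <;> simp [conjTranspose_single]
  · simp [Matrix.trace_single_eq_same]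

theorem density_kron {ι κ : Type*} [Fintype ι] [Fintype κ] [DecidableEq ι] [DecidableEq κ]
    {X : Matrix ι ι ℂ} {Y : Matrix κ κ ℂ} (h : IsDensity X) (h' : IsDensity Y) : IsDensity (X ⊗ₖ Y) :=
  ⟨h.1.kronecker h'.1, by rw [trace_kronecker, h.2, h'.2, one_mul]⟩

theorem kron_one_iso {ι κ μ : Type*} [Fintype ι] [Fintype κ] [Fintype μ] [DecidableEq ι] [DecidableEq κ]
    [DecidableEq μ] {U : Matrix κ ι ℂ} (hU : Uᴴ * U = 1) :
    (U ⊗ₖ (1 : Matrix μ μ ℂ))ᴴ * (U ⊗ₖ (1 : Matrix μ μ ℂ)) = 1 := by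
  rw [conjTranspose_kronecker, ← mul_kronecker_mul, hU, conjTranspose_one, Matrix.one_mul, one_kronecker_one]

theorem kron_conj_entry {ι κ μ : Type*} [Fintype ι] [Fintype κ] [Fintype μ] [DecidableEq ι] [DecidableEq κ]
    [DecidableEq μ] (U : Matrix κ ι ℂ) (S : Matrix (ι × μ) (ι × μ) ℂ) (r r' : κ) (x x' : μ) :
    ((U ⊗ₖ (1 : Matrix μ μ ℂ)) * S * (U ⊗ₖ (1 : Matrix μ μ ℂ))ᴴ) (r, x) (r', x') =
      ∑ s, ∑ s', U r s * S (s, x) (s', x') * star (U r' s') := by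
  rw [Matrix.mul_apply, Fintype.sum_prod_type, Finset.sum_comm]
  rw [Finset.sum_eq_single x']
  · rw [Finset.sum_comm]
    refine Finset.sum_congr rfl fun s' _ => ?_
    rw [Matrix.mul_apply, Fintype.sum_prod_type, Finset.sum_mul]
    refine Finset.sum_congr rfl fun s _ => ?_
    rw [Finset.sum_eq_single x]
    · simp
    · intro z _ hz; simp [Matrix.one_apply_ne hz.symm]
    · simp
  · intro z _ hz
    refine Finset.sum_eq_zero fun s _ => ?_
    simp [Matrix.one_apply_ne hz.symm]
  · simp

section
variable {α β : Type*} [Fintype α] [DecidableEq α] [Fintype β] [DecidableEq β]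

theorem density_output {ρ : Matrix (α × β) (α × β) ℂ} (h : IsDensity ρ) {n : ℕ} (Pr : Protocol α β n) :
    IsDensity (outputReduced ρ Pr) := by
  apply density_ptraceRight
  apply density_reindex
  apply density_conj _ (kron_one_iso Pr.UB_unitary.1)
  apply density_reindex
  apply density_reindex
  apply density_dephase
  apply density_reindex
  apply density_conj _ (kron_one_iso Pr.UA_unitary.1)
  apply density_reindex
  exact density_kron (density_tpowAB h n) (density_pureZero Pr.dC_pos)

theorem protocolError_le {ρ : Matrix (α × β) (α × β) ℂ} (h : IsDensity ρ) {n : ℕ} (Pr : Protocol α β n) {t : ℝ}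
    (ht : t ≤ (outputReduced ρ Pr (⟨0, Pr.dAp_pos⟩, ⟨0, Pr.dBp_pos⟩) (⟨0, Pr.dAp_pos⟩, ⟨0, Pr.dBp_pos⟩)).re) :
    protocolError ρ Pr ≤ 3 * √(1 - t) := by
  have : pureZero Pr.dAp ⊗ₖ pureZero Pr.dBp =
      Matrix.single (⟨0, Pr.dAp_pos⟩, ⟨0, Pr.dBp_pos⟩) (⟨0, Pr.dAp_pos⟩, ⟨0, Pr.dBp_pos⟩) 1 := by
    ext ⟨i, i'⟩ ⟨j, j'⟩
    simp only [kroneckerMap_apply, pureZero, Matrix.single_apply, Prod.mk.injEq, Fin.ext_iff]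
    by_cases h1 : i.val = 0 <;> by_cases h2 : i'.val = 0 <;> by_cases h3 : j.val = 0 <;>
      by_cases h4 : j'.val = 0 <;> simp [h1, h2, h3, h4, eq_comm]
  unfold protocolError
  rw [this]
  refine (traceNorm_le (density_output h Pr) _).trans ?_
  gcongr

theorem stateAfterUA_entry (ρ : Matrix (α × β) (α × β) ℂ) {n : ℕ} (Pr : Protocol α β n) (r r' b b') :
    stateAfterUA ρ Pr (r, b) (r', b') = ∑ a, ∑ a', Pr.UA r (a, ⟨0, Pr.dC_pos⟩) *
      tpowAB ρ n (a, b) (a', b') * star (Pr.UA r' (a', ⟨0, Pr.dC_pos⟩)) := by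
  unfold stateAfterUA
  rw [kron_conj_entry, Fintype.sum_prod_type]
  refine Finset.sum_congr rfl fun a _ => ?_
  have e : ∀ c a' c', inputState ρ Pr ((a, c), b) ((a', c'), b') =
      tpowAB ρ n (a, b) (a', b') * pureZero Pr.dC c c' := fun c a' c' => rfl
  rw [Finset.sum_eq_single ⟨0, Pr.dC_pos⟩]
  · rw [Fintype.sum_prod_type]
    refine Finset.sum_congr rfl fun a' _ => ?_
    rw [Finset.sum_eq_single ⟨0, Pr.dC_pos⟩]
    · rw [e]; simp [pureZero]
    · intro c _ hc
      have : c.val ≠ 0 := fun h => hc (Fin.ext h)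
      rw [e]; simp [pureZero, this]
    · simp
  · intro c _ hc
    have : c.val ≠ 0 := fun h => hc (Fin.ext h)
    refine Finset.sum_eq_zero fun p _ => ?_
    obtain ⟨a', c'⟩ := p
    rw [e]; simp [pureZero, this]
  · simp

theorem kron_entry' {A B R : Type*} [Fintype A] [Fintype B] (N : Matrix R A ℂ) (V : Matrix B B ℂ)
    (ρ : Matrix (A × B) (A × B) ℂ) (r i) : ((N ⊗ₖ V) * ρ * (N ⊗ₖ V)ᴴ) (r, i) (r, i) =
      ∑ b, ∑ b', V i b * (∑ a, ∑ a', N r a * ρ (a, b) (a', b') * star (N r a')) * star (V i b') := by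
  simp only [Matrix.mul_apply, Fintype.sum_prod_type, kroneckerMap_apply, conjTranspose_apply]
  simp only [Finset.mul_sum, Finset.sum_mul]
  have swap3 : ∀ f : A → A → B → ℂ, ∑ a', ∑ a, ∑ b, f a' a b = ∑ b, ∑ a, ∑ a', f a' a b := by
    intro f
    calc ∑ a', ∑ a, ∑ b, f a' a b = ∑ a', ∑ b, ∑ a, f a' a b :=
          Finset.sum_congr rfl fun a' _ => Finset.sum_comm
      _ = ∑ b, ∑ a', ∑ a, f a' a b := Finset.sum_comm
      _ = _ := Finset.sum_congr rfl fun b _ => Finset.sum_comm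
  rw [Finset.sum_comm]
  conv_rhs => rw [Finset.sum_comm]
  refine Finset.sum_congr rfl fun b' _ => ?_
  rw [swap3]
  refine Finset.sum_congr rfl fun b _ => Finset.sum_congr rfl fun a _ => Finset.sum_congr rfl fun a' _ => ?_
  rw [star_mul']
  ring

theorem stateAfterDephasing_entry (ρ : Matrix (α × β) (α × β) ℂ) {n : ℕ} (Pr : Protocol α β n) (ap y g b ap' y' g' b') :
    stateAfterDephasing ρ Pr (((ap, y), g), b) (((ap', y'), g'), b') =
      if y = y' then stateAfterUA ρ Pr (((ap, y), g), b) (((ap', y'), g'), b') else 0 := rfl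

/-- Bob's controlled unitary. -/
def mkUB {B : Type*} [Fintype B] [DecidableEq B] {P L M : ℕ} (V : Fin M → Matrix B B ℂ) (e : Fin M → B ≃ Fin P × Fin L) :
    Matrix (Fin P × Fin (L * M)) (B × Fin M) ℂ :=
  Matrix.of fun p q => if (finProdFinEquiv.symm p.2).2 = q.2 then
    V q.2 ((e q.2).symm (p.1, (finProdFinEquiv.symm p.2).1)) q.1 else 0

theorem mkUB_unitary {B : Type*} [Fintype B] [DecidableEq B] {P L M : ℕ} {V : Fin M → Matrix B B ℂ}
    (hV : ∀ j, (V j)ᴴ * V j = 1) (e : Fin M → B ≃ Fin P × Fin L) (hB : Fintype.card B = P * L) :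
    (mkUB V e)ᴴ * mkUB V e = 1 ∧ mkUB V e * (mkUB V e)ᴴ = 1 := by
  have h1 : (mkUB V e)ᴴ * mkUB V e = 1 := by
    ext ⟨b, y⟩ ⟨b', y'⟩
    rw [Matrix.mul_apply, Fintype.sum_prod_type]
    simp only [conjTranspose_apply, mkUB, Matrix.of_apply]
    have e1 : ∀ x : Fin P, (∑ bg : Fin (L * M),
        star (if (finProdFinEquiv.symm bg).2 = y then V y ((e y).symm (x, (finProdFinEquiv.symm bg).1)) b else 0) *
        (if (finProdFinEquiv.symm bg).2 = y' then V y' ((e y').symm (x, (finProdFinEquiv.symm bg).1)) b' else 0)) =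
        if y = y' then ∑ l, star (V y ((e y).symm (x, l)) b) * V y ((e y).symm (x, l)) b' else 0 := by
      intro x
      rw [← Equiv.sum_comp finProdFinEquiv, Fintype.sum_prod_type]
      simp only [Equiv.symm_apply_apply]
      split_ifs with hy
      · subst hy
        refine Finset.sum_congr rfl fun l _ => ?_
        rw [Finset.sum_eq_single y]
        · simp
        · intro z _ hz; simp [hz]
        · simp
      · refine Finset.sum_eq_zero fun l _ => Finset.sum_eq_zero fun z _ => ?_
        by_cases h1 : z = y
        · have : z ≠ y' := h1 ▸ hy
          simp [this]
        · simp [h1]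
    rw [Finset.sum_congr rfl fun x _ => e1 x]
    split_ifs with hy
    · subst hy
      rw [← Fintype.sum_prod_type', Equiv.sum_comp (e y).symm (fun i => star (V y i b) * V y i b')]
      have := congrFun (congrFun (hV y) b) b'
      rw [Matrix.mul_apply] at this
      simp only [conjTranspose_apply] at this
      rw [this]
      simp [Matrix.one_apply]
    · simp [Matrix.one_apply, hy]
  refine ⟨h1, (mul_eq_one_comm_of_card_eq _ _ _ (A := (mkUB V e)ᴴ) (B := mkUB V e) ?_).1 h1⟩
  simp [hB, mul_assoc]

end


section
variable {α β : Type*} [Fintype α] [DecidableEq α] [Fintype β] [DecidableEq β]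

theorem exists_pow_bound {b n K : ℕ} (hb : 0 < b) (hK : 0 < K) : ∃ k ≤ n, min K (b ^ n) ≤ b ^ k ∧
    b ^ k ≤ b * K := by
  classical
  have hex : ∃ k, min K (b ^ n) ≤ b ^ k := ⟨n, min_le_right _ _⟩
  refine ⟨Nat.find hex, Nat.find_min' hex (min_le_right _ _), Nat.find_spec hex, ?_⟩
  rcases Nat.eq_zero_or_pos (Nat.find hex) with h0 | h0
  · rw [h0, pow_zero]; exact Nat.mul_pos hb hK
  · have h1 := Nat.find_min hex (m := Nat.find hex - 1) (by omega)
    have h2 : b ^ (Nat.find hex - 1) ≤ K := (not_le.1 h1).le.trans (min_le_left _ _)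
    calc b ^ Nat.find hex = b * b ^ (Nat.find hex - 1) := by
          rw [← pow_succ']; congr 1; omega
      _ ≤ _ := Nat.mul_le_mul_left _ h2

theorem Code.protocol {ρ : Matrix (α × β) (α × β) ℂ} (hρ : IsDensity ρ) {n M D K : ℕ} {ε : ℝ}
    (hM : 0 < M) (hD : 0 < D) (hK : 0 < K) (hα : 0 < Fintype.card α) (hβ : 0 < Fintype.card β)
    (hc : Code (tpowAB ρ n) M (Fin D) K ε) : ∃ Pr : Protocol α β n,
      Pr.dY = M ∧ n * Real.log (Fintype.card α) + n * Real.log (Fintype.card β) - Real.log M - Real.log D -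
        Real.log K - Real.log (Fintype.card β) ≤ Real.log (Pr.dAp * Pr.dBp) - Real.log Pr.dC ∧
      protocolError ρ Pr ≤ 3 * √ε := by
  obtain ⟨N, V, G, hN, hV, hG, hs⟩ := hc
  haveI : Nonempty α := Fintype.card_pos_iff.1 hα
  haveI : Nonempty β := Fintype.card_pos_iff.1 hβ
  obtain ⟨k, hkn, hk1, hk2⟩ := exists_pow_bound (n := n) hβ hK
  have hA0 : 0 < 2 * Fintype.card (Fin n → α) := Nat.mul_pos two_pos Fintype.card_pos
  have hC0 : 0 < 2 * M * D := by positivity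
  obtain ⟨UA, hUA1, hUA2, hUA3⟩ := exists_UA hM hD hN hA0 hC0
  set L := Fintype.card β ^ k with hL
  set P := Fintype.card β ^ (n - k) with hP
  have hL0 : 0 < L := by positivity
  have hP0 : 0 < P := by positivity
  have hcard : Fintype.card (Fin n → β) = P * L := by
    rw [hP, hL, ← pow_add, Nat.sub_add_cancel hkn]; simp
  have hpos := fun j => exists_pos hP0 hcard (G j) ((le_min (hG j) (by
    refine (Finset.card_le_univ _).trans (le_of_eq ?_); simp)).trans hk1)
  choose e he using hpos
  have hUB := mkUB_unitary (fun j => (hV j).1) e hcard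
  let Pr : Protocol α β n :=
    { dC := 2 * M * D
      dAp := 2 * Fintype.card (Fin n → α)
      dY := M
      dAg := D
      dBp := P
      dBg := L * M
      dC_pos := hC0
      dAp_pos := hA0
      dY_pos := hM
      dAg_pos := hD
      dBp_pos := hP0
      dBg_pos := Nat.mul_pos hL0 hM
      UA := UA
      UA_unitary := ⟨hUA1, hUA2⟩
      UB := mkUB V e
      UB_unitary := hUB }
  refine ⟨Pr, rfl, ?_, ?_⟩
  · change _ ≤ Real.log (((2 * Fintype.card (Fin n → α) : ℕ) : ℝ) * (P : ℝ)) - Real.log ((2 * M * D : ℕ) : ℝ)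
    have hb : (0:ℝ) < Fintype.card β := by exact_mod_cast hβ
    have ha : (0:ℝ) < Fintype.card α := by exact_mod_cast hα
    have hM' : (0:ℝ) < M := by exact_mod_cast hM
    have hD' : (0:ℝ) < D := by exact_mod_cast hD
    have hK' : (0:ℝ) < K := by exact_mod_cast hK
    have hk : k * Real.log (Fintype.card β) ≤ Real.log (Fintype.card β) + Real.log K := by
      rw [← Real.log_pow, ← Real.log_mul hb.ne' hK'.ne']
      apply Real.log_le_log (by positivity)
      exact_mod_cast hk2
    have hPl : Real.log P = (n - k) * Real.log (Fintype.card β) := by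
      rw [hP, Nat.cast_pow, Real.log_pow, Nat.cast_sub hkn]
    have hPp : (0:ℝ) < P := by exact_mod_cast hP0
    rw [Real.log_mul (by exact_mod_cast hA0.ne') hPp.ne', hPl]
    push_cast
    rw [Real.log_mul (by positivity) hD'.ne', Real.log_mul two_ne_zero hM'.ne',
      Real.log_mul two_ne_zero (by positivity)]
    simp only [Finset.prod_const, Finset.card_univ, Fintype.card_fin, Fintype.card_pi, Nat.cast_pow, Real.log_pow]
    linarith
  · have hPSD : (tpowAB ρ n).PosSemidef := (density_tpowAB hρ n).1
    have hent : ∀ (g : Fin D) (l : Fin L) (y : Fin M),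
        stateAfterUB ρ Pr ((⟨0, hP0⟩, finProdFinEquiv (l, y)), (⟨0, hA0⟩, g))
          ((⟨0, hP0⟩, finProdFinEquiv (l, y)), (⟨0, hA0⟩, g)) =
        ((N ⊗ₖ V y) * tpowAB ρ n * (N ⊗ₖ V y)ᴴ) ((y, g), (e y).symm (⟨0, hP0⟩, l))
          ((y, g), (e y).symm (⟨0, hP0⟩, l)) := by
      intro g l y
      have hU : ∀ b y', Pr.UB (⟨0, hP0⟩, finProdFinEquiv (l, y)) (b, y') =
          if y = y' then V y' ((e y').symm (⟨0, hP0⟩, l)) b else 0 := by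
        intro b y'
        change mkUB V e _ _ = _
        simp only [mkUB, Matrix.of_apply, Equiv.symm_apply_apply]
      unfold stateAfterUB
      rw [kron_conj_entry, kron_entry', Fintype.sum_prod_type]
      refine Finset.sum_congr rfl fun b _ => ?_
      rw [Finset.sum_eq_single y]
      · rw [Fintype.sum_prod_type]
        refine Finset.sum_congr rfl fun b' _ => ?_
        rw [Finset.sum_eq_single y]
        · have h3 : Matrix.reindex (pullBY (Fin Pr.dAp) (Fin Pr.dY) (Fin Pr.dAg) (Fin n → β))
              (pullBY (Fin Pr.dAp) (Fin Pr.dY) (Fin Pr.dAg) (Fin n → β)) (stateAfterDephasing ρ Pr)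
              ((b, y), (⟨0, hA0⟩, g)) ((b', y), (⟨0, hA0⟩, g)) =
              stateAfterDephasing ρ Pr (((⟨0, hA0⟩, y), g), b) (((⟨0, hA0⟩, y), g), b') := rfl
          rw [h3, hU, hU, stateAfterDephasing_entry, if_pos rfl, if_pos rfl, if_pos rfl, stateAfterUA_entry]
          congr 2
          refine Finset.sum_congr rfl fun a _ => Finset.sum_congr rfl fun a' _ => ?_
          have h4 : ∀ a, Pr.UA ((⟨0, hA0⟩, y), g) (a, ⟨0, Pr.dC_pos⟩) = N (y, g) a := fun a => hUA3 y g a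
          rw [h4, h4]
        · intro y' _ hy
          rw [hU b', if_neg hy.symm, star_zero, mul_zero]
        · simp
      · intro y' _ hy
        refine Finset.sum_eq_zero fun q _ => ?_
        rw [hU b, if_neg hy.symm, zero_mul, zero_mul]
      · simp
    have := protocolError_le hρ Pr (t := 1 - ε) ?_
    · simpa using this
    refine hs.trans ?_
    have hout : outputReduced ρ Pr (⟨0, hA0⟩, ⟨0, hP0⟩) (⟨0, hA0⟩, ⟨0, hP0⟩) =
        ∑ g : Fin D, ∑ bg : Fin (L * M), stateAfterUB ρ Pr ((⟨0, hP0⟩, bg), (⟨0, hA0⟩, g))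
          ((⟨0, hP0⟩, bg), (⟨0, hA0⟩, g)) := by
      rw [← Fintype.sum_prod_type']; rfl
    have hout2 : outputReduced ρ Pr (⟨0, hA0⟩, ⟨0, hP0⟩) (⟨0, hA0⟩, ⟨0, hP0⟩) =
        ∑ y, ∑ g, ∑ l, ((N ⊗ₖ V y) * tpowAB ρ n * (N ⊗ₖ V y)ᴴ) ((y, g), (e y).symm (⟨0, hP0⟩, l))
          ((y, g), (e y).symm (⟨0, hP0⟩, l)) := by
      rw [hout]
      have : ∀ g : Fin D, (∑ bg : Fin (L * M), stateAfterUB ρ Pr ((⟨0, hP0⟩, bg), (⟨0, hA0⟩, g))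
          ((⟨0, hP0⟩, bg), (⟨0, hA0⟩, g))) = ∑ y, ∑ l, ((N ⊗ₖ V y) * tpowAB ρ n * (N ⊗ₖ V y)ᴴ) ((y, g), (e y).symm (⟨0, hP0⟩, l))
          ((y, g), (e y).symm (⟨0, hP0⟩, l)) := by
        intro g
        rw [← Equiv.sum_comp (finProdFinEquiv (m := L) (n := M)), Fintype.sum_prod_type_right]
        exact Finset.sum_congr rfl fun y _ => Finset.sum_congr rfl fun l _ => hent g l y
      rw [Finset.sum_congr rfl fun g _ => this g, Finset.sum_comm]
    change CodeVal _ N V G ≤ (outputReduced ρ Pr (⟨0, hA0⟩, ⟨0, hP0⟩) (⟨0, hA0⟩, ⟨0, hP0⟩)).re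
    rw [hout2]
    simp only [Complex.re_sum]
    unfold CodeVal
    refine Finset.sum_le_sum fun y _ => Finset.sum_le_sum fun g _ => ?_
    have hnn : ∀ i, 0 ≤ (((N ⊗ₖ V y) * tpowAB ρ n * (N ⊗ₖ V y)ᴴ) ((y, g), i) ((y, g), i)).re := fun i =>
      (Complex.nonneg_iff.1 ((hPSD.mul_mul_conjTranspose_same (N ⊗ₖ V y)).diag_nonneg (i := ((y, g), i)))).1
    have hinj : Function.Injective fun l : Fin L => (e y).symm (⟨0, hP0⟩, l) := by
      intro l l' h
      simpa using h
    rw [← Finset.sum_image (f := fun i => (((N ⊗ₖ V y) * tpowAB ρ n * (N ⊗ₖ V y)ᴴ) ((y, g), i) ((y, g), i)).re)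
      (g := fun l : Fin L => (e y).symm (⟨0, hP0⟩, l)) (s := Finset.univ) hinj.injOn]
    apply Finset.sum_le_sum_of_subset_of_nonneg
    · intro i hi
      rw [Finset.mem_image]
      refine ⟨(e y i).2, Finset.mem_univ _, ?_⟩
      rw [← he y i hi]; simp
    · exact fun i _ _ => hnn i

end


/-! ### Entropies of classical-quantum states -/

def bd {Y W W' : Type*} [DecidableEq Y] (S : Y → Matrix W W' ℂ) : Matrix (Y × W) (Y × W') ℂ :=
  Matrix.of fun p q => if p.1 = q.1 then S p.1 p.2 q.2 else 0

theorem bd_mul {Y W W' W'' : Type*} [Fintype Y] [DecidableEq Y] [Fintype W'] (S : Y → Matrix W W' ℂ)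
    (T : Y → Matrix W' W'' ℂ) : bd S * bd T = bd (fun y => S y * T y) := by
  ext ⟨y, w⟩ ⟨y', w'⟩
  rw [Matrix.mul_apply, Fintype.sum_prod_type, Finset.sum_eq_single y]
  · simp only [bd, Matrix.of_apply, if_true]
    split_ifs with h
    · rw [Matrix.mul_apply]
    · simp
  · intro z _ hz
    simp [bd, hz.symm]
  · simp

theorem bd_conjT {Y W W' : Type*} [DecidableEq Y] (S : Y → Matrix W W' ℂ) : (bd S)ᴴ = bd (fun y => (S y)ᴴ) := by
  ext ⟨y, w⟩ ⟨y', w'⟩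
  simp only [bd, Matrix.of_apply, conjTranspose_apply]
  by_cases h : y = y'
  · subst h; simp
  · simp [h, Ne.symm h]

theorem bd_diag {Y W : Type*} [DecidableEq Y] [DecidableEq W] (x : Y → W → ℂ) :
    bd (fun y => diagonal (x y)) = diagonal (fun p : Y × W => x p.1 p.2) := by
  ext ⟨y, w⟩ ⟨y', w'⟩
  simp only [bd, Matrix.of_apply, diagonal_apply, Prod.mk.injEq]
  by_cases h : y = y' <;> by_cases h' : w = w' <;> simp [h, h']

theorem bd_one {Y W : Type*} [DecidableEq Y] [DecidableEq W] : bd (fun _ : Y => (1 : Matrix W W ℂ)) = 1 := by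
  rw [← diagonal_one, ← diagonal_one]
  exact bd_diag (fun _ _ => 1)

theorem bd_entropy {Y W : Type*} [Fintype Y] [DecidableEq Y] [Fintype W] [DecidableEq W]
    {U : Y → Matrix W W ℂ} {x : Y → W → ℝ} (hU : ∀ y, (U y)ᴴ * U y = 1) :
    entropy (bd fun y => fc (U y) (x y)) = -∑ y, ∑ w, x y w * Real.log (x y w) := by
  have h1 : bd (fun y => fc (U y) (x y)) = fc (bd U) (fun p : Y × W => x p.1 p.2) := by
    unfold fc
    rw [← bd_mul, ← bd_mul, bd_diag, bd_conjT]
  have h2 : (bd U)ᴴ * bd U = 1 := by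
    rw [bd_conjT, bd_mul, funext hU, bd_one]
  rw [h1, entropy_fc h2, Fintype.sum_prod_type]

theorem cq_mutualInfo {Y W : Type*} [Fintype Y] [DecidableEq Y] [Fintype W] [DecidableEq W]
    {S : Y → Matrix W W ℂ} {U : Y → Matrix W W ℂ} {x : Y → W → ℝ} {p : Y → ℝ} (hU : ∀ y, (U y)ᴴ * U y = 1)
    (hS : ∀ y, S y = fc (U y) (x y)) (hx : ∀ y w, 0 ≤ x y w) (hp : ∀ y, p y = ∑ w, x y w) :
    mutualInfo (bd S) = entropy (∑ y, S y) - (-∑ y, ∑ w, x y w * Real.log (x y w / p y)) := by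
  have h1 : entropy (bd S) = -∑ y, ∑ w, x y w * Real.log (x y w) := by
    rw [funext hS]; exact bd_entropy hU
  have h2 : ptraceLeft (bd S) = ∑ y, S y := by
    ext w w'
    rw [Matrix.sum_apply]
    simp [ptraceLeft, bd]
  have h3 : ptraceRight (bd S) = fc (1 : Matrix Y Y ℂ) p := by
    ext y y'
    simp only [fc, Matrix.one_mul, conjTranspose_one, Matrix.mul_one, diagonal_apply, ptraceRight, bd, Matrix.of_apply]
    split_ifs with h
    · have := fc_trace (hU y) (x y)
      rw [← hS, ← hp] at this
      exact this
    · simp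
  have h4 : entropy (ptraceRight (bd S)) = -∑ y, p y * Real.log (p y) := by
    rw [h3, entropy_fc (by simp)]
  have h5 : ∀ y, ∑ w, x y w * Real.log (x y w / p y) = ∑ w, x y w * Real.log (x y w) - p y * Real.log (p y) := by
    intro y
    have : p y * Real.log (p y) = ∑ w, x y w * Real.log (p y) := by rw [← Finset.sum_mul, ← hp]
    rw [this, ← Finset.sum_sub_distrib]
    refine Finset.sum_congr rfl fun w _ => ?_
    rcases eq_or_ne (x y w) 0 with h0 | h0
    · simp [h0]
    · have hpy : p y ≠ 0 := by
        have : x y w ≤ p y := by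
          rw [hp]; exact Finset.single_le_sum (fun w _ => hx y w) (Finset.mem_univ w)
        have := lt_of_le_of_ne (hx y w) h0.symm
        linarith
      rw [Real.log_div h0 hpy]; ring
  unfold mutualInfo
  rw [h1, h2, h4, Finset.sum_congr rfl fun y _ => h5 y, Finset.sum_sub_distrib]
  ring

theorem exists_SD {α β E Y : Type*} [Fintype α] [DecidableEq α] [Fintype β] [DecidableEq β]
    [Fintype E] [DecidableEq E] [Fintype Y] [DecidableEq Y] {ρ : Matrix (α × β) (α × β) ℂ}
    {ψ : (α × β) × E → ℂ} (hψ : star ψ ⬝ᵥ ψ = 1) (hpur : ptraceRight (vecMulVec ψ (star ψ)) = ρ)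
    (Λ : POVM α Y) : ∃ s : SD α β E Y,
      (∀ a b a' b', ρ (a, b) (a', b') = ∑ e, s.Φ (b, e) a * star (s.Φ (b', e) a')) ∧
      IYBE (measureLeft Λ (Matrix.reindex (Equiv.prodAssoc α β E)
          (Equiv.prodAssoc α β E) (vecMulVec ψ (star ψ)))) = s.H - s.h2 ∧
      kappa (ptraceRight ρ) + kappa (ptraceLeft ρ) +
        IYB (measureLeft Λ (Matrix.reindex (Equiv.prodAssoc α β E)
          (Equiv.prodAssoc α β E) (vecMulVec ψ (star ψ)))) =
        Real.log (Fintype.card α) + Real.log (Fintype.card β) - s.H - s.h3 := by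
  let Φ : Matrix (β × E) α ℂ := Matrix.of fun w a => ψ ((a, w.1), w.2)
  let σ : Y → Matrix (β × E) (β × E) ℂ := fun y => Φ * (Λ.elem y)ᵀ * Φᴴ
  have hσp : ∀ y, (σ y).PosSemidef := fun y => (Λ.pos y).transpose.mul_mul_conjTranspose_same Φ
  have hτp : ∀ y, (ptraceRight (σ y)).PosSemidef := fun y => by
    have : ptraceRight (σ y) = ∑ e, (σ y).submatrix (fun b => (b, e)) (fun b => (b, e)) := by
      ext a a'; rw [Matrix.sum_apply]; rfl
    rw [this]
    exact Matrix.posSemidef_sum _ fun b _ => (hσp y).submatrix _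
  choose U μ hU hU' hσμ hμ using fun y => exists_fc_psd (hσp y)
  choose V ν hV hV' hτν hν using fun y => exists_fc_psd (hτp y)
  obtain ⟨UG, g, hUG, hUG', hG, hg⟩ := exists_fc_psd (posSemidef_self_mul_conjTranspose Φ)
  have hρ : ∀ a b a' b', ρ (a, b) (a', b') = ∑ e, Φ (b, e) a * star (Φ (b', e) a') := by
    intro a b a' b'
    rw [← hpur]; rfl
  have hΦ : hs Φ = 1 := by
    have h1 : ((hs Φ : ℝ) : ℂ) = 1 := by
      rw [← trace_conjT_mul, ← hψ, Matrix.trace, dotProduct, Fintype.sum_prod_type, Fintype.sum_prod_type]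
      refine Finset.sum_congr rfl fun a _ => ?_
      rw [Matrix.diag_apply, Matrix.mul_apply, Fintype.sum_prod_type]
      rfl
    exact_mod_cast h1
  have hσs : ∑ y, σ y = Φ * Φᴴ := by
    simp only [σ]
    rw [← Matrix.sum_mul, ← Matrix.mul_sum, ← transpose_sum, Λ.sum_eq, transpose_one, Matrix.mul_one]
  have hptr : ∀ y, ∑ i, ν y i = ∑ w, μ y w := by
    intro y
    have h1 := fc_trace (hV y) (ν y)
    have h2 := fc_trace (hU y) (μ y)
    rw [← hτν] at h1
    rw [← hσμ] at h2
    have h3 : (ptraceRight (σ y)).trace = (σ y).trace := by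
      rw [Matrix.trace, Matrix.trace, Fintype.sum_prod_type]; rfl
    rw [h3, h2] at h1
    exact_mod_cast h1.symm
  let s : SD α β E Y :=
    { Φ := Φ
      σ := σ
      U := U
      μ := μ
      p := fun y => ∑ w, μ y w
      UG := UG
      g := g
      V := fun y => (V y)ᴴ
      ν := ν
      hΦ := hΦ
      hσ := hσs
      hU := hU
      hU' := hU'
      hμ := hμ
      hσμ := hσμ
      hp := fun _ => rfl
      hUG := hUG
      hUG' := hUG'
      hg := hg
      hG := hG
      hV := fun y => by rw [conjTranspose_conjTranspose, hV']
      hV' := fun y => by rw [conjTranspose_conjTranspose, hV]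
      hν := by
        intro y i
        simp only [kron_conj_entry]
        have h1 : (V y)ᴴ * ptraceRight (σ y) * (V y) = diagonal (fun i => (ν y i : ℂ)) := by
          rw [hτν]; unfold fc
          calc (V y)ᴴ * (V y * diagonal (fun i => (ν y i : ℂ)) * (V y)ᴴ) * V y
              = ((V y)ᴴ * V y) * diagonal (fun i => (ν y i : ℂ)) * ((V y)ᴴ * V y) := by
                simp only [Matrix.mul_assoc]
            _ = _ := by rw [hV]; simp
        have h2 := congrFun (congrFun h1 i) i
        rw [diagonal_apply_eq, Matrix.mul_apply] at h2
        rw [← h2]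
        simp only [Matrix.mul_apply, Finset.sum_mul, ptraceRight, Finset.mul_sum]
        rw [Finset.sum_comm]
        have : ∀ f : β → E → β → ℂ, ∑ s, ∑ e, ∑ s', f s e s' = ∑ s', ∑ s, ∑ e, f s e s' := by
          intro f
          rw [Finset.sum_comm (s := (Finset.univ : Finset β)) (t := (Finset.univ : Finset β))]
          refine Finset.sum_congr rfl fun b _ => ?_
          rw [Finset.sum_comm]
        rw [this]
        refine Finset.sum_congr rfl fun b _ => Finset.sum_congr rfl fun b' _ => Finset.sum_congr rfl fun e _ => ?_
        simp only [conjTranspose_apply, star_star] }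
  have hm : measureLeft Λ (Matrix.reindex (Equiv.prodAssoc α β E) (Equiv.prodAssoc α β E)
      (vecMulVec ψ (star ψ))) = bd σ := by
    ext ⟨y, w⟩ ⟨y', w'⟩
    simp only [measureLeft, bd, Matrix.of_apply]
    split_ifs with h
    · simp only [σ]
      rw [Matrix.mul_apply]
      refine Finset.sum_congr rfl fun a _ => ?_
      rw [Matrix.mul_apply, Finset.sum_mul]
      refine Finset.sum_congr rfl fun a' _ => ?_
      have : (Matrix.reindex (Equiv.prodAssoc α β E) (Equiv.prodAssoc α β E)
        (vecMulVec ψ (star ψ))) (a', w) (a, w') = Φ w a' * Φᴴ a w' := rfl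
      rw [this, transpose_apply]; ring
    · rfl
  have hm2 : ptraceRight (Matrix.reindex (Equiv.prodAssoc Y β E).symm
    (Equiv.prodAssoc Y β E).symm (bd σ)) = bd (fun y => ptraceRight (σ y)) := by
    ext ⟨y, b⟩ ⟨y', b'⟩
    simp only [bd, Matrix.of_apply, ptraceRight, Matrix.reindex_apply, submatrix_apply]
    by_cases h : y = y' <;> simp [h]
  have hHG : entropy (Φ * Φᴴ) = s.H := by rw [hG, entropy_fc hUG]; rfl
  refine ⟨s, hρ, ?_, ?_⟩
  · rw [hm, IYBE, cq_mutualInfo (p := s.p) hU hσμ hμ (fun _ => rfl), hσs, hHG]; rfl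
  · rw [hm, IYB, hm2, cq_mutualInfo (p := s.p) hV hτν hν (fun y => (hptr y).symm)]
    have e1 : ∑ y, ptraceRight (σ y) = ptraceLeft ρ := by
      have : ∑ y, ptraceRight (σ y) = ptraceRight (∑ y, σ y) := by
        ext b b'
        simp only [Matrix.sum_apply, ptraceRight]
        rw [Finset.sum_comm]
      rw [this, hσs]
      ext b b'
      simp only [ptraceRight, ptraceLeft, hρ, Matrix.mul_apply]
      rw [Finset.sum_comm]; rfl
    have e2 : entropy (ptraceRight ρ) = s.H := by
      have : ptraceRight ρ = (Φᴴ * Φ)ᵀ := by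
        ext a a'
        simp only [ptraceRight, hρ, transpose_apply, Matrix.mul_apply, conjTranspose_apply, Fintype.sum_prod_type]
        simp only [mul_comm]
      rw [this, entropy_transpose (isHermitian_conjTranspose_mul_self Φ), ← entropy_mul_comm, hHG]
    rw [e1]
    unfold kappa
    rw [e2]
    simp only [SD.h3]
    ring


theorem Code.reindexX {A B X X' : Type*} [Fintype A] [DecidableEq A] [Fintype B] [DecidableEq B]
    [Fintype X] [Fintype X'] (e : X' ≃ X) {ρ : Matrix (A × B) (A × B) ℂ} {M K : ℕ} {ε : ℝ}
    (hc : Code ρ M X K ε) : Code ρ M X' K ε := by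
  obtain ⟨N, V, G, hN, hV, hG, hs⟩ := hc
  let g : Fin M × X' ≃ Fin M × X := (Equiv.refl _).prodCongr e
  refine ⟨N.submatrix g id, V, G, ?_, hV, hG, ?_⟩
  · have : (N.submatrix g id)ᴴ * N.submatrix g id = Nᴴ * N := by
      rw [conjTranspose_submatrix, submatrix_mul_equiv, submatrix_id_id]
    rw [this]; exact hN
  · refine hs.trans (le_of_eq ?_)
    unfold CodeVal
    refine Finset.sum_congr rfl fun j _ => ?_
    exact (Fintype.sum_equiv e _ _ fun x => Finset.sum_congr rfl fun i _ => rfl).symm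

def splitE (q k r n : ℕ) (h : q * k + r = n) {α α' : Type*} (e : (Fin k → α) ≃ α') :
    (Fin n → α) ≃ (Fin q → α') × (Fin r → α) :=
  let f : (Fin q × Fin k) ⊕ Fin r ≃ Fin n :=
    (((finProdFinEquiv (m := q) (n := k)).sumCongr (Equiv.refl (Fin r))).trans finSumFinEquiv).trans (finCongr h)
  ((Equiv.arrowCongr f.symm (Equiv.refl α)).trans (Equiv.sumArrowEquivProdArrow _ _ _)).trans
    (((Equiv.curry _ _ _).trans (Equiv.arrowCongr (Equiv.refl _) e)).prodCongr (Equiv.refl _))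

theorem tpowAB_split {α β α' β' : Type*} {ρ : Matrix (α × β) (α × β) ℂ} {ρ' : Matrix (α' × β') (α' × β') ℂ}
    {k : ℕ} (eα : (Fin k → α) ≃ α') (eβ : (Fin k → β) ≃ β')
    (hk : ∀ a b a' b', tpowAB ρ k (a, b) (a', b') = ρ' (eα a, eβ b) (eα a', eβ b'))
    {q r n : ℕ} (h : q * k + r = n) (a b a' b') :
    tpowAB ρ n (a, b) (a', b') =
      tpowAB ρ' q ((splitE q k r n h eα a).1, (splitE q k r n h eβ b).1)
        ((splitE q k r n h eα a').1, (splitE q k r n h eβ b').1) *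
      tpowAB ρ r ((splitE q k r n h eα a).2, (splitE q k r n h eβ b).2)
        ((splitE q k r n h eα a').2, (splitE q k r n h eβ b').2) := by
  let f : (Fin q × Fin k) ⊕ Fin r ≃ Fin n :=
    (((finProdFinEquiv (m := q) (n := k)).sumCongr (Equiv.refl (Fin r))).trans finSumFinEquiv).trans (finCongr h)
  have h1 : tpowAB ρ n (a, b) (a', b') = ∏ k, ρ (a k, b k) (a' k, b' k) := rfl
  rw [h1, ← Fintype.prod_equiv f (fun i => ρ (a (f i), b (f i)) (a' (f i), b' (f i))) _ (fun _ => rfl),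
    Fintype.prod_sum_type, Fintype.prod_prod_type]
  refine congrArg₂ (· * ·) ?_ rfl
  have h2 : ∀ (x y : (Fin q → α') × (Fin q → β')), tpowAB ρ' q x y = ∏ k, ρ' (x.1 k, x.2 k) (y.1 k, y.2 k) :=
    fun _ _ => rfl
  rw [h2]
  refine Finset.prod_congr rfl fun i _ => ?_
  exact hk (fun j => a (f (Sum.inl (i, j)))) (fun j => b (f (Sum.inl (i, j))))
    (fun j => a' (f (Sum.inl (i, j)))) (fun j => b' (f (Sum.inl (i, j))))

theorem achieve_core {α β α' β' E Y : Type*} [Fintype α] [DecidableEq α] [Fintype β] [DecidableEq β]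
    [Fintype α'] [DecidableEq α'] [Fintype β'] [DecidableEq β']
    [Fintype E] [DecidableEq E] [Fintype Y] [DecidableEq Y] {ρ : Matrix (α × β) (α × β) ℂ}
    (hρ : IsDensity ρ) {ρ' : Matrix (α' × β') (α' × β') ℂ} {k : ℕ} (hk0 : 0 < k)
    (eα : (Fin k → α) ≃ α') (eβ : (Fin k → β) ≃ β')
    (hk : ∀ a b a' b', tpowAB ρ k (a, b) (a', b') = ρ' (eα a, eβ b) (eα a', eβ b'))
    (s : SD α' β' E Y)
    (hs : ∀ a b a' b', ρ' (a, b) (a', b') = ∑ e, s.Φ (b, e) a * star (s.Φ (b', e) a'))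
    {P R : ℝ} (hR : s.H - s.h2 ≤ k * R)
    (hP : k * P ≤ k * Real.log (Fintype.card α) + k * Real.log (Fintype.card β) - s.H - s.h3) :
    Achievable ρ P R := by
  intro ε hε δ hδ
  have hne : Nonempty (α × β) := by
    by_contra h
    rw [not_nonempty_iff] at h
    have := hρ.2
    rw [Matrix.trace, Fintype.sum_empty] at this
    exact zero_ne_one this
  obtain ⟨a0, b0⟩ := hne
  have hα : 0 < Fintype.card α := Fintype.card_pos_iff.2 ⟨a0⟩
  have hβ : 0 < Fintype.card β := Fintype.card_pos_iff.2 ⟨b0⟩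
  obtain ⟨N, hN⟩ := s.code hs (ε := (ε / 3) ^ 2) (δ := δ / 4) (by positivity) (by positivity)
  set B := Real.log (Fintype.card β) with hB
  set A := Real.log (Fintype.card α) with hA
  obtain ⟨N1, hN1⟩ := exists_nat_ge ((2 * (k * |P| + B) + 4 * (k * |R|)) / δ)
  refine ⟨k * N + N1 + 1, fun n hn => ?_⟩
  have hq : N ≤ n / k := by
    rw [Nat.le_div_iff_mul_le hk0, mul_comm]; omega
  have hsplit : (n / k) * k + n % k = n := Nat.div_add_mod' n k
  have hr : n % k < k := Nat.mod_lt _ hk0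
  obtain ⟨M, D, K, hM, hD, hK, h1, h2, h3, hc⟩ := hN _ hq
  generalize n / k = q at *
  generalize n % k = r at *
  have hc2 := Code.extend (splitE q k r n hsplit eα) (splitE q k r n hsplit eβ)
    (tpowAB_split eα eβ hk hsplit) (density_tpowAB hρ r).2 hc
  have e : Fin (D * Fintype.card α ^ r) ≃ Fin D × (Fin r → α) :=
    (Fintype.equivFinOfCardEq (by simp)).symm
  have hc3 := hc2.reindexX e
  have hKb : Fintype.card (Fin r → β) = Fintype.card β ^ r := by simp
  rw [hKb] at hc3
  obtain ⟨Pr, hY, hpur, herr⟩ := hc3.protocol hρ hM (by positivity) (by positivity) hα hβ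
  have hn1 : (1 : ℝ) ≤ n := by exact_mod_cast (by omega : 1 ≤ n)
  have hn0 : (0 : ℝ) < n := by linarith
  have hnN : (N1 : ℝ) ≤ n := by exact_mod_cast (by omega : N1 ≤ n)
  have hlarge : 2 * (k * |P| + B) + 4 * (k * |R|) ≤ n * δ := by
    rw [div_le_iff₀ hδ] at hN1
    nlinarith
  have hsR : (q : ℝ) * k + r = n := by exact_mod_cast hsplit
  have hrR : (r : ℝ) ≤ k := by exact_mod_cast hr.le
  have hr0 : (0 : ℝ) ≤ r := Nat.cast_nonneg r
  have hq0 : (0 : ℝ) ≤ q := Nat.cast_nonneg q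
  have hk1 : (1 : ℝ) ≤ k := by exact_mod_cast hk0
  have hqn : (q : ℝ) ≤ n := by nlinarith
  have hB0 : 0 ≤ B := Real.log_nonneg (by exact_mod_cast hβ)
  have hrP : (r : ℝ) * P ≤ k * |P| := by
    calc (r : ℝ) * P ≤ r * |P| := mul_le_mul_of_nonneg_left (le_abs_self P) hr0
      _ ≤ _ := mul_le_mul_of_nonneg_right hrR (abs_nonneg P)
  have hrRR : -((r : ℝ) * R) ≤ k * |R| := by
    calc -((r : ℝ) * R) = r * (-R) := by ring
      _ ≤ r * |R| := mul_le_mul_of_nonneg_left (neg_le_abs R) hr0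
      _ ≤ _ := mul_le_mul_of_nonneg_right hrR (abs_nonneg R)
  have hqδ : (q : ℝ) * δ ≤ n * δ := mul_le_mul_of_nonneg_right hqn hδ.le
  have hkP0 : 0 ≤ (k : ℝ) * |P| := by positivity
  have hkR0 : 0 ≤ (k : ℝ) * |R| := by positivity
  refine ⟨Pr, ?_, ?_, ?_⟩
  · unfold commRate
    rw [div_le_iff₀ hn0, hY]
    have : (q : ℝ) * (s.H - s.h2) ≤ q * (k * R) := mul_le_mul_of_nonneg_left hR hq0
    have e1 : n * R = q * (k * R) + r * R := by rw [← hsR]; ring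
    linarith
  · unfold purityRate
    rw [le_div_iff₀ hn0]
    refine le_trans ?_ hpur
    push_cast
    rw [Real.log_mul (by positivity) (by positivity), Real.log_mul (by positivity) (by positivity),
      Real.log_pow, Real.log_pow, ← hA, ← hB]
    have : (q : ℝ) * (k * P) ≤ q * (k * A + k * B - s.H - s.h3) := mul_le_mul_of_nonneg_left hP hq0
    have e1 : n * P = q * (k * P) + r * P := by rw [← hsR]; ring
    have e2 : n * A = q * (k * A) + r * A := by rw [← hsR]; ring
    have e3 : n * B = q * (k * B) + r * B := by rw [← hsR]; ring
    linarith
  · refine herr.trans (le_of_eq ?_)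
    rw [Real.sqrt_sq (by positivity)]; ring

theorem direct_part1 {α β E Y : Type*} [Fintype α] [DecidableEq α] [Fintype β] [DecidableEq β]
    [Fintype E] [DecidableEq E] [Fintype Y] [DecidableEq Y] {ρ : Matrix (α × β) (α × β) ℂ} (hρ : IsDensity ρ)
    {ψ : (α × β) × E → ℂ} (hψ : star ψ ⬝ᵥ ψ = 1) (hpur : ptraceRight (vecMulVec ψ (star ψ)) = ρ)
    (Λ : POVM α Y) : 
    Achievable ρ
      (kappa (ptraceRight ρ) + kappa (ptraceLeft ρ) +
        IYB (measureLeft Λ (Matrix.reindex (Equiv.prodAssoc α β E)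
          (Equiv.prodAssoc α β E) (vecMulVec ψ (star ψ)))))
      (IYBE (measureLeft Λ (Matrix.reindex (Equiv.prodAssoc α β E)
        (Equiv.prodAssoc α β E) (vecMulVec ψ (star ψ))))) := by
  obtain ⟨s, hs, h1, h2⟩ := exists_SD hψ hpur Λ
  rw [h1, h2]
  refine achieve_core hρ one_pos (Equiv.funUnique (Fin 1) α) (Equiv.funUnique (Fin 1) β) ?_ s hs ?_ ?_
  · intro a b a' b'
    have h1 : tpowAB ρ 1 (a, b) (a', b') = ∏ k, ρ (a k, b k) (a' k, b' k) := rfl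
    rw [h1]; simp
  · simp
  · simp

theorem sqrt_mul_conjT {ι : Type*} [Fintype ι] [DecidableEq ι] {ρ : Matrix ι ι ℂ} (h : ρ.PosSemidef) :
    h.sqrt * h.sqrtᴴ = ρ := by
  have hU : (h.1.eigenvectorUnitary.1)ᴴ * h.1.eigenvectorUnitary.1 = 1 :=
    (Matrix.mem_unitaryGroup_iff').1 h.1.eigenvectorUnitary.2
  have e1 : h.sqrt = fc h.1.eigenvectorUnitary.1 (fun i => √(h.1.eigenvalues i)) := rfl
  rw [e1, fc_conjT, fc_mul hU]
  have h3 : ρ = fc h.1.eigenvectorUnitary.1 h.1.eigenvalues := by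
    conv_lhs => rw [h.1.spectral_theorem]
    rfl
  conv_rhs => rw [h3]
  congr 1
  funext i
  exact Real.mul_self_sqrt (h.eigenvalues_nonneg i)

theorem canonical_norm {ι : Type*} [Fintype ι] [DecidableEq ι] {ρ : Matrix ι ι ℂ} (h : ρ.PosSemidef)
    (ht : ρ.trace = 1) : star (fun p : ι × ι => h.sqrt p.1 p.2) ⬝ᵥ (fun p : ι × ι => h.sqrt p.1 p.2) = 1 := by
  rw [← ht]
  conv_rhs => rw [← sqrt_mul_conjT h]
  rw [dotProduct, Fintype.sum_prod_type, Matrix.trace]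
  refine Finset.sum_congr rfl fun a _ => ?_
  rw [Matrix.diag_apply, Matrix.mul_apply]
  refine Finset.sum_congr rfl fun a _ => ?_
  exact mul_comm _ _

theorem canonical_pur {ι : Type*} [Fintype ι] [DecidableEq ι] {ρ : Matrix ι ι ℂ} (h : ρ.PosSemidef) :
    ptraceRight (vecMulVec (fun p : ι × ι => h.sqrt p.1 p.2) (star fun p : ι × ι => h.sqrt p.1 p.2)) = ρ := by
  conv_rhs => rw [← sqrt_mul_conjT h]
  rfl

theorem sigmaOf_eq {α β Y : Type*} [Fintype α] [DecidableEq α] [Fintype β] [DecidableEq β]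
    [Fintype Y] [DecidableEq Y] {ρ : Matrix (α × β) (α × β) ℂ} (h : ρ.PosSemidef) (Λ : POVM α Y) :
    sigmaOf ρ Λ = measureLeft Λ (Matrix.reindex (Equiv.prodAssoc α β (α × β)) (Equiv.prodAssoc α β (α × β))
      (vecMulVec (fun p => h.sqrt p.1 p.2) (star fun p => h.sqrt p.1 p.2))) := by
  unfold sigmaOf purifyAssoc canonicalPurification
  rw [dif_pos h]

theorem trivial_IYBE {α β E : Type*} [Fintype α] [DecidableEq α] [Fintype β] [DecidableEq β]
    [Fintype E] [DecidableEq E] 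
    {ψ : (α × β) × E → ℂ} (hψ : star ψ ⬝ᵥ ψ = 1) (Λ : POVM α (Fin 1)) :
    IYBE (measureLeft Λ (Matrix.reindex (Equiv.prodAssoc α β E)
        (Equiv.prodAssoc α β E) (vecMulVec ψ (star ψ)))) = 0 := by
  let Φ : Matrix (β × E) α ℂ := Matrix.of fun w a => ψ ((a, w.1), w.2)
  have hΛ : Λ.elem 0 = 1 := by have := Λ.sum_eq; simpa using this
  have hΦ : (Φ * Φᴴ).trace = 1 := by
    rw [Matrix.trace_mul_comm, ← hψ, Matrix.trace, dotProduct, Fintype.sum_prod_type, Fintype.sum_prod_type]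
    refine Finset.sum_congr rfl fun a _ => ?_
    rw [Matrix.diag_apply, Matrix.mul_apply, Fintype.sum_prod_type]
    rfl
  obtain ⟨U, x, hU, hU', hG, hx⟩ := exists_fc_psd (posSemidef_self_mul_conjTranspose Φ)
  have hx1 : ∑ w, x w = 1 := by
    have := fc_trace hU x
    rw [← hG, hΦ] at this
    exact_mod_cast this.symm
  have hm : measureLeft Λ (Matrix.reindex (Equiv.prodAssoc α β E) (Equiv.prodAssoc α β E)
      (vecMulVec ψ (star ψ))) = bd (fun _ => Φ * Φᴴ) := by
    ext ⟨y, w⟩ ⟨y', w'⟩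
    obtain rfl := Subsingleton.elim y 0
    obtain rfl := Subsingleton.elim y' 0
    simp only [measureLeft, bd, Matrix.of_apply, if_true, hΛ]
    rw [Matrix.mul_apply]
    refine Finset.sum_congr rfl fun a _ => ?_
    rw [Finset.sum_eq_single a]
    · rw [Matrix.one_apply_eq, one_mul]; rfl
    · intro b _ hb; rw [Matrix.one_apply_ne hb.symm, zero_mul]
    · simp
  rw [hm, IYBE, cq_mutualInfo (p := fun _ => 1) (fun _ => hU) (fun _ => hG) (fun _ => hx) (fun _ => hx1.symm)]
  simp [hG, entropy_fc hU]

theorem entropy_tpow {ι : Type*} [Fintype ι] [DecidableEq ι] {ρ : Matrix ι ι ℂ} (h : IsDensity ρ) (n : ℕ) :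
    entropy (tpow ρ n) = n * entropy ρ := by
  obtain ⟨U, x, hU, hU', hG, hx⟩ := exists_fc_psd h.1
  have hx1 : ∑ w, x w = 1 := by
    have := fc_trace hU x
    rw [← hG, h.2] at this
    exact_mod_cast this.symm
  have e1 : tpow ρ n = fc (tpr fun _ : Fin n => U) (fun y => ∏ i, x (y i)) := by
    rw [tpow_eq_tpr, hG]; exact tpr_fc (fun _ => U) (fun _ => x)
  have hT : (tpr fun _ : Fin n => U)ᴴ * (tpr fun _ : Fin n => U) = 1 := by
    rw [tpr_conjT, tpr_mul, hU, tpr_one]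
  rw [e1, entropy_fc hT, hG, entropy_fc hU]
  have h1 : ∀ y : Fin n → ι, (∏ i, x (y i)) * Real.log (∏ i, x (y i)) =
      ∑ i, ∏ k, (x (y k) * if k = i then Real.log (x (y k)) else 1) := by
    intro y
    have h2 : ∀ i, ∏ k, (x (y k) * if k = i then Real.log (x (y k)) else 1) =
        (∏ k, x (y k)) * Real.log (x (y i)) := by
      intro i; rw [Finset.prod_mul_distrib]; simp
    simp only [h2]
    rw [← Finset.mul_sum]
    by_cases h0 : ∏ i, x (y i) = 0
    · simp [h0]
    · rw [Real.log_prod]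
      intro i hi hh
      exact h0 (Finset.prod_eq_zero hi hh)
  simp only [h1]
  rw [Finset.sum_comm]
  have h3 : ∀ i : Fin n, ∑ y : Fin n → ι, ∏ k, (x (y k) * if k = i then Real.log (x (y k)) else 1) =
      ∑ w, x w * Real.log (x w) := by
    intro i
    rw [sum_prod_powC (fun k w => x w * if k = i then Real.log (x w) else 1)]
    rw [Finset.prod_eq_single i]
    · simp
    · intro j _ hj; simp [hj, hx1]
    · simp
  simp only [h3]
  simp

theorem kappa_tpow {ι : Type*} [Fintype ι] [DecidableEq ι] {ρ : Matrix ι ι ℂ} (h : IsDensity ρ) (n : ℕ) :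
    kappa (tpow ρ n) = n * kappa ρ := by
  unfold kappa
  rw [entropy_tpow h]
  simp; ring

theorem ptraceRight_tpowAB {α β : Type*} [Fintype α] [DecidableEq α] [Fintype β] [DecidableEq β]
    (ρ : Matrix (α × β) (α × β) ℂ) (n : ℕ) : ptraceRight (tpowAB ρ n) = tpow (ptraceRight ρ) n := by
  ext a a'
  exact sum_prod_powC (fun k b => ρ (a k, b) (a' k, b))

theorem ptraceLeft_tpowAB {α β : Type*} [Fintype α] [DecidableEq α] [Fintype β] [DecidableEq β]
    (ρ : Matrix (α × β) (α × β) ℂ) (n : ℕ) : ptraceLeft (tpowAB ρ n) = tpow (ptraceLeft ρ) n := by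
  ext b b'
  exact sum_prod_powC (fun k a => ρ (a, b k) (a, b' k))

theorem direct_part2 {α β : Type*} [Fintype α] [DecidableEq α] [Fintype β] [DecidableEq β]
    {ρ : Matrix (α × β) (α × β) ℂ} (hρ : IsDensity ρ) {R : ℝ} (hR : 0 ≤ R) {Pinf : ℝ}
    (hlim : Filter.Tendsto (fun n : ℕ => P1 (tpowAB ρ n) (n * R) / n) Filter.atTop (nhds Pinf))
    {P : ℝ} (hP : P ≤ kappa (ptraceRight ρ) + kappa (ptraceLeft ρ) + Pinf) : Achievable ρ P R := by
  have key : ∀ η > 0, Achievable ρ (P - η) R := by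
    intro η hη
    obtain ⟨k, hk1, hk0⟩ := ((hlim.eventually (lt_mem_nhds (show Pinf - η / 2 < Pinf by linarith))).and
      (Filter.eventually_gt_atTop 0)).exists
    have hkR : (0 : ℝ) < k := by exact_mod_cast hk0
    have hd := density_tpowAB hρ k
    have hΛ : ∃ (m : ℕ) (Λ : POVM (Fin k → α) (Fin m)), IYBE (sigmaOf (tpowAB ρ k) Λ) ≤ k * R ∧
        P1 (tpowAB ρ k) (k * R) - η / 2 ≤ IYB (sigmaOf (tpowAB ρ k) Λ) := by
      by_contra hcon
      push Not at hcon
      have hne : { v : ℝ | ∃ (m : ℕ) (Λ : POVM (Fin k → α) (Fin m)),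
          IYBE (sigmaOf (tpowAB ρ k) Λ) ≤ k * R ∧ v = IYB (sigmaOf (tpowAB ρ k) Λ) }.Nonempty := by
        let Λ : POVM (Fin k → α) (Fin 1) :=
          { elem := fun _ => 1
            pos := fun _ => Matrix.PosSemidef.one
            sum_eq := by simp }
        refine ⟨_, 1, Λ, ?_, rfl⟩
        rw [sigmaOf_eq hd.1, trivial_IYBE (canonical_norm hd.1 hd.2)]
        positivity
      have hle : P1 (tpowAB ρ k) (k * R) ≤ P1 (tpowAB ρ k) (k * R) - η / 2 := by
        conv_lhs => unfold P1
        refine csSup_le hne ?_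
        rintro v ⟨m, Λ, h1, rfl⟩
        exact (hcon m Λ h1).le
      linarith
    obtain ⟨m, Λ, h1, h2⟩ := hΛ
    rw [sigmaOf_eq hd.1] at h1 h2
    obtain ⟨s, hs, h3, h4⟩ := exists_SD (canonical_norm hd.1 hd.2) (canonical_pur hd.1) Λ
    rw [h3] at h1
    refine achieve_core hρ hk0 (Equiv.refl _) (Equiv.refl _) (fun _ _ _ _ => rfl) s hs h1 ?_
    rw [ptraceRight_tpowAB, ptraceLeft_tpowAB, kappa_tpow (density_ptraceRight hρ),
      kappa_tpow (density_ptraceLeft hρ)] at h4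
    rw [lt_div_iff₀ hkR] at hk1
    simp only [Fintype.card_pi_const, Nat.cast_pow, Real.log_pow] at h4
    rw [← h4]
    have hk2 : (1 : ℝ) ≤ k := by exact_mod_cast hk0
    have := mul_le_mul_of_nonneg_left hP hkR.le
    nlinarith
  intro ε hε δ hδ
  obtain ⟨N, hN⟩ := key (δ / 2) (by positivity) ε hε (δ / 2) (by positivity)
  refine ⟨N, fun n hn => ?_⟩
  obtain ⟨Pr, h1, h2, h3⟩ := hN n hn
  exact ⟨Pr, by linarith, by linarith, h3⟩

/-- **Direct coding part of the main theorem.** For any POVM `Λ` on Alice's system and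
`σ^{YBE} = (Λ ⊗ 1^{BE})(Ψ^{ABE})` for a purification `Ψ^{ABE}` of `ρ^{AB}`, the rate pair
`(κ(ρ^A) + κ(ρ^B) + I(Y;B)_σ , I(Y;BE)_σ)` is achievable; consequently every
`P ≤ κ*_→(ρ^{AB},R)` corresponds to an achievable rate pair `(P,R)`. -/
theorem direct_coding {α β γE : Type*} [Fintype α] [DecidableEq α] [Fintype β]
    [DecidableEq β] [Fintype γE] [DecidableEq γE]
    (ρ : Matrix (α × β) (α × β) ℂ) (hρ : IsDensity ρ)
    (ψ : (α × β) × γE → ℂ) (hψ : star ψ ⬝ᵥ ψ = 1)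
    (hpur : ptraceRight (vecMulVec ψ (star ψ)) = ρ)
    {m : ℕ} (Λ : POVM α (Fin m)) :
    Achievable ρ
      (kappa (ptraceRight ρ) + kappa (ptraceLeft ρ) +
        IYB (measureLeft Λ (Matrix.reindex (Equiv.prodAssoc α β γE)
          (Equiv.prodAssoc α β γE) (vecMulVec ψ (star ψ)))))
      (IYBE (measureLeft Λ (Matrix.reindex (Equiv.prodAssoc α β γE)
        (Equiv.prodAssoc α β γE) (vecMulVec ψ (star ψ)))))
    ∧ ∀ R : ℝ, 0 ≤ R → ∀ Pinf : ℝ,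
        Filter.Tendsto (fun n : ℕ => P1 (tpowAB ρ n) (n * R) / n)
          Filter.atTop (nhds Pinf) →
        ∀ P : ℝ, P ≤ kappa (ptraceRight ρ) + kappa (ptraceLeft ρ) + Pinf →
          Achievable ρ P R := by
  exact ⟨direct_part1 hρ hψ hpur Λ, fun R hR Pinf hlim P hP => direct_part2 hρ hR hlim hP⟩

end LPD
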